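/- (Optimal error estimate for the fully discrete 1D OEDG method; Theorem 4.1 with d = 1.) Assume: the partition is quasi-uniform (h ≤ γ min_j h_j for a fixed γ); the time step satisfies τ ≤ C_CFL h^κ with κ ≥ 1, under which the RKDG scheme without the OE procedure (i.e., with F_τ replaced by the identity, and allowing stage source terms g^{n,ℓ} added as τ d_{ℓm} in each stage) is stable in the sense ‖u_h^{n+1}‖²_{L²(Ω)} ≤ (1 + C_s τ)‖u_h^n‖²_{L²(Ω)} + C τ Σ_{0≤ℓ<s}‖g^{n,ℓ}‖²_{L²(Ω)}; the Runge–Kutta method has order r with r ≥ 2 (r > d/2 + 1) and k ≥ 1 (k > d/2); ‖u_h^{n,ℓ} − avg(u_h^{n,ℓ})‖_{L∞(Ω)} ≥ c₀ > 0 uniformly for all n and ℓ; the exact solution u of u_t + βu_x = 0 is sufficiently smooth; and ‖u_σ^0 − u(·,0)‖_{L²(Ω)} ≤ C h^{k+1}. Then there exists a constant C, independent of h, τ, and n (depending on k, s, r, the Runge–Kutta coefficients, β, γ, c₀, T, and Sobolev norms of u), such that max_{0≤n≤n⋆} ‖u_σ^n − u(·, nτ)‖_{L²(Ω)} ≤ C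 (h^{k+1} + τ^r), where T = n⋆ τ is the final time. -/

import Mathlib

open Polynomial Finset MeasureTheory

namespace OEDG

variable {N : ℕ}

/-- `pt` lists the nodes `x_{1/2} < x_{3/2} < … < x_{N+1/2}` of a partition of `Ω = [0,1]`. -/
def IsMesh (pt : Fin (N+1) → ℝ) : Prop :=
  pt 0 = 0 ∧ pt (Fin.last N) = 1 ∧ StrictMono pt

/-- Left endpoint of cell `j`. -/
def ptL (pt : Fin (N+1) → ℝ) (j : Fin N) : ℝ := pt j.castSucc

/-- Right endpoint of cell `j`. -/
def ptR (pt : Fin (N+1) → ℝ) (j : Fin N) : ℝ := pt j.succ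

/-- Length `h_j` of cell `j`. -/
def cellh (pt : Fin (N+1) → ℝ) (j : Fin N) : ℝ := ptR pt j - ptL pt j

/-- Maximal mesh size `h`. -/
noncomputable def meshSize (pt : Fin (N+1) → ℝ) : ℝ := ⨆ j : Fin N, cellh pt j

/-- Quasi-uniformity of the partition: `h ≤ γ h_j` for all `j`. -/
def QuasiUniform (pt : Fin (N+1) → ℝ) (γ : ℝ) : Prop :=
  ∀ j : Fin N, meshSize pt ≤ γ * cellh pt j

/-- Membership in `V^k`: every cell polynomial has degree at most `k`. -/
def MemVk (k : ℕ) (u : Fin N → Polynomial ℝ) : Prop :=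
  ∀ j, (u j).natDegree ≤ k

/-- Cellwise `L²` inner product. -/
noncomputable def cip (pt : Fin (N+1) → ℝ) (j : Fin N) (p q : Polynomial ℝ) : ℝ :=
  ∫ x in (ptL pt j)..(ptR pt j), p.eval x * q.eval x

/-- Global `L²(Ω)` inner product of piecewise polynomials. -/
noncomputable def ip (pt : Fin (N+1) → ℝ) (u v : Fin N → Polynomial ℝ) : ℝ :=
  ∑ j : Fin N, cip pt j (u j) (v j)

/-- Cellwise `L²` norm. -/
noncomputable def cl2 (pt : Fin (N+1) → ℝ) (j : Fin N) (p : Polynomial ℝ) : ℝ :=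
  Real.sqrt (cip pt j p p)

/-- Global `L²(Ω)` norm of a piecewise polynomial. -/
noncomputable def l2 (pt : Fin (N+1) → ℝ) (u : Fin N → Polynomial ℝ) : ℝ :=
  Real.sqrt (ip pt u u)

/-- Average `avg(u) = (1/|Ω|) ∫_Ω u dx` (here `|Ω| = 1`). -/
noncomputable def avg (pt : Fin (N+1) → ℝ) (u : Fin N → Polynomial ℝ) : ℝ :=
  ∑ j : Fin N, ∫ x in (ptL pt j)..(ptR pt j), (u j).eval x

/-- `‖u - c‖_{L∞(Ω)}` for a piecewise polynomial `u` and a constant `c`. -/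
noncomputable def linfSub (pt : Fin (N+1) → ℝ) (u : Fin N → Polynomial ℝ) (c : ℝ) : ℝ :=
  ⨆ j : Fin N, sSup ((fun x => |(u j).eval x - c|) '' Set.Icc (ptL pt j) (ptR pt j))

/-- `m`-th derivative of a polynomial. -/
noncomputable def pderiv (m : ℕ) (p : Polynomial ℝ) : Polynomial ℝ :=
  (fun q : Polynomial ℝ => Polynomial.derivative q)^[m] p

/-- Jump `[∂_x^m u]_{j+1/2}` of the `m`-th derivative at the interface to the right of
cell `j`, with periodic identification of `x_{N+1/2}` with `x_{1/2}`. -/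
noncomputable def jumpD [NeZero N] (pt : Fin (N+1) → ℝ) (u : Fin N → Polynomial ℝ)
    (m : ℕ) (j : Fin N) : ℝ :=
  (pderiv m (u (j+1))).eval (pt (Fin.castSucc (j+1))) - (pderiv m (u j)).eval (pt j.succ)

/-- The scale-invariant damping coefficient `σ_j^m(u)` of the OEDG method. -/
noncomputable def sigma [NeZero N] (k : ℕ) (pt : Fin (N+1) → ℝ)
    (u : Fin N → Polynomial ℝ) (m : ℕ) (j : Fin N) : ℝ :=
  if ∀ i, u i = Polynomial.C (avg pt u) then 0
  else (2*(m:ℝ)+1) * (cellh pt j)^m / ((2*(k:ℝ)-1) * (Nat.factorial m)) *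
    ((|jumpD pt u m (j-1)| + |jumpD pt u m j|) / (2 * linfSub pt u (avg pt u)))

/-- Damping rate `δ_j^m = β_j σ_j^m(u) / h_j`. -/
noncomputable def dampRate [NeZero N] (k : ℕ) (pt : Fin (N+1) → ℝ) (β : Fin N → ℝ)
    (u : Fin N → Polynomial ℝ) (m : ℕ) (j : Fin N) : ℝ :=
  β j * sigma k pt u m j / cellh pt j

/-- `Pc j d` is the cellwise `L²(I_j)`-orthogonal projection onto `ℙ^d(I_j)`.
(The family `Pc` realizes the global projections `P^d` onto `V^d`.) -/
def IsCellProj (pt : Fin (N+1) → ℝ)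
    (Pc : Fin N → ℕ → Polynomial ℝ → Polynomial ℝ) : Prop :=
  ∀ (j : Fin N) (dd : ℕ) (p : Polynomial ℝ), (Pc j dd p).natDegree ≤ dd ∧
    ∀ q : Polynomial ℝ, q.natDegree ≤ dd → cip pt j (p - Pc j dd p) q = 0

/-- `w` solves the damping initial value problem with initial data `u`:
`d/dt̂ ∫_{I_j} u_σ v dx + ∑_{m=0}^k (β_j σ_j^m(u)/h_j) ∫_{I_j} (u_σ - P^{m-1} u_σ) v dx = 0`
for every `v ∈ ℙ^k(I_j)` and every `j`, with `u_σ(·,0) = u`.  (Note `m - 1` is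
truncated ℕ-subtraction, which realizes the convention `P^{-1} = P^0`.) -/
def IsDampingSol [NeZero N] (k : ℕ) (pt : Fin (N+1) → ℝ) (β : Fin N → ℝ)
    (Pc : Fin N → ℕ → Polynomial ℝ → Polynomial ℝ)
    (u : Fin N → Polynomial ℝ) (w : ℝ → Fin N → Polynomial ℝ) : Prop :=
  w 0 = u ∧ (∀ t j, (w t j).natDegree ≤ k) ∧
  ∀ (t : ℝ) (j : Fin N) (v : Polynomial ℝ), v.natDegree ≤ k →
    HasDerivAt (fun s => cip pt j (w s j) v)
      (-(∑ m ∈ Finset.range (k+1),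
        dampRate k pt β u m j * cip pt j (w t j - Pc j (m-1) (w t j)) v)) t

/-- `Fτ` is the OE (oscillation-eliminating) operator: for every `u ∈ V^k` the damping
initial value problem has a solution `w` and `Fτ u = w τ`. -/
def IsOEOp [NeZero N] (k : ℕ) (pt : Fin (N+1) → ℝ) (β : Fin N → ℝ)
    (Pc : Fin N → ℕ → Polynomial ℝ → Polynomial ℝ) (τ : ℝ)
    (Fτ : (Fin N → Polynomial ℝ) → (Fin N → Polynomial ℝ)) : Prop :=
  ∀ u, MemVk k u → ∃ w, IsDampingSol k pt β Pc u w ∧ Fτ u = w τ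

/-- Right-hand side of the weak form of the upwind DG operator for `u_t + β u_x = 0`:
`β ∫_{I_j} w v_x dx - β w(x_{j+1/2}^-) v(x_{j+1/2}^-) + β w(x_{j-1/2}^-) v(x_{j-1/2}^+)`. -/
noncomputable def dgRHS [NeZero N] (pt : Fin (N+1) → ℝ) (β : ℝ)
    (w : Fin N → Polynomial ℝ) (j : Fin N) (v : Polynomial ℝ) : ℝ :=
  β * (∫ x in (ptL pt j)..(ptR pt j), (w j).eval x * (Polynomial.derivative v).eval x)
  - β * (w j).eval (ptR pt j) * v.eval (ptR pt j)
  + β * (w (j-1)).eval (pt (j-1).succ) * v.eval (ptL pt j)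

/-- `L` is the upwind DG spatial operator on `V^k`. -/
def IsDGOp [NeZero N] (k : ℕ) (pt : Fin (N+1) → ℝ) (β : ℝ)
    (L : (Fin N → Polynomial ℝ) → (Fin N → Polynomial ℝ)) : Prop :=
  ∀ w, MemVk k w → MemVk k (L w) ∧
    ∀ (j : Fin N) (v : Polynomial ℝ), v.natDegree ≤ k →
      cip pt j (L w j) v = dgRHS pt β w j v

/-- The upwind DG bilinear form
`H(w,v) = β ∑_j ∫_{I_j} w v_x dx + β ∑_j w(x_{j+1/2}^-) [v]_{j+1/2}`. -/
noncomputable def Hform [NeZero N] (pt : Fin (N+1) → ℝ) (β : ℝ)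
    (w v : Fin N → Polynomial ℝ) : ℝ :=
  β * ∑ j : Fin N, (∫ x in (ptL pt j)..(ptR pt j),
      (w j).eval x * (Polynomial.derivative (v j)).eval x)
  + β * ∑ j : Fin N, (w j).eval (ptR pt j) * jumpD pt v 0 j

/-- The upwind DG bilinear form with piecewise-smooth first argument. -/
noncomputable def HformF [NeZero N] (pt : Fin (N+1) → ℝ) (β : ℝ)
    (w : Fin N → ℝ → ℝ) (v : Fin N → Polynomial ℝ) : ℝ :=
  β * ∑ j : Fin N, (∫ x in (ptL pt j)..(ptR pt j),
      w j x * (Polynomial.derivative (v j)).eval x)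
  + β * ∑ j : Fin N, w j (ptR pt j) * jumpD pt v 0 j

/-- `L²(Ω)` pairing of a piecewise-smooth function with a piecewise polynomial. -/
noncomputable def ipF (pt : Fin (N+1) → ℝ) (w : Fin N → ℝ → ℝ)
    (v : Fin N → Polynomial ℝ) : ℝ :=
  ∑ j : Fin N, ∫ x in (ptL pt j)..(ptR pt j), w j x * (v j).eval x

/-- One Runge–Kutta stage: `∑_{0≤m≤ℓ} (c_{ℓm} u_σ^{n,m} + τ d_{ℓm} L(u_σ^{n,m}))`. -/
noncomputable def rkStage [NeZero N] (c d : ℕ → ℕ → ℝ) (τ : ℝ)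
    (L : (Fin N → Polynomial ℝ) → (Fin N → Polynomial ℝ))
    (uσ : ℕ → Fin N → Polynomial ℝ) (ℓ : ℕ) : Fin N → Polynomial ℝ :=
  fun j => ∑ m ∈ Finset.range (ℓ+1),
    (Polynomial.C (c ℓ m) * uσ m j + Polynomial.C (τ * d ℓ m) * L (uσ m) j)

/-- One full OEDG time step from `u_σ^n = un`: the stages `u_h^{n,ℓ+1}` and
`u_σ^{n,ℓ+1} = F_τ u_h^{n,ℓ+1}`, `0 ≤ ℓ ≤ s-1`. -/
def IsOEDGStep [NeZero N] (s : ℕ) (c d : ℕ → ℕ → ℝ) (τ : ℝ)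
    (L Fτ : (Fin N → Polynomial ℝ) → (Fin N → Polynomial ℝ))
    (un : Fin N → Polynomial ℝ) (uh uσ : ℕ → Fin N → Polynomial ℝ) : Prop :=
  uσ 0 = un ∧ ∀ ℓ < s, uh (ℓ+1) = rkStage c d τ L uσ ℓ ∧ uσ (ℓ+1) = Fτ (uh (ℓ+1))

/-- The full OEDG evolution: `uσ n ℓ = u_σ^{n,ℓ}` and `uh n ℓ = u_h^{n,ℓ}`, starting from
`u_σ^0 = u0`, with `u_σ^{n+1} = u_σ^{n,s}`. -/
def IsOEDGEvol [NeZero N] (s : ℕ) (c d : ℕ → ℕ → ℝ) (τ : ℝ)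
    (L Fτ : (Fin N → Polynomial ℝ) → (Fin N → Polynomial ℝ))
    (u0 : Fin N → Polynomial ℝ) (uh uσ : ℕ → ℕ → Fin N → Polynomial ℝ) : Prop :=
  uσ 0 0 = u0 ∧ ∀ n, uσ (n+1) 0 = uσ n s ∧
    ∀ ℓ < s, uh n (ℓ+1) = rkStage c d τ L (uσ n) ℓ ∧ uσ n (ℓ+1) = Fτ (uh n (ℓ+1))

/-- `p` is the Gauss–Radau projection of `w` on `[a,b]` into `ℙ^k`:
`∫_a^b (w - p) q dx = 0` for all `q ∈ ℙ^{k-1}` and `p(b) = w(b)`. -/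
def IsGRProj (k : ℕ) (a b : ℝ) (w : ℝ → ℝ) (p : Polynomial ℝ) : Prop :=
  p.natDegree ≤ k ∧
  (∀ q : Polynomial ℝ, q.natDegree < k →
    (∫ x in a..b, (w x - p.eval x) * q.eval x) = 0) ∧
  p.eval b = w b

/-- `u = u(x,t)` is a smooth `1`-periodic exact solution of `u_t + β u_x = 0`. -/
def IsSmoothSolution (β : ℝ) (u : ℝ → ℝ → ℝ) : Prop :=
  ContDiff ℝ (⊤ : ℕ∞) (fun p : ℝ × ℝ => u p.1 p.2) ∧
  (∀ x t, u (x+1) t = u x t) ∧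
  (∀ x t, deriv (fun s => u x s) t + β * deriv (fun y => u y t) x = 0)

/-- Auxiliary table for the reference functions `U^{n,ℓ}`. -/
noncomputable def UrefUpTo (u : ℝ → ℝ → ℝ) (c d : ℕ → ℕ → ℝ) (β τ : ℝ) (n : ℕ) :
    ℕ → ℕ → ℝ → ℝ
  | 0 => fun _ => fun x => u x ((n:ℝ) * τ)
  | (ℓ+1) => fun i =>
      if i ≤ ℓ then UrefUpTo u c d β τ n ℓ i
      else fun x => ∑ m ∈ Finset.range (ℓ+1),
        (c ℓ m * UrefUpTo u c d β τ n ℓ m x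
          - τ * d ℓ m * β * deriv (UrefUpTo u c d β τ n ℓ m) x)

/-- Reference function `U^{n,ℓ}` (for `0 ≤ ℓ ≤ s-1`): `U^{n,0} = u(·, t^n)` and
`U^{n,ℓ+1} = ∑_{0≤m≤ℓ} (c_{ℓm} U^{n,m} - τ d_{ℓm} β ∂_x U^{n,m})`. -/
noncomputable def Uref (u : ℝ → ℝ → ℝ) (c d : ℕ → ℕ → ℝ) (β τ : ℝ) (n ℓ : ℕ) : ℝ → ℝ :=
  UrefUpTo u c d β τ n ℓ ℓ

/-- Reference function `U^{n,ℓ}` including the final stage `U^{n,s} := u(·, t^{n+1})`. -/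
noncomputable def UrefS (u : ℝ → ℝ → ℝ) (c d : ℕ → ℕ → ℝ) (β τ : ℝ) (s n ℓ : ℕ) : ℝ → ℝ :=
  if ℓ = s then fun x => u x (((n:ℝ)+1) * τ) else Uref u c d β τ n ℓ

/-- The Runge–Kutta residual `ρ^{n,s-1}`, defined so that
`U^{n,s} = ∑_{0≤m≤s-1} (c_{s-1,m} U^{n,m} - τ d_{s-1,m} β ∂_x U^{n,m}) + τ ρ^{n,s-1}`. -/
noncomputable def rkRes (u : ℝ → ℝ → ℝ) (c d : ℕ → ℕ → ℝ) (β τ : ℝ) (s n : ℕ) : ℝ → ℝ :=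
  fun x => (u x (((n:ℝ)+1) * τ) - ∑ m ∈ Finset.range s,
    (c (s-1) m * Uref u c d β τ n m x
      - τ * d (s-1) m * β * deriv (Uref u c d β τ n m) x)) / τ

/-- `L²(0,1)` norm of a function. -/
noncomputable def fl2 (f : ℝ → ℝ) : ℝ := Real.sqrt (∫ x in (0:ℝ)..1, (f x)^2)

/-- `L²(Ω)` distance between a piecewise polynomial and a function. -/
noncomputable def errL2 (pt : Fin (N+1) → ℝ) (w : Fin N → Polynomial ℝ) (f : ℝ → ℝ) : ℝ :=
  Real.sqrt (∑ j : Fin N, ∫ x in (ptL pt j)..(ptR pt j), ((w j).eval x - f x)^2)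

/-! ### Polynomial inner products on an interval -/

lemma pderiv_eq (m : ℕ) (p : ℝ[X]) : pderiv m p = derivative^[m] p := rfl

@[simp] lemma pderiv_zero (p : ℝ[X]) : pderiv 0 p = p := rfl

lemma pderiv_sub (m : ℕ) (p q : ℝ[X]) : pderiv m (p - q) = pderiv m p - pderiv m q := by
  simp only [pderiv_eq, iterate_derivative_sub]

/-- The `L²(a,b)` inner product of polynomials as a bilinear form. -/
noncomputable def ibil (a b : ℝ) : LinearMap.BilinForm ℝ ℝ[X] :=
  LinearMap.mk₂ ℝ (fun p q => ∫ x in a..b, p.eval x * q.eval x)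
    (fun p p' q => by
      rw [← intervalIntegral.integral_add]
      · simp only [eval_add, add_mul]
      · exact (p.continuous.mul q.continuous).intervalIntegrable _ _
      · exact (p'.continuous.mul q.continuous).intervalIntegrable _ _)
    (fun c p q => by
      simp only [eval_smul, smul_eq_mul, mul_assoc, intervalIntegral.integral_const_mul])
    (fun p q q' => by
      rw [← intervalIntegral.integral_add]
      · simp only [eval_add, mul_add]
      · exact (p.continuous.mul q.continuous).intervalIntegrable _ _
      · exact (p.continuous.mul q'.continuous).intervalIntegrable _ _)
    (fun c p q => by
      simp only [eval_smul, smul_eq_mul, mul_left_comm, intervalIntegral.integral_const_mul])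

lemma ibil_apply (a b : ℝ) (p q : ℝ[X]) :
    ibil a b p q = ∫ x in a..b, p.eval x * q.eval x := rfl

lemma cip_eq (pt : Fin (N+1) → ℝ) (j : Fin N) (p q : ℝ[X]) :
    cip pt j p q = ibil (ptL pt j) (ptR pt j) p q := rfl

lemma ibil_comm (a b : ℝ) (p q : ℝ[X]) : ibil a b p q = ibil a b q p := by
  simp only [ibil_apply, mul_comm]

lemma ibil_self_nonneg {a b : ℝ} (hab : a ≤ b) (p : ℝ[X]) : 0 ≤ ibil a b p p :=
  intervalIntegral.integral_nonneg hab fun _ _ => mul_self_nonneg _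

/-- A polynomial whose weighted square integral vanishes is zero. -/
lemma eq_zero_of_integral_mul_sq {a b : ℝ} (hab : a < b) (g : ℝ → ℝ) (hg : Continuous g)
    (hpos : ∀ x ∈ Set.Ioo a b, 0 < g x) (p : ℝ[X])
    (h : ∫ x in a..b, g x * (p.eval x * p.eval x) = 0) : p = 0 := by
  by_contra hp
  have hcont : Continuous fun x => g x * (p.eval x * p.eval x) :=
    hg.mul (p.continuous.mul p.continuous)
  obtain ⟨x, hx, hne⟩ : ∃ x ∈ Set.Ioo a b, p.eval x ≠ 0 := by
    by_contra hcon
    push Not at hcon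
    exact hp (eq_zero_of_infinite_isRoot p ((Set.Ioo_infinite hab).mono fun x hx => hcon x hx))
  have hgn : ∀ x ∈ Set.Icc a b, 0 ≤ g x := by
    intro x hx
    have : x ∈ closure (Set.Ioo a b) := by rwa [closure_Ioo hab.ne]
    exact closure_minimal (fun y hy => (hpos y hy).le)
      (isClosed_le continuous_const hg) this
  have := intervalIntegral.integral_pos hab hcont.continuousOn
    (fun y hy => mul_nonneg (hgn y (Set.Ioc_subset_Icc_self hy)) (mul_self_nonneg _))
    ⟨x, Set.Ioo_subset_Icc_self hx, mul_pos (hpos x hx) (mul_self_pos.2 hne)⟩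
  exact this.ne' h

lemma eq_zero_of_ibil_self {a b : ℝ} (hab : a < b) {p : ℝ[X]} (h : ibil a b p p = 0) :
    p = 0 :=
  eq_zero_of_integral_mul_sq hab (fun _ => 1) continuous_const (fun _ _ => one_pos) p
    (by simpa [ibil_apply] using h)

/-! ### Seminorms of positive semidefinite symmetric forms -/

section BilinNorm

variable {V : Type*} [AddCommGroup V] [Module ℝ V] {B : LinearMap.BilinForm ℝ V}

lemma bilin_abs_le (hs : ∀ x, 0 ≤ B x x) (hc : ∀ x y, B x y = B y x) (x y : V) :
    |B x y| ≤ √(B x x) * √(B y y) := by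
  rw [← Real.sqrt_mul (hs x)]
  refine Real.abs_le_sqrt ?_
  rw [sq]
  nth_rewrite 2 [hc x y]
  exact LinearMap.BilinForm.apply_mul_apply_le_of_forall_zero_le B hs x y

lemma bilin_sqrt_add_le (hs : ∀ x, 0 ≤ B x x) (hc : ∀ x y, B x y = B y x) (x y : V) :
    √(B (x + y) (x + y)) ≤ √(B x x) + √(B y y) := by
  refine Real.sqrt_le_iff.2 ⟨by positivity, ?_⟩
  have h := (abs_le.1 (bilin_abs_le hs hc x y)).2
  have h1 := Real.sq_sqrt (hs x)
  have h2 := Real.sq_sqrt (hs y)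
  simp only [map_add, LinearMap.add_apply, hc y x]
  nlinarith

lemma bilin_sqrt_smul (c : ℝ) (x : V) : √(B (c • x) (c • x)) = |c| * √(B x x) := by
  simp only [map_smul, LinearMap.smul_apply, smul_eq_mul]
  rw [← mul_assoc, Real.sqrt_mul (mul_self_nonneg c), Real.sqrt_mul_self_eq_abs]

end BilinNorm

/-- The `L²(a,b)` norm of a polynomial. -/
noncomputable def inorm (a b : ℝ) (p : ℝ[X]) : ℝ := √(ibil a b p p)

lemma inorm_nonneg (a b : ℝ) (p : ℝ[X]) : 0 ≤ inorm a b p := Real.sqrt_nonneg _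

lemma inorm_sq {a b : ℝ} (hab : a ≤ b) (p : ℝ[X]) : inorm a b p ^ 2 = ibil a b p p :=
  Real.sq_sqrt (ibil_self_nonneg hab p)

lemma inorm_add_le {a b : ℝ} (hab : a ≤ b) (p q : ℝ[X]) :
    inorm a b (p + q) ≤ inorm a b p + inorm a b q :=
  bilin_sqrt_add_le (ibil_self_nonneg hab) (ibil_comm a b) p q

lemma ibil_abs_le {a b : ℝ} (hab : a ≤ b) (p q : ℝ[X]) :
    |ibil a b p q| ≤ inorm a b p * inorm a b q :=
  bilin_abs_le (ibil_self_nonneg hab) (ibil_comm a b) p q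

lemma inorm_le_of_abs_le {a b M : ℝ} (hab : a ≤ b) (hM : 0 ≤ M) (p : ℝ[X])
    (h : ∀ x ∈ Set.Icc a b, |p.eval x| ≤ M) : inorm a b p ≤ M * √(b - a) := by
  have h1 : ibil a b p p ≤ ∫ _ in a..b, M ^ 2 := by
    refine intervalIntegral.integral_mono_on hab
      ((p.continuous.mul p.continuous).intervalIntegrable _ _)
      (continuous_const.intervalIntegrable _ _) fun x hx => ?_
    have := h x hx
    have h0 := abs_nonneg (p.eval x)
    nlinarith [abs_mul_abs_self (p.eval x)]
  rw [intervalIntegral.integral_const, smul_eq_mul] at h1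
  refine Real.sqrt_le_iff.2 ⟨by positivity, h1.trans (le_of_eq ?_)⟩
  rw [mul_pow, Real.sq_sqrt (sub_nonneg.2 hab), mul_comm]

/-! ### Estimates on the reference interval -/

/-- The polynomial with prescribed coefficients. -/
noncomputable def ofCoeffs (k : ℕ) : (Fin (k+1) → ℝ) →ₗ[ℝ] ℝ[X] where
  toFun c := ∑ i, c i • (X : ℝ[X]) ^ (i : ℕ)
  map_add' c c' := by simp [add_smul, sum_add_distrib]
  map_smul' r c := by simp [mul_smul, smul_sum]

lemma ofCoeffs_apply (k : ℕ) (c : Fin (k+1) → ℝ) :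
    ofCoeffs k c = ∑ i, c i • (X : ℝ[X]) ^ (i : ℕ) := rfl

lemma ofCoeffs_natDegree (k : ℕ) (c : Fin (k+1) → ℝ) : (ofCoeffs k c).natDegree ≤ k := by
  rw [ofCoeffs_apply]
  refine natDegree_sum_le_of_forall_le (S := ℝ) _ _ fun i _ => ?_
  exact (natDegree_smul_le _ _).trans ((natDegree_X_pow_le _).trans (by omega))

lemma ofCoeffs_coeff {k : ℕ} {p : ℝ[X]} (hp : p.natDegree ≤ k) :
    ofCoeffs k (fun i => p.coeff i) = p := by
  rw [ofCoeffs_apply, Fin.sum_univ_eq_sum_range (fun i => p.coeff i • (X : ℝ[X]) ^ i)]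
  conv_rhs => rw [p.as_sum_range_C_mul_X_pow' (Nat.lt_succ_of_le hp)]
  simp only [smul_eq_C_mul]

lemma ofCoeffs_eq_zero {k : ℕ} {c : Fin (k+1) → ℝ} (h : ofCoeffs k c = 0) : c = 0 := by
  funext i
  have := congrArg (fun p => p.coeff (i : ℕ)) h
  simpa [ofCoeffs_apply, finsetSum_coeff, coeff_X_pow, Fin.val_inj] using this

lemma abs_pderiv_ofCoeffs_le (k m : ℕ) (c : Fin (k+1) → ℝ) {t : ℝ} (ht : t ∈ Set.Icc (0:ℝ) 1) :
    |(pderiv m (ofCoeffs k c)).eval t| ≤ ((k+1) * Nat.factorial k) * ‖c‖ := by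
  rw [ofCoeffs_apply, pderiv_eq, iterate_derivative_sum, eval_finsetSum]
  refine (abs_sum_le_sum_abs _ _).trans ?_
  have : ∀ i ∈ (univ : Finset (Fin (k+1))),
      |eval t (derivative^[m] (c i • (X : ℝ[X]) ^ (i : ℕ)))| ≤ Nat.factorial k * ‖c‖ := by
    intro i _
    rw [smul_eq_C_mul, iterate_derivative_C_mul, iterate_derivative_X_pow_eq_natCast_mul]
    simp only [eval_mul, eval_C, eval_natCast, eval_pow, eval_X, abs_mul, abs_pow]
    have h1 : |c i| ≤ ‖c‖ := by simpa using norm_le_pi_norm c i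
    have h2 : |t| ^ ((i : ℕ) - m) ≤ 1 :=
      pow_le_one₀ (abs_nonneg _) (abs_le.2 ⟨by linarith [ht.1], ht.2⟩)
    have h3 : ((Nat.descFactorial i m : ℕ) : ℝ) ≤ Nat.factorial k := by
      have : Nat.descFactorial i m ≤ Nat.factorial i := by
        rcases le_or_gt m (i : ℕ) with hm | hm
        · rw [← Nat.factorial_mul_descFactorial hm]
          exact Nat.le_mul_of_pos_left _ (Nat.factorial_pos _)
        · rw [Nat.descFactorial_of_lt hm]; exact Nat.zero_le _
      exact_mod_cast this.trans (Nat.factorial_le (by omega))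
    rw [Nat.abs_cast]
    calc |c i| * (((i : ℕ).descFactorial m : ℝ) * |t| ^ ((i : ℕ) - m))
        ≤ ‖c‖ * (Nat.factorial k * 1) := by gcongr
      _ = _ := by ring
  refine (sum_le_sum this).trans (le_of_eq ?_)
  simp [mul_assoc]

lemma exists_norm_le_of_injective {n : ℕ} (f : (Fin n → ℝ) →ₗ[ℝ] (Fin n → ℝ))
    (hf : ∀ x, f x = 0 → x = 0) : ∃ C : ℝ, 0 < C ∧ ∀ x, ‖x‖ ≤ C * ‖f x‖ := by
  obtain ⟨K, hK, h⟩ := f.exists_antilipschitzWith (LinearMap.ker_eq_bot'.2 hf)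
  refine ⟨K, by exact_mod_cast hK, fun x => ?_⟩
  simpa using h.le_mul_dist x 0

lemma abs_integral_mul_X_pow_le {w : ℝ → ℝ} {M : ℝ}
    (h : ∀ x ∈ Set.Icc (0:ℝ) 1, |w x| ≤ M) (i : ℕ) :
    |∫ x in (0:ℝ)..1, w x * x ^ i| ≤ M := by
  have := intervalIntegral.norm_integral_le_of_norm_le_const (a := (0:ℝ)) (b := 1)
    (f := fun x => w x * x ^ i) (C := M) (fun x hx => by
      rw [Set.uIoc_of_le zero_le_one] at hx
      rw [norm_mul, norm_pow, Real.norm_eq_abs, Real.norm_eq_abs]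
      have h1 := h x ⟨hx.1.le, hx.2⟩
      have h2 : |x| ^ i ≤ 1 :=
        pow_le_one₀ (abs_nonneg _) (abs_le.2 ⟨by linarith [hx.1], hx.2⟩)
      calc |w x| * |x| ^ i ≤ |w x| * 1 := by gcongr
        _ ≤ M := by simpa using h1)
  simpa using this

/-- Inverse inequality on the reference interval. -/
lemma ref_inverse (k : ℕ) : ∃ C : ℝ, 0 < C ∧ ∀ p : ℝ[X], p.natDegree ≤ k → ∀ m : ℕ,
    ∀ t ∈ Set.Icc (0:ℝ) 1, |(pderiv m p).eval t| ≤ C * inorm 0 1 p := by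
  let f : (Fin (k+1) → ℝ) →ₗ[ℝ] (Fin (k+1) → ℝ) :=
    LinearMap.pi fun i => ((ibil 0 1).flip (X ^ (i : ℕ))).comp (ofCoeffs k)
  have hf : ∀ c i, f c i = ibil 0 1 (ofCoeffs k c) (X ^ (i : ℕ)) := fun c i => rfl
  obtain ⟨C, hC, h⟩ := exists_norm_le_of_injective f (fun c hc => by
    apply ofCoeffs_eq_zero
    refine eq_zero_of_ibil_self zero_lt_one ?_
    nth_rewrite 2 [ofCoeffs_apply]
    rw [map_sum]
    refine sum_eq_zero fun i _ => ?_
    rw [map_smul, ← hf, hc]; simp)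
  refine ⟨((k+1) * Nat.factorial k) * C, by positivity, fun p hp m t ht => ?_⟩
  have h1 := abs_pderiv_ofCoeffs_le k m (fun i => p.coeff i) ht
  rw [ofCoeffs_coeff hp] at h1
  refine h1.trans ?_
  rw [mul_assoc ((k+1 : ℝ) * _)]
  gcongr
  refine (h _).trans ?_
  gcongr
  refine (pi_norm_le_iff_of_nonneg (inorm_nonneg _ _ _)).2 fun i => ?_
  rw [hf, ofCoeffs_coeff hp, Real.norm_eq_abs]
  refine (ibil_abs_le zero_le_one _ _).trans ?_
  have : inorm 0 1 ((X : ℝ[X]) ^ (i : ℕ)) ≤ 1 * √(1 - 0) := by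
    refine inorm_le_of_abs_le zero_le_one zero_le_one _ fun x hx => ?_
    rw [eval_pow, eval_X, abs_pow]
    exact pow_le_one₀ (abs_nonneg _) (abs_le.2 ⟨by linarith [hx.1], hx.2⟩)
  calc inorm 0 1 p * inorm 0 1 ((X : ℝ[X]) ^ (i : ℕ)) ≤ inorm 0 1 p * (1 * √(1 - 0)) := by
        gcongr; exact inorm_nonneg _ _ _
    _ = _ := by simp

/-- Existence and stability of the Gauss–Radau projection on the reference interval. -/
lemma ref_gaussRadau (k : ℕ) : ∃ C : ℝ, 0 < C ∧ ∀ w : ℝ → ℝ, Continuous w →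
    (∃ p, IsGRProj k 0 1 w p) ∧ ∀ p, IsGRProj k 0 1 w p → ∀ M : ℝ,
      (∀ x ∈ Set.Icc (0:ℝ) 1, |w x| ≤ M) → ∀ m : ℕ, ∀ t ∈ Set.Icc (0:ℝ) 1,
      |(pderiv m p).eval t| ≤ C * M := by
  let f : (Fin (k+1) → ℝ) →ₗ[ℝ] (Fin (k+1) → ℝ) :=
    LinearMap.pi fun i => if (i : ℕ) < k then ((ibil 0 1).flip (X ^ (i : ℕ))).comp (ofCoeffs k)
      else (leval 1).comp (ofCoeffs k)
  have hf1 : ∀ c (i : Fin (k+1)), (i : ℕ) < k →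
      f c i = ibil 0 1 (ofCoeffs k c) (X ^ (i : ℕ)) := by
    intro c i hi
    simp only [f, LinearMap.pi_apply, if_pos hi]; rfl
  have hf2 : ∀ c (i : Fin (k+1)), ¬ (i : ℕ) < k → f c i = (ofCoeffs k c).eval 1 := by
    intro c i hi
    simp only [f, LinearMap.pi_apply, if_neg hi]; rfl
  have hlast : ¬ ((Fin.last k : Fin (k+1)) : ℕ) < k := by simp
  have hlow : ∀ (g : ℝ → ℝ), Continuous g → (∀ i < k, ∫ x in (0:ℝ)..1, g x * x ^ i = 0) →
      ∀ q : ℝ[X], q.natDegree < k → ∫ x in (0:ℝ)..1, g x * q.eval x = 0 := by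
    intro g hg h0 q hq
    have : (fun x => g x * q.eval x) =
        fun x => ∑ i ∈ range (q.natDegree + 1), q.coeff i * (g x * x ^ i) := by
      funext x
      rw [eval_eq_sum_range, mul_sum]
      exact sum_congr rfl fun i _ => by ring
    rw [this, intervalIntegral.integral_finsetSum]
    · refine sum_eq_zero fun i hi => ?_
      rw [intervalIntegral.integral_const_mul, h0 i (by have := mem_range.1 hi; omega), mul_zero]
    · intro i _
      exact (continuous_const.mul (hg.mul (continuous_id.pow i))).intervalIntegrable _ _
  have hinj : ∀ c, f c = 0 → c = 0 := by
    intro c hc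
    apply ofCoeffs_eq_zero
    set p := ofCoeffs k c with hp
    have hp1 : p.eval 1 = 0 := by
      rw [← hf2 c (Fin.last k) hlast, hc]; rfl
    obtain ⟨q, hq⟩ := dvd_iff_isRoot.2 hp1
    by_cases hq0 : q = 0
    · rw [hq, hq0, mul_zero]
    have hdeg : q.natDegree < k := by
      have h1 : p.natDegree = 1 + q.natDegree := by
        rw [hq, natDegree_mul (X_sub_C_ne_zero 1) hq0, natDegree_X_sub_C]
      have h2 : p.natDegree ≤ k := ofCoeffs_natDegree k c
      omega
    have := hlow (fun x => p.eval x) p.continuous (fun i hi => by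
      have := hf1 c ⟨i, by omega⟩ hi
      rw [hc] at this
      simpa [ibil_apply] using this.symm) q hdeg
    have hz : ∫ x in (0:ℝ)..1, (1 - x) * (q.eval x * q.eval x) = 0 := by
      rw [← neg_eq_zero, ← intervalIntegral.integral_neg]
      refine Eq.trans ?_ this
      refine intervalIntegral.integral_congr fun x _ => ?_
      simp only [hq, eval_mul, eval_sub, eval_X, eval_C]; ring
    have := eq_zero_of_integral_mul_sq zero_lt_one (fun x : ℝ => 1 - x) (by fun_prop)
      (fun x hx => by linarith [hx.2]) q hz
    exact absurd this hq0
  obtain ⟨C, hC, h⟩ := exists_norm_le_of_injective f hinj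
  have hsurj : Function.Surjective f :=
    LinearMap.injective_iff_surjective.1 ((injective_iff_map_eq_zero f).2 hinj)
  have hii : ∀ (w : ℝ → ℝ), Continuous w → ∀ (p : ℝ[X]) (i : ℕ),
      ∫ x in (0:ℝ)..1, (w x - p.eval x) * x ^ i
        = (∫ x in (0:ℝ)..1, w x * x ^ i) - ibil 0 1 p (X ^ i) := by
    intro w hw p i
    rw [ibil_apply, ← intervalIntegral.integral_sub]
    · simp only [eval_pow, eval_X, sub_mul]
    · exact (hw.mul (continuous_id.pow i)).intervalIntegrable _ _
    · exact (p.continuous.mul (X ^ i : ℝ[X]).continuous).intervalIntegrable _ _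
  refine ⟨((k+1) * Nat.factorial k) * C, by positivity, fun w hw => ⟨?_, ?_⟩⟩
  · obtain ⟨c, hc⟩ := hsurj (fun i => if (i : ℕ) < k then ∫ x in (0:ℝ)..1, w x * x ^ (i : ℕ)
      else w 1)
    refine ⟨ofCoeffs k c, ofCoeffs_natDegree k c, ?_, ?_⟩
    · refine hlow (fun x => w x - (ofCoeffs k c).eval x)
        (hw.sub (ofCoeffs k c).continuous) fun i hi => ?_
      have := hf1 c ⟨i, by omega⟩ hi
      rw [hc] at this
      simp only [if_pos hi] at this
      rw [hii w hw, this, sub_self]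
    · rw [← hf2 c (Fin.last k) hlast, hc]
      simp
  · intro p ⟨hp, hp0, hp1⟩ M hM m t ht
    have hM0 : 0 ≤ M := (abs_nonneg _).trans (hM 0 (by simp))
    have h1 := abs_pderiv_ofCoeffs_le k m (fun i => p.coeff i) ht
    rw [ofCoeffs_coeff hp] at h1
    refine h1.trans ?_
    rw [mul_assoc ((k+1 : ℝ) * _)]
    gcongr
    refine (h _).trans ?_
    gcongr
    refine (pi_norm_le_iff_of_nonneg hM0).2 fun i => ?_
    rw [Real.norm_eq_abs]
    by_cases hi : (i : ℕ) < k
    · rw [hf1 _ i hi, ofCoeffs_coeff hp]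
      have h2 := hp0 (X ^ (i : ℕ)) (by simpa using hi)
      simp only [eval_pow, eval_X] at h2
      rw [hii w hw, sub_eq_zero] at h2
      rw [← h2]
      exact abs_integral_mul_X_pow_le hM i
    · rw [hf2 _ i hi, ofCoeffs_coeff hp, hp1]
      exact hM 1 (by simp)

/-! ### Scaling to a general interval -/

/-- The pull-back of a polynomial on `[a,b]` to the reference interval `[0,1]`. -/
noncomputable def pull (a b : ℝ) (p : ℝ[X]) : ℝ[X] := p.comp (C a + C (b - a) * X)

lemma eval_pull (a b t : ℝ) (p : ℝ[X]) : (pull a b p).eval t = p.eval (a + (b - a) * t) := by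
  simp [pull]

lemma natDegree_pull_le (a b : ℝ) (p : ℝ[X]) : (pull a b p).natDegree ≤ p.natDegree := by
  refine natDegree_comp_le.trans ?_
  have : (C a + C (b - a) * X : ℝ[X]).natDegree ≤ 1 := by
    rw [add_comm]; exact natDegree_linear_le
  calc _ ≤ p.natDegree * 1 := Nat.mul_le_mul_left _ this
    _ = _ := mul_one _

lemma pderiv_pull (a b : ℝ) (m : ℕ) (p : ℝ[X]) :
    pderiv m (pull a b p) = C ((b - a) ^ m) * pull a b (pderiv m p) := by
  induction m with
  | zero => simp
  | succ m ih =>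
    have h : ∀ q : ℝ[X], derivative (pull a b q) = C (b - a) * pull a b (derivative q) := by
      intro q
      simp [pull, derivative_comp]
    simp only [pderiv_eq, Function.iterate_succ_apply'] at ih ⊢
    rw [ih, derivative_C_mul, h, ← mul_assoc, ← C_mul, pow_succ]

lemma integral_scale (a b : ℝ) (f : ℝ → ℝ) :
    ∫ x in a..b, f x = (b - a) * ∫ t in (0:ℝ)..1, f (a + (b - a) * t) := by
  rw [intervalIntegral.mul_integral_comp_add_mul]
  simp

lemma exists_mem_ref {a b x : ℝ} (hab : a < b) (hx : x ∈ Set.Icc a b) :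
    ∃ t ∈ Set.Icc (0:ℝ) 1, a + (b - a) * t = x := by
  have h : 0 < b - a := sub_pos.2 hab
  refine ⟨(x - a) / (b - a), ⟨div_nonneg (by linarith [hx.1]) h.le,
    (div_le_one h).2 (by linarith [hx.2])⟩, ?_⟩
  field_simp; ring

lemma mem_of_ref {a b t : ℝ} (hab : a < b) (ht : t ∈ Set.Icc (0:ℝ) 1) :
    a + (b - a) * t ∈ Set.Icc a b := by
  constructor <;> nlinarith [ht.1, ht.2]

lemma inorm_pull {a b : ℝ} (hab : a < b) (p : ℝ[X]) :
    √(b - a) * inorm 0 1 (pull a b p) = inorm a b p := by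
  rw [inorm, inorm, ← Real.sqrt_mul (sub_pos.2 hab).le, ibil_apply, ibil_apply,
    integral_scale a b]
  simp only [eval_pull]

/-- Inverse inequality for polynomials of degree at most `k`. -/
lemma inverse_inequality (k : ℕ) : ∃ C : ℝ, 0 < C ∧ ∀ a b : ℝ, a < b → ∀ p : ℝ[X],
    p.natDegree ≤ k → ∀ m : ℕ, ∀ x ∈ Set.Icc a b,
    (b - a) ^ m * |(pderiv m p).eval x| * √(b - a) ≤ C * inorm a b p := by
  obtain ⟨C, hC, h⟩ := ref_inverse k
  refine ⟨C, hC, fun a b hab p hp m x hx => ?_⟩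
  obtain ⟨t, ht, rfl⟩ := exists_mem_ref hab hx
  have := h (pull a b p) ((natDegree_pull_le a b p).trans hp) m t ht
  rw [pderiv_pull, eval_mul, eval_C, eval_pull, abs_mul,
    abs_of_nonneg (pow_nonneg (sub_pos.2 hab).le m)] at this
  rw [← inorm_pull hab]
  calc _ ≤ (C * inorm 0 1 (pull a b p)) * √(b - a) := by gcongr
    _ = _ := by ring

/-- The pull-back from the reference interval is inverted by the opposite pull-back. -/
lemma pull_pull {a b : ℝ} (hab : a < b) (p : ℝ[X]) :
    pull (-a / (b - a)) ((1 - a) / (b - a)) (pull a b p) = p := by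
  have h : b - a ≠ 0 := (sub_pos.2 hab).ne'
  refine Polynomial.funext fun x => ?_
  rw [eval_pull, eval_pull]
  congr 1
  field_simp; ring

lemma pull_pull' {a b : ℝ} (hab : a < b) (p : ℝ[X]) :
    pull a b (pull (-a / (b - a)) ((1 - a) / (b - a)) p) = p := by
  have h : b - a ≠ 0 := (sub_pos.2 hab).ne'
  refine Polynomial.funext fun x => ?_
  rw [eval_pull, eval_pull]
  congr 1
  field_simp; ring

lemma isGRProj_pull {k : ℕ} {a b : ℝ} (hab : a < b) {w : ℝ → ℝ} {p : ℝ[X]} :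
    IsGRProj k a b w p ↔ IsGRProj k 0 1 (fun t => w (a + (b - a) * t)) (pull a b p) := by
  have hb : b - a ≠ 0 := (sub_pos.2 hab).ne'
  have h1 : a + (b - a) * 1 = b := by ring
  have hd : ∀ q, (pull a b q).natDegree = q.natDegree := fun q =>
    le_antisymm (natDegree_pull_le a b q) (by
      conv_lhs => rw [← pull_pull hab q]
      exact natDegree_pull_le _ _ _)
  have hI : ∀ q : ℝ[X], ∫ x in a..b, (w x - p.eval x) * q.eval x = (b - a) *
      ∫ t in (0:ℝ)..1, (w (a + (b - a) * t) - (pull a b p).eval t) * (pull a b q).eval t := by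
    intro q
    rw [integral_scale a b]
    simp only [eval_pull]
  unfold IsGRProj
  rw [hd, eval_pull]
  simp only [h1]
  refine and_congr_right fun _ => and_congr_left fun _ => ⟨fun h q hq => ?_, fun h q hq => ?_⟩
  · have := hI (pull (-a / (b - a)) ((1 - a) / (b - a)) q)
    rw [pull_pull' hab, h _ ((natDegree_pull_le _ _ _).trans_lt hq)] at this
    exact (mul_eq_zero.1 this.symm).resolve_left hb
  · rw [hI, h _ ((hd q).trans_lt hq), mul_zero]

lemma exists_isGRProj (k : ℕ) {a b : ℝ} (hab : a < b) {w : ℝ → ℝ} (hw : Continuous w) :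
    ∃ p, IsGRProj k a b w p := by
  obtain ⟨C, hC, h⟩ := ref_gaussRadau k
  obtain ⟨q, hq⟩ := (h (fun t => w (a + (b - a) * t)) (by fun_prop)).1
  refine ⟨pull (-a / (b - a)) ((1 - a) / (b - a)) q, ?_⟩
  rw [isGRProj_pull hab, pull_pull' hab]
  exact hq

lemma isGRProj_bound (k : ℕ) : ∃ C : ℝ, 0 < C ∧ ∀ a b : ℝ, a < b → ∀ w : ℝ → ℝ,
    Continuous w → ∀ p, IsGRProj k a b w p → ∀ M : ℝ, (∀ x ∈ Set.Icc a b, |w x| ≤ M) →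
    ∀ m : ℕ, ∀ x ∈ Set.Icc a b, (b - a) ^ m * |(pderiv m p).eval x| ≤ C * M := by
  obtain ⟨C, hC, h⟩ := ref_gaussRadau k
  refine ⟨C, hC, fun a b hab w hw p hp M hM m x hx => ?_⟩
  obtain ⟨t, ht, rfl⟩ := exists_mem_ref hab hx
  have := (h (fun t => w (a + (b - a) * t)) (by fun_prop)).2 _ ((isGRProj_pull hab).1 hp) M
    (fun s hs => hM _ (mem_of_ref hab hs)) m t ht
  rwa [pderiv_pull, eval_mul, eval_C, eval_pull, abs_mul,
    abs_of_nonneg (pow_nonneg (sub_pos.2 hab).le m)] at this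

lemma IsGRProj.unique {k : ℕ} {a b : ℝ} (hab : a < b) {w : ℝ → ℝ} (hw : Continuous w)
    {p q : ℝ[X]} (hp : IsGRProj k a b w p) (hq : IsGRProj k a b w q) : p = q := by
  have hpq : IsGRProj k a b (fun _ => 0) (p - q) := by
    refine ⟨(natDegree_sub_le _ _).trans (max_le hp.1 hq.1), fun v hv => ?_,
      by simp [hp.2.2, hq.2.2]⟩
    have h1 := hp.2.1 v hv
    have h2 := hq.2.1 v hv
    have := intervalIntegral.integral_sub (μ := volume) (a := a) (b := b)
      (f := fun x => (w x - p.eval x) * v.eval x) (g := fun x => (w x - q.eval x) * v.eval x)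
      (((hw.sub p.continuous).mul v.continuous).intervalIntegrable a b)
      (((hw.sub q.continuous).mul v.continuous).intervalIntegrable a b)
    rw [h1, h2, sub_zero] at this
    refine Eq.trans ?_ this
    refine intervalIntegral.integral_congr fun x _ => ?_
    simp only [eval_sub]; ring
  obtain ⟨C, hC, h⟩ := isGRProj_bound k
  refine eq_of_infinite_eval_eq p q ((Set.Icc_infinite hab).mono fun x hx => ?_)
  have := h a b hab _ continuous_const _ hpq 0 (by simp) 0 x hx
  simp only [pow_zero, one_mul, mul_zero, pderiv_zero] at this
  have := abs_nonpos_iff.1 this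
  rw [eval_sub, sub_eq_zero] at this
  exact this

lemma IsGRProj.linComb {k : ℕ} {a b : ℝ} {ι : Type*} (S : Finset ι) (c : ι → ℝ)
    {w : ι → ℝ → ℝ} (hw : ∀ i ∈ S, Continuous (w i)) {p : ι → ℝ[X]}
    (h : ∀ i ∈ S, IsGRProj k a b (w i) (p i)) :
    IsGRProj k a b (fun x => ∑ i ∈ S, c i * w i x) (∑ i ∈ S, C (c i) * p i) := by
  refine ⟨natDegree_sum_le_of_forall_le (S := ℝ) _ _ fun i hi =>
    (natDegree_C_mul_le _ _).trans (h i hi).1, fun q hq => ?_, ?_⟩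
  · have : (fun x => ((∑ i ∈ S, c i * w i x) - (∑ i ∈ S, C (c i) * p i).eval x) * q.eval x)
        = fun x => ∑ i ∈ S, c i * ((w i x - (p i).eval x) * q.eval x) := by
      funext x
      rw [eval_finsetSum, ← sum_sub_distrib, sum_mul]
      exact sum_congr rfl fun i _ => by simp only [eval_mul, eval_C]; ring
    rw [this, intervalIntegral.integral_finsetSum]
    · refine sum_eq_zero fun i hi => ?_
      rw [intervalIntegral.integral_const_mul, (h i hi).2.1 q hq, mul_zero]
    · intro i hi
      exact (continuous_const.mul (((hw i hi).sub (p i).continuous).mul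
        q.continuous)).intervalIntegrable _ _
  · rw [eval_finsetSum]
    exact sum_congr rfl fun i hi => by rw [eval_mul, eval_C, (h i hi).2.2]

lemma IsGRProj.sub_poly {k : ℕ} {a b : ℝ} {w : ℝ → ℝ} {p q : ℝ[X]} (h : IsGRProj k a b w p)
    (hq : q.natDegree ≤ k) : IsGRProj k a b (fun x => w x - q.eval x) (p - q) := by
  refine ⟨(natDegree_sub_le _ _).trans (max_le h.1 hq), fun v hv => ?_, by simp [h.2.2]⟩
  rw [← h.2.1 v hv]
  refine intervalIntegral.integral_congr fun x _ => ?_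
  simp only [eval_sub]; ring

/-! ### Taylor polynomials and approximation by the Gauss–Radau projection -/

/-- The Taylor polynomial of degree `k` of `f` at `x₀`. -/
noncomputable def taylorPoly (k : ℕ) (f : ℝ → ℝ) (x₀ : ℝ) : ℝ[X] :=
  ∑ i ∈ range (k+1), C (iteratedDeriv i f x₀ / Nat.factorial i) * (X - C x₀) ^ i

lemma natDegree_taylorPoly (k : ℕ) (f : ℝ → ℝ) (x₀ : ℝ) : (taylorPoly k f x₀).natDegree ≤ k := by
  refine natDegree_sum_le_of_forall_le (S := ℝ) _ _ fun i hi => ?_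
  refine (natDegree_C_mul_le _ _).trans ?_
  rw [natDegree_pow, natDegree_X_sub_C, mul_one]
  have := mem_range.1 hi
  omega

lemma pderiv_taylorPoly {k m : ℕ} (hm : m ≤ k) (f : ℝ → ℝ) (x₀ : ℝ) :
    (pderiv m (taylorPoly k f x₀)).eval x₀ = iteratedDeriv m f x₀ := by
  rw [taylorPoly, pderiv_eq, iterate_derivative_sum, eval_finsetSum,
    sum_eq_single_of_mem m (mem_range.2 (by omega))]
  · rw [iterate_derivative_C_mul, iterate_derivative_X_sub_pow_self, eval_mul, eval_C,
      eval_natCast]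
    field_simp
  · intro i _ hi
    rw [iterate_derivative_C_mul, iterate_derivative_X_sub_pow, eval_mul, eval_C]
    rcases lt_or_gt_of_ne hi with h | h
    · rw [Nat.descFactorial_of_lt h]; simp
    · have : i - m ≠ 0 := by omega
      simp [this]

lemma abs_sub_taylorPoly_le (k : ℕ) {f : ℝ → ℝ} (hf : ContDiff ℝ (k+1) f) {M : ℝ}
    (hM : ∀ x, |iteratedDeriv (k+1) f x| ≤ M) (x₀ x : ℝ) :
    |f x - (taylorPoly k f x₀).eval x| ≤ M * |x - x₀| ^ (k+1) := by
  have hM0 : 0 ≤ M := (abs_nonneg _).trans (hM 0)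
  by_cases hx : x₀ = x
  · subst hx
    have := pderiv_taylorPoly (Nat.zero_le k) f x₀
    rw [pderiv_zero, iteratedDeriv_zero] at this
    rw [this]; simp
  · obtain ⟨y, -, hy⟩ := taylor_mean_remainder_lagrange_iteratedDeriv hx hf.contDiffOn (n := k)
    have : taylorWithinEval f k (Set.uIcc x₀ x) x₀ x = (taylorPoly k f x₀).eval x := by
      rw [taylor_within_apply, taylorPoly, eval_finsetSum]
      refine sum_congr rfl fun i hi => ?_
      have hi' : (i : WithTop ℕ∞) ≤ k + 1 := by
        have := mem_range.1 hi
        exact_mod_cast this.le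
      rw [iteratedDerivWithin_eq_iteratedDeriv (uniqueDiffOn_uIcc hx)
        (hf.contDiffAt.of_le hi') Set.left_mem_uIcc]
      simp only [smul_eq_mul, eval_mul, eval_C, eval_pow, eval_sub, eval_X]
      ring
    rw [← this, hy, abs_div, abs_mul, abs_pow, Nat.abs_cast]
    have h1 : (1:ℝ) ≤ (Nat.factorial (k+1) : ℝ) := by exact_mod_cast Nat.factorial_pos _
    refine (div_le_self (by positivity) h1).trans ?_
    gcongr
    exact hM y

/-- Approximation properties of the Gauss–Radau projection. -/
lemma isGRProj_approx (k : ℕ) : ∃ C : ℝ, 0 < C ∧ ∀ a b : ℝ, a < b → ∀ f : ℝ → ℝ,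
    ContDiff ℝ (k+1) f → ∀ M : ℝ, (∀ x, |iteratedDeriv (k+1) f x| ≤ M) →
    ∀ p, IsGRProj k a b f p → ∀ m ≤ k, ∀ x ∈ Set.Icc a b,
    (b - a) ^ m * |(pderiv m p).eval x - iteratedDeriv m f x| ≤ C * M * (b - a) ^ (k+1) := by
  obtain ⟨C, hC, h⟩ := isGRProj_bound k
  refine ⟨C, hC, fun a b hab f hf M hM p hp m hm x hx => ?_⟩
  have hM0 : 0 ≤ M := (abs_nonneg _).trans (hM 0)
  have := h a b hab _ (hf.continuous.sub (taylorPoly k f x).continuous) _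
    (hp.sub_poly (natDegree_taylorPoly k f x)) (M * (b - a) ^ (k+1)) (fun y hy => by
      refine (abs_sub_taylorPoly_le k hf hM x y).trans ?_
      gcongr
      exact abs_le.2 ⟨by linarith [hx.2, hy.1], by linarith [hx.1, hy.2]⟩) m x hx
  rw [pderiv_sub, eval_sub, pderiv_taylorPoly hm] at this
  rwa [mul_assoc]

/-! ### Meshes -/

section Mesh

variable {pt : Fin (N+1) → ℝ}

lemma IsMesh.lt (h : IsMesh pt) (j : Fin N) : ptL pt j < ptR pt j :=
  h.2.2 Fin.castSucc_lt_succ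

lemma IsMesh.cellh_pos (h : IsMesh pt) (j : Fin N) : 0 < cellh pt j := sub_pos.2 (h.lt j)

lemma cellh_le_meshSize (j : Fin N) : cellh pt j ≤ meshSize pt :=
  le_ciSup (f := fun j => cellh pt j) (Set.finite_range _).bddAbove j

lemma IsMesh.meshSize_pos [NeZero N] (h : IsMesh pt) : 0 < meshSize pt :=
  (h.cellh_pos 0).trans_le (cellh_le_meshSize 0)

lemma IsMesh.sum_integral (h : IsMesh pt) {f : ℝ → ℝ} (hf : Continuous f) :
    ∑ j : Fin N, ∫ x in (ptL pt j)..(ptR pt j), f x = ∫ x in (0:ℝ)..1, f x := by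
  let g : ℕ → ℝ := fun i => if hi : i < N + 1 then pt ⟨i, hi⟩ else 0
  have hg : ∀ j : Fin (N+1), g j = pt j := fun j => by simp only [g, dif_pos j.is_lt, Fin.eta]
  have h1 := intervalIntegral.sum_integral_adjacent_intervals (f := f) (μ := volume) (a := g)
    (n := N) (fun i _ => hf.intervalIntegrable _ _)
  rw [← Fin.sum_univ_eq_sum_range (fun i => ∫ x in g i..g (i+1), f x)] at h1
  have h0 : g 0 = 0 := by
    have := hg 0
    rw [h.1] at this
    simpa using this
  have hN : g N = 1 := by
    have := hg (Fin.last N)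
    rw [h.2.1] at this
    simpa using this
  rw [h0, hN] at h1
  rw [← h1]
  refine sum_congr rfl fun j _ => ?_
  have e1 : g (j : ℕ) = ptL pt j := hg j.castSucc
  have e2 : g ((j : ℕ) + 1) = ptR pt j := by
    have := hg j.succ
    rwa [Fin.val_succ] at this
  rw [e1, e2]

lemma IsMesh.sum_cellh (h : IsMesh pt) : ∑ j : Fin N, cellh pt j = 1 := by
  have := h.sum_integral (f := fun _ => 1) continuous_const
  simpa [cellh] using this

lemma IsMesh.card_mul_le {γ : ℝ} (h : IsMesh pt) (hq : QuasiUniform pt γ) :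
    (N : ℝ) * meshSize pt ≤ γ := by
  have h1 : ∑ _j : Fin N, meshSize pt ≤ ∑ j : Fin N, γ * cellh pt j :=
    sum_le_sum fun j _ => hq j
  rw [← mul_sum, h.sum_cellh] at h1
  simpa using h1

/-- A periodic function takes the same value at both representatives of an interface. -/
lemma IsMesh.periodic_succ [NeZero N] (h : IsMesh pt) {f : ℝ → ℝ} (hf : ∀ x, f (x + 1) = f x)
    (j : Fin N) : f (pt (Fin.castSucc (j + 1))) = f (pt j.succ) := by
  by_cases hj : (j : ℕ) + 1 < N
  · have : Fin.castSucc (j + 1) = j.succ := by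
      apply Fin.ext
      rw [Fin.val_castSucc, Fin.val_succ, Fin.val_add_one_of_lt']
      exact hj
    rw [this]
  · have h1 : j.succ = Fin.last N := by
      apply Fin.ext
      rw [Fin.val_succ, Fin.val_last]
      omega
    have h2 : Fin.castSucc (j + 1) = 0 := by
      apply Fin.ext
      rw [Fin.val_castSucc, Fin.val_add]
      have : (j : ℕ) + 1 = N := by omega
      rw [Fin.coe_ofNat_eq_mod, Nat.add_mod_mod, this]
      simp
    rw [h1, h2, h.1, h.2.1, ← hf 0, zero_add]

lemma IsMesh.periodic_pred [NeZero N] (h : IsMesh pt) {f : ℝ → ℝ} (hf : ∀ x, f (x + 1) = f x)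
    (j : Fin N) : f (pt (j - 1).succ) = f (ptL pt j) := by
  have := h.periodic_succ hf (j - 1)
  rw [sub_add_cancel] at this
  exact this.symm

end Mesh

lemma sum_shift_succ [NeZero N] (f : Fin N → ℝ) : ∑ j, f (j + 1) = ∑ j, f j :=
  Fintype.sum_equiv (Equiv.addRight 1) _ _ fun _ => rfl

lemma sum_shift_pred [NeZero N] (f : Fin N → ℝ) : ∑ j, f (j - 1) = ∑ j, f j :=
  Fintype.sum_equiv (Equiv.subRight 1) _ _ fun _ => rfl

/-! ### The global `L²` inner product -/

/-- The global `L²` inner product as a bilinear form. -/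
noncomputable def gbil (pt : Fin (N+1) → ℝ) : LinearMap.BilinForm ℝ (Fin N → ℝ[X]) :=
  LinearMap.mk₂ ℝ (ip pt)
    (fun u u' v => by simp [ip, cip_eq, sum_add_distrib])
    (fun c u v => by simp [ip, cip_eq, mul_sum])
    (fun u v v' => by simp [ip, cip_eq, sum_add_distrib])
    (fun c u v => by simp [ip, cip_eq, mul_sum])

lemma gbil_apply (pt : Fin (N+1) → ℝ) (u v : Fin N → ℝ[X]) : gbil pt u v = ip pt u v := rfl

section GlobalNorm

variable {pt : Fin (N+1) → ℝ}

lemma ip_comm (u v : Fin N → ℝ[X]) : ip pt u v = ip pt v u :=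
  sum_congr rfl fun _ _ => ibil_comm _ _ _ _

lemma IsMesh.ip_self_nonneg (h : IsMesh pt) (u : Fin N → ℝ[X]) : 0 ≤ ip pt u u :=
  sum_nonneg fun j _ => ibil_self_nonneg (h.lt j).le _

lemma l2_nonneg (u : Fin N → ℝ[X]) : 0 ≤ l2 pt u := Real.sqrt_nonneg _

lemma IsMesh.l2_sq (h : IsMesh pt) (u : Fin N → ℝ[X]) : l2 pt u ^ 2 = ip pt u u :=
  Real.sq_sqrt (h.ip_self_nonneg u)

lemma IsMesh.l2_sq_eq_sum (h : IsMesh pt) (u : Fin N → ℝ[X]) :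
    l2 pt u ^ 2 = ∑ j, cl2 pt j (u j) ^ 2 := by
  rw [h.l2_sq]
  exact sum_congr rfl fun j _ => (inorm_sq (h.lt j).le _).symm

lemma IsMesh.l2_add_le (h : IsMesh pt) (u v : Fin N → ℝ[X]) :
    l2 pt (u + v) ≤ l2 pt u + l2 pt v :=
  bilin_sqrt_add_le (B := gbil pt) h.ip_self_nonneg ip_comm u v

lemma l2_smul (c : ℝ) (u : Fin N → ℝ[X]) : l2 pt (c • u) = |c| * l2 pt u :=
  bilin_sqrt_smul (B := gbil pt) c u

lemma l2_neg (u : Fin N → ℝ[X]) : l2 pt (-u) = l2 pt u := by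
  simpa using l2_smul (pt := pt) (-1) u

lemma IsMesh.l2_sub_le (h : IsMesh pt) (u v : Fin N → ℝ[X]) :
    l2 pt (u - v) ≤ l2 pt u + l2 pt v := by
  rw [sub_eq_add_neg, ← l2_neg v]
  exact h.l2_add_le _ _

lemma l2_zero : l2 pt (0 : Fin N → ℝ[X]) = 0 := by
  simpa using l2_smul (pt := pt) 0 0

lemma IsMesh.l2_sum_le (h : IsMesh pt) {ι : Type*} (S : Finset ι) (u : ι → Fin N → ℝ[X]) :
    l2 pt (∑ i ∈ S, u i) ≤ ∑ i ∈ S, l2 pt (u i) :=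
  le_sum_of_subadditive (l2 pt) l2_zero.le h.l2_add_le S u

lemma IsMesh.cl2_le_l2 (h : IsMesh pt) (u : Fin N → ℝ[X]) (j : Fin N) :
    cl2 pt j (u j) ≤ l2 pt u := by
  refine abs_le_of_sq_le_sq' ?_ (l2_nonneg u) |>.2
  rw [h.l2_sq_eq_sum]
  exact single_le_sum (f := fun j => cl2 pt j (u j) ^ 2) (fun i _ => sq_nonneg _) (mem_univ j)

lemma cl2_nonneg (j : Fin N) (p : ℝ[X]) : 0 ≤ cl2 pt j p := Real.sqrt_nonneg _

/-- A cellwise bound by `A (y_j + ε √h)` gives a global `L²` bound. -/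
lemma IsMesh.l2_le_of_cell (h : IsMesh pt) {γ : ℝ} (hq : QuasiUniform pt γ) [NeZero N]
    (hγ : 1 ≤ γ) (u : Fin N → ℝ[X]) (y : Fin N → ℝ) {Y A ε : ℝ} (hY0 : 0 ≤ Y) (hA : 0 ≤ A)
    (hε : 0 ≤ ε) (hY : ∑ j, y j ^ 2 ≤ Y ^ 2)
    (hu : ∀ j, cl2 pt j (u j) ≤ A * (y j + ε * √(meshSize pt))) :
    l2 pt u ≤ 2 * γ * A * (Y + ε) := by
  refine abs_le_of_sq_le_sq' ?_ (by positivity) |>.2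
  rw [h.l2_sq_eq_sum]
  have hh := h.meshSize_pos
  have h1 : ∀ j ∈ (univ : Finset (Fin N)), cl2 pt j (u j) ^ 2 ≤
      2 * A ^ 2 * y j ^ 2 + 2 * A ^ 2 * ε ^ 2 * meshSize pt := by
    intro j _
    have h2 := pow_le_pow_left₀ (cl2_nonneg j (u j)) (hu j) 2
    refine h2.trans ?_
    rw [mul_pow]
    have h3 : (y j + ε * √(meshSize pt)) ^ 2 ≤ 2 * y j ^ 2 + 2 * (ε ^ 2 * meshSize pt) := by
      have := sq_nonneg (y j - ε * √(meshSize pt))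
      have h4 := Real.sq_sqrt hh.le
      have h5 : (ε * √(meshSize pt)) ^ 2 = ε ^ 2 * meshSize pt := by rw [mul_pow, h4]
      nlinarith
    calc _ ≤ A ^ 2 * (2 * y j ^ 2 + 2 * (ε ^ 2 * meshSize pt)) := by gcongr
      _ = _ := by ring
  refine (sum_le_sum h1).trans ?_
  rw [sum_add_distrib, ← mul_sum, sum_const, card_univ, Fintype.card_fin, nsmul_eq_mul]
  have h2 := h.card_mul_le hq
  calc 2 * A ^ 2 * ∑ j, y j ^ 2 + N * (2 * A ^ 2 * ε ^ 2 * meshSize pt)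
      = 2 * A ^ 2 * ∑ j, y j ^ 2 + 2 * A ^ 2 * ε ^ 2 * (N * meshSize pt) := by ring
    _ ≤ 2 * A ^ 2 * Y ^ 2 + 2 * A ^ 2 * ε ^ 2 * γ := by gcongr
    _ ≤ 4 * γ ^ 2 * A ^ 2 * Y ^ 2 + 4 * γ ^ 2 * A ^ 2 * ε ^ 2 := by
        have : 1 ≤ γ ^ 2 := one_le_pow₀ hγ
        have h5 : γ ≤ γ ^ 2 := by nlinarith
        have e1 : 0 ≤ A ^ 2 * Y ^ 2 := by positivity
        have e2 : 0 ≤ A ^ 2 * ε ^ 2 := by positivity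
        nlinarith
    _ ≤ 4 * γ ^ 2 * A ^ 2 * Y ^ 2 + 4 * γ ^ 2 * A ^ 2 * ε ^ 2
        + 8 * γ ^ 2 * A ^ 2 * (Y * ε) := by
        have : 0 ≤ 8 * γ ^ 2 * A ^ 2 * (Y * ε) := by positivity
        linarith
    _ = _ := by ring

end GlobalNorm

/-! ### The damping step -/

/-- Scalar exponential decay moves the initial value by at most `λ τ |f(0)|`. -/
lemma abs_sub_le_of_decay {f : ℝ → ℝ} {lam τ : ℝ} (hl : 0 ≤ lam) (hτ : 0 ≤ τ)
    (hf : ∀ t, HasDerivAt f (-(lam * f t)) t) : |f τ - f 0| ≤ lam * τ * |f 0| := by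
  have h1 : ∀ t, HasDerivAt (fun t => Real.exp (lam * t) * f t) 0 t := by
    intro t
    have h2 : HasDerivAt (fun t => Real.exp (lam * t)) (Real.exp (lam * t) * lam) t := by
      simpa using ((hasDerivAt_id t).const_mul lam).exp
    exact (h2.mul (hf t)).congr_deriv (by ring)
  have h3 := is_const_of_deriv_eq_zero (fun t => (h1 t).differentiableAt)
    (fun t => (h1 t).deriv) τ 0
  simp only [mul_zero, Real.exp_zero, one_mul] at h3
  have h4 : f τ = Real.exp (-(lam * τ)) * f 0 := by
    rw [← h3, ← mul_assoc, ← Real.exp_add]; simp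
  have h5 : f τ - f 0 = -((1 - Real.exp (-(lam * τ))) * f 0) := by rw [h4]; ring
  have hlt : 0 ≤ lam * τ := mul_nonneg hl hτ
  rw [h5, abs_neg, abs_mul]
  gcongr
  rw [abs_of_nonneg (by simpa using hlt)]
  linarith [Real.add_one_le_exp (-(lam * τ))]

section Damping

variable {pt : Fin (N+1) → ℝ} {Pc : Fin N → ℕ → ℝ[X] → ℝ[X]}

lemma cip_sub_left (j : Fin N) (p q v : ℝ[X]) :
    cip pt j (p - q) v = cip pt j p v - cip pt j q v := by
  simp [cip_eq]

lemma cip_sub_right (j : Fin N) (p q v : ℝ[X]) :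
    cip pt j p (q - v) = cip pt j p q - cip pt j p v := by
  simp [cip_eq]

lemma cip_comm (j : Fin N) (p q : ℝ[X]) : cip pt j p q = cip pt j q p := ibil_comm _ _ _ _

/-- The increment between consecutive projections is orthogonal to lower degrees. -/
lemma IsCellProj.cip_increment (hP : IsCellProj pt Pc) (j : Fin N) (i : ℕ) (p q : ℝ[X])
    (hq : q.natDegree ≤ i) : cip pt j (Pc j (i+1) p - Pc j i p) q = 0 := by
  have h1 := (hP j (i+1) p).2 q (by omega)
  have h2 := (hP j i p).2 q hq
  rw [cip_sub_left] at h1 h2 ⊢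
  linarith

lemma IsCellProj.cip_self_increment (hP : IsCellProj pt Pc) (j : Fin N) (i : ℕ) (p : ℝ[X]) :
    cip pt j p (Pc j (i+1) p - Pc j i p)
      = cip pt j (Pc j (i+1) p - Pc j i p) (Pc j (i+1) p - Pc j i p) := by
  have hd : (Pc j (i+1) p - Pc j i p).natDegree ≤ i + 1 :=
    (natDegree_sub_le _ _).trans (max_le (hP j (i+1) p).1 ((hP j i p).1.trans (by omega)))
  have h1 := (hP j (i+1) p).2 _ hd
  have h2 := hP.cip_increment j i p (Pc j i p) (hP j i p).1
  rw [cip_comm] at h2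
  rw [cip_sub_left] at h1
  rw [cip_sub_left, h2]
  linarith

lemma IsCellProj.eq_self (hm : IsMesh pt) (hP : IsCellProj pt Pc) (j : Fin N) {i : ℕ} {p : ℝ[X]}
    (hp : p.natDegree ≤ i) : Pc j i p = p := by
  have := (hP j i p).2 (p - Pc j i p)
    ((natDegree_sub_le _ _).trans (max_le hp (hP j i p).1))
  exact (sub_eq_zero.1 (eq_zero_of_ibil_self (hm.lt j) this)).symm

lemma cip_abs_le (hm : IsMesh pt) (j : Fin N) (p q : ℝ[X]) :
    |cip pt j p q| ≤ cl2 pt j p * cl2 pt j q := ibil_abs_le (hm.lt j).le p q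

lemma cl2_sq (hm : IsMesh pt) (j : Fin N) (p : ℝ[X]) : cl2 pt j p ^ 2 = cip pt j p p :=
  inorm_sq (hm.lt j).le p

/-- The OE step changes a cell polynomial by at most `τ` times the damping rates times its
distance to constants. -/
lemma damping_increment_le [NeZero N] (hm : IsMesh pt) (hP : IsCellProj pt Pc) {k : ℕ}
    {β : Fin N → ℝ} {u : Fin N → ℝ[X]} {w : ℝ → Fin N → ℝ[X]}
    (hw : IsDampingSol k pt β Pc u w) (hu : MemVk k u) {τ : ℝ} (hτ : 0 ≤ τ) (j : Fin N)
    (hδ : ∀ m, 0 ≤ dampRate k pt β u m j) (c : ℝ) :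
    cl2 pt j (w τ j - u j)
      ≤ k * (∑ m ∈ range (k+1), dampRate k pt β u m j) * τ * cl2 pt j (u j - C c) := by
  set Λ := ∑ m ∈ range (k+1), dampRate k pt β u m j with hΛ
  have hΛ0 : 0 ≤ Λ := sum_nonneg fun m _ => hδ m
  obtain ⟨hw0, hwd, hode⟩ := hw
  set z := w τ j - u j with hz
  have hzd : z.natDegree ≤ k := (natDegree_sub_le _ _).trans (max_le (hwd τ j) (hu j))
  have hzero : cip pt j z (Pc j 0 z) = 0 := by
    have hv := (hP j 0 z).1
    have hconst := is_const_of_deriv_eq_zero (f := fun s => cip pt j (w s j) (Pc j 0 z))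
      (fun t => (hode t j _ (hv.trans (Nat.zero_le k))).differentiableAt)
      (fun t => by
        rw [(hode t j _ (hv.trans (Nat.zero_le k))).deriv, neg_eq_zero]
        refine sum_eq_zero fun m _ => ?_
        rw [(hP j (m-1) (w t j)).2 _ (hv.trans (Nat.zero_le _)), mul_zero]) τ 0
    simp only [hw0] at hconst
    rw [hz, cip_sub_left, ← hz, hconst, sub_self]
  have hinc : ∀ i ∈ range k, cip pt j z (Pc j (i+1) z - Pc j i z)
      ≤ Λ * τ * cl2 pt j (u j - C c) * cl2 pt j z := by
    intro i hi
    have hik : i + 1 ≤ k := mem_range.1 hi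
    set v := Pc j (i+1) z - Pc j i z with hv
    have hvd : v.natDegree ≤ i + 1 :=
      (natDegree_sub_le _ _).trans (max_le (hP j (i+1) z).1 ((hP j i z).1.trans (by omega)))
    have horth : ∀ q : ℝ[X], q.natDegree ≤ i → cip pt j q v = 0 := fun q hq => by
      rw [cip_comm]; exact hP.cip_increment j i z q hq
    set lam := ∑ m ∈ range (i+2), dampRate k pt β u m j with hlam
    have hlam0 : 0 ≤ lam := sum_nonneg fun m _ => hδ m
    have hlamΛ : lam ≤ Λ := sum_le_sum_of_subset_of_nonneg
      (range_subset_range.2 (by omega)) fun m _ _ => hδ m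
    have hterm : ∀ t m, cip pt j (w t j - Pc j (m-1) (w t j)) v
        = if m < i + 2 then cip pt j (w t j) v else 0 := by
      intro t m
      split_ifs with hm'
      · rw [cip_sub_left, horth _ ((hP j (m-1) (w t j)).1.trans (by omega)), sub_zero]
      · exact (hP j (m-1) (w t j)).2 v (by omega)
    have hder : ∀ t, HasDerivAt (fun s => cip pt j (w s j) v) (-(lam * cip pt j (w t j) v)) t := by
      intro t
      convert hode t j v (by omega) using 2
      simp only [hterm, mul_ite, mul_zero]
      rw [← sum_filter, hlam, sum_mul]
      refine sum_congr ?_ fun _ _ => rfl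
      ext m
      simp only [mem_filter, mem_range]
      omega
    have h1 := abs_sub_le_of_decay hlam0 hτ hder
    simp only [hw0] at h1
    rw [← cip_sub_left, ← hz] at h1
    have h2 : cip pt j (u j) v = cip pt j (u j - C c) v := by
      rw [cip_sub_left, horth (C c) (by simp), sub_zero]
    have h3 : cl2 pt j v ≤ cl2 pt j z := by
      have h4 := hP.cip_self_increment j i z
      rw [← hv, ← cl2_sq hm] at h4
      have h5 := (abs_le.1 (cip_abs_le hm j z v)).2
      rcases (cl2_nonneg (pt := pt) j v).eq_or_lt with h6 | h6
      · rw [← h6]; exact cl2_nonneg _ _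
      · nlinarith
    calc cip pt j z v ≤ |cip pt j z v| := le_abs_self _
      _ ≤ lam * τ * |cip pt j (u j) v| := h1
      _ ≤ Λ * τ * (cl2 pt j (u j - C c) * cl2 pt j v) := by
          rw [h2]
          gcongr
          exact cip_abs_le hm j _ _
      _ ≤ Λ * τ * (cl2 pt j (u j - C c) * cl2 pt j z) := by
          gcongr
          exact cl2_nonneg _ _
      _ = _ := by ring
  have htel : cip pt j z z = cip pt j z (Pc j 0 z)
      + ∑ i ∈ range k, cip pt j z (Pc j (i+1) z - Pc j i z) := by
    simp only [cip_sub_right]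
    rw [sum_range_sub (fun i => cip pt j z (Pc j i z)), hP.eq_self hm j hzd]
    ring
  have hfin : cl2 pt j z ^ 2 ≤ k * (Λ * τ * cl2 pt j (u j - C c) * cl2 pt j z) := by
    rw [cl2_sq hm, htel, hzero, zero_add]
    refine (sum_le_sum hinc).trans (le_of_eq ?_)
    simp
  rcases (cl2_nonneg (pt := pt) j z).eq_or_lt with h6 | h6
  · rw [← h6]
    have := cl2_nonneg (pt := pt) j (u j - C c)
    positivity
  · nlinarith

end Damping

/-! ### The upwind DG operator -/

section DG

variable {pt : Fin (N+1) → ℝ}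

lemma IsMesh.eq_of_cip (h : IsMesh pt) {k : ℕ} {j : Fin N} {p q : ℝ[X]} (hp : p.natDegree ≤ k)
    (hq : q.natDegree ≤ k)
    (hpq : ∀ v : ℝ[X], v.natDegree ≤ k → cip pt j p v = cip pt j q v) : p = q := by
  have h1 : cip pt j (p - q) (p - q) = 0 := by
    rw [cip_sub_left, sub_eq_zero]
    exact hpq _ ((natDegree_sub_le _ _).trans (max_le hp hq))
  exact sub_eq_zero.1 (eq_zero_of_ibil_self (h.lt j) h1)

lemma MemVk.sub {k : ℕ} {u v : Fin N → ℝ[X]} (hu : MemVk k u) (hv : MemVk k v) :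
    MemVk k (u - v) := fun j => (natDegree_sub_le _ _).trans (max_le (hu j) (hv j))

lemma MemVk.add {k : ℕ} {u v : Fin N → ℝ[X]} (hu : MemVk k u) (hv : MemVk k v) :
    MemVk k (u + v) := fun j => (natDegree_add_le _ _).trans (max_le (hu j) (hv j))

lemma MemVk.smul {k : ℕ} {u : Fin N → ℝ[X]} (c : ℝ) (hu : MemVk k u) :
    MemVk k (c • u) := fun j => (natDegree_smul_le _ _).trans (hu j)

lemma MemVk.sum {k : ℕ} {ι : Type*} (S : Finset ι) {u : ι → Fin N → ℝ[X]}
    (hu : ∀ i ∈ S, MemVk k (u i)) : MemVk k (∑ i ∈ S, u i) := fun j => by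
  rw [Finset.sum_apply]
  exact natDegree_sum_le_of_forall_le (S := ℝ) _ _ fun i hi => hu i hi j

lemma dgRHS_eq [NeZero N] (β : ℝ) (w : Fin N → ℝ[X]) (j : Fin N) (v : ℝ[X]) :
    dgRHS pt β w j v = β * cip pt j (w j) (derivative v)
      - β * (w j).eval (ptR pt j) * v.eval (ptR pt j)
      + β * (w (j-1)).eval (pt (j-1).succ) * v.eval (ptL pt j) := rfl

lemma IsDGOp.map_sub [NeZero N] {k : ℕ} {β : ℝ} {L : (Fin N → ℝ[X]) → (Fin N → ℝ[X])}
    (h : IsMesh pt) (hL : IsDGOp k pt β L) {u v : Fin N → ℝ[X]} (hu : MemVk k u)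
    (hv : MemVk k v) : L (u - v) = L u - L v := by
  funext j
  refine h.eq_of_cip (k := k) (j := j) ((hL _ (hu.sub hv)).1 j) (((hL u hu).1.sub (hL v hv).1) j)
    fun q hq => ?_
  rw [(hL _ (hu.sub hv)).2 j q hq, Pi.sub_apply, cip_sub_left, (hL u hu).2 j q hq,
    (hL v hv).2 j q hq]
  simp only [dgRHS_eq, Pi.sub_apply, cip_sub_left, eval_sub]
  ring

lemma sum_dgRHS [NeZero N] (β : ℝ) (w v : Fin N → ℝ[X]) :
    ∑ j, dgRHS pt β w j (v j) = Hform pt β w v := by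
  have h1 : ∑ j : Fin N, (w j).eval (ptR pt j) * (v (j+1)).eval (pt (Fin.castSucc (j+1)))
      = ∑ j : Fin N, (w (j-1)).eval (pt (j-1).succ) * (v j).eval (ptL pt j) := by
    rw [← sum_shift_succ fun j => (w (j-1)).eval (pt (j-1).succ) * (v j).eval (ptL pt j)]
    simp only [add_sub_cancel_right]
    rfl
  simp only [dgRHS, Hform, jumpD, pderiv_zero, mul_sub, sum_sub_distrib, sum_add_distrib, h1]
  simp only [mul_sum, mul_assoc]
  unfold ptR
  ring

lemma IsDGOp.ip_eq [NeZero N] {k : ℕ} {β : ℝ} {L : (Fin N → ℝ[X]) → (Fin N → ℝ[X])}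
    (hL : IsDGOp k pt β L) {w v : Fin N → ℝ[X]} (hw : MemVk k w) (hv : MemVk k v) :
    ip pt (L w) v = Hform pt β w v := by
  rw [← sum_dgRHS]
  exact sum_congr rfl fun j _ => (hL w hw).2 j _ (hv j)

/-- Inverse inequality on a quasi-uniform mesh, scaled by the mesh size. -/
lemma mesh_inverse (k : ℕ) {γ : ℝ} (hγ : 1 ≤ γ) : ∃ K : ℝ, 0 < K ∧
    ∀ (N : ℕ) [NeZero N] (pt : Fin (N+1) → ℝ), IsMesh pt → QuasiUniform pt γ →
    ∀ (j : Fin N) (p : ℝ[X]), p.natDegree ≤ k → ∀ m ≤ k, ∀ x ∈ Set.Icc (ptL pt j) (ptR pt j),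
    meshSize pt ^ m * |(pderiv m p).eval x| * √(meshSize pt) ≤ K * cl2 pt j p := by
  obtain ⟨K, hK, hinv⟩ := inverse_inequality k
  refine ⟨γ ^ k * √γ * K, by positivity, fun N _ pt h hq j p hp m hm x hx => ?_⟩
  have h1 := hinv _ _ (h.lt j) p hp m x hx
  have h0 := h.meshSize_pos
  have hj := h.cellh_pos j
  calc meshSize pt ^ m * |(pderiv m p).eval x| * √(meshSize pt)
      ≤ (γ * cellh pt j) ^ m * |(pderiv m p).eval x| * √(γ * cellh pt j) := by
        gcongr <;> exact hq j
    _ = γ ^ m * √γ * (cellh pt j ^ m * |(pderiv m p).eval x| * √(cellh pt j)) := by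
        rw [mul_pow, Real.sqrt_mul (by linarith)]; ring
    _ ≤ γ ^ k * √γ * (K * cl2 pt j p) := by
        refine mul_le_mul ?_ h1 (by positivity) (by positivity)
        gcongr
    _ = _ := by ring

/-- The DG operator is bounded by a multiple of `1/h`. -/
lemma dg_bound {k : ℕ} (hk : 1 ≤ k) {β γ : ℝ} (hβ : 0 < β) (hγ : 1 ≤ γ) : ∃ K : ℝ, 0 < K ∧
    ∀ (N : ℕ) [NeZero N] (pt : Fin (N+1) → ℝ), IsMesh pt → QuasiUniform pt γ →
    ∀ L : (Fin N → ℝ[X]) → (Fin N → ℝ[X]), IsDGOp k pt β L →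
    ∀ w, MemVk k w → meshSize pt * l2 pt (L w) ≤ K * l2 pt w := by
  obtain ⟨K, hK, hinv⟩ := mesh_inverse k hγ
  refine ⟨2 * γ * (β * (K + K ^ 2)) * 2, by positivity, fun N _ pt h hq L hL w hw => ?_⟩
  have h0 := h.meshSize_pos
  have hsq := Real.sq_sqrt h0.le
  have hs : 0 < √(meshSize pt) := Real.sqrt_pos.2 h0
  set H := meshSize pt with hH
  have hcell : ∀ j, cl2 pt j ((H • L w) j)
      ≤ β * (K + K ^ 2) * ((cl2 pt j (w j) + cl2 pt (j-1) (w (j-1))) + 0 * √(meshSize pt)) := by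
    intro j
    set v := L w j with hv
    have hvd : v.natDegree ≤ k := (hL w hw).1 j
    have hmR : ptR pt j ∈ Set.Icc (ptL pt j) (ptR pt j) := ⟨(h.lt j).le, le_rfl⟩
    have hmL : ptL pt j ∈ Set.Icc (ptL pt j) (ptR pt j) := ⟨le_rfl, (h.lt j).le⟩
    have hmP : ptR pt (j-1) ∈ Set.Icc (ptL pt (j-1)) (ptR pt (j-1)) := ⟨(h.lt (j-1)).le, le_rfl⟩
    have hwb := hinv N pt h hq j _ (hw j) 0 (by omega) _ hmR
    have hvb := hinv N pt h hq j _ hvd 0 (by omega) _ hmR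
    have hva := hinv N pt h hq j _ hvd 0 (by omega) _ hmL
    have hwp := hinv N pt h hq (j-1) _ (hw (j-1)) 0 (by omega) _ hmP
    rw [pow_zero, one_mul, pderiv_zero, ← hH] at hwb hvb hva hwp
    have hc0 := cl2_nonneg (pt := pt) j v
    have hw0 := cl2_nonneg (pt := pt) j (w j)
    have hp0 := cl2_nonneg (pt := pt) (j-1) (w (j-1))
    have hder : H * cl2 pt j (derivative v) ≤ K * cl2 pt j v := by
      have h1 : cl2 pt j (derivative v) ≤ (K * cl2 pt j v / (H * √H)) * √(ptR pt j - ptL pt j) := by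
        refine inorm_le_of_abs_le (h.lt j).le (by positivity) _ fun x hx => ?_
        rw [le_div_iff₀ (by positivity)]
        have := hinv N pt h hq j _ hvd 1 hk x hx
        simp only [pow_one, pderiv, Function.iterate_one] at this
        rw [← hH] at this
        linarith
      have h2 : √(ptR pt j - ptL pt j) ≤ √H := Real.sqrt_le_sqrt (cellh_le_meshSize j)
      calc H * cl2 pt j (derivative v)
          ≤ H * ((K * cl2 pt j v / (H * √H)) * √H) := by
            gcongr
            exact h1.trans (by gcongr)
        _ = _ := by field_simp
    have hmain : H * cl2 pt j v ^ 2
        ≤ β * (K + K ^ 2) * (cl2 pt j (w j) + cl2 pt (j-1) (w (j-1))) * cl2 pt j v := by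
      rw [cl2_sq h, (hL w hw).2 j v hvd, dgRHS_eq]
      have t1 : H * cip pt j (w j) (derivative v) ≤ cl2 pt j (w j) * (K * cl2 pt j v) := by
        have := (abs_le.1 (cip_abs_le h j (w j) (derivative v))).2
        calc H * cip pt j (w j) (derivative v)
            ≤ H * (cl2 pt j (w j) * cl2 pt j (derivative v)) := by gcongr
          _ = cl2 pt j (w j) * (H * cl2 pt j (derivative v)) := by ring
          _ ≤ _ := by gcongr
      have t2 : -(H * ((w j).eval (ptR pt j) * v.eval (ptR pt j)))
          ≤ (K * cl2 pt j (w j)) * (K * cl2 pt j v) := by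
        calc -(H * ((w j).eval (ptR pt j) * v.eval (ptR pt j)))
            ≤ |H * ((w j).eval (ptR pt j) * v.eval (ptR pt j))| := neg_le_abs _
          _ = (|(w j).eval (ptR pt j)| * √H) * (|v.eval (ptR pt j)| * √H) := by
              rw [abs_mul, abs_mul, abs_of_pos h0]
              linear_combination -|(w j).eval (ptR pt j)| * |v.eval (ptR pt j)| * hsq
          _ ≤ _ := by gcongr
      have t3 : H * ((w (j-1)).eval (pt (j-1).succ) * v.eval (ptL pt j))
          ≤ (K * cl2 pt (j-1) (w (j-1))) * (K * cl2 pt j v) := by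
        calc H * ((w (j-1)).eval (pt (j-1).succ) * v.eval (ptL pt j))
            ≤ |H * ((w (j-1)).eval (pt (j-1).succ) * v.eval (ptL pt j))| := le_abs_self _
          _ = (|(w (j-1)).eval (ptR pt (j-1))| * √H) * (|v.eval (ptL pt j)| * √H) := by
              rw [abs_mul, abs_mul, abs_of_pos h0]
              change H * (|(w (j-1)).eval (ptR pt (j-1))| * |v.eval (ptL pt j)|) = _
              linear_combination -|(w (j-1)).eval (ptR pt (j-1))| * |v.eval (ptL pt j)| * hsq
          _ ≤ _ := by gcongr
      have hx : 0 ≤ β * K * cl2 pt (j-1) (w (j-1)) * cl2 pt j v := by positivity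
      nlinarith [mul_le_mul_of_nonneg_left t1 hβ.le, mul_le_mul_of_nonneg_left t2 hβ.le,
        mul_le_mul_of_nonneg_left t3 hβ.le]
    have hsm : cl2 pt j ((H • L w) j) = H * cl2 pt j v := by
      rw [Pi.smul_apply, ← hv]
      have := bilin_sqrt_smul (B := ibil (ptL pt j) (ptR pt j)) H v
      rw [abs_of_pos h0] at this
      exact this
    rw [hsm, zero_mul, add_zero]
    rcases hc0.eq_or_lt with h6 | h6
    · rw [← h6]; simp only [mul_zero]; positivity
    · nlinarith
  have hY : ∑ j, (cl2 pt j (w j) + cl2 pt (j-1) (w (j-1))) ^ 2 ≤ (2 * l2 pt w) ^ 2 := by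
    calc ∑ j, (cl2 pt j (w j) + cl2 pt (j-1) (w (j-1))) ^ 2
        ≤ ∑ j, (2 * cl2 pt j (w j) ^ 2 + 2 * cl2 pt (j-1) (w (j-1)) ^ 2) :=
          sum_le_sum fun j _ => by nlinarith [sq_nonneg (cl2 pt j (w j) - cl2 pt (j-1) (w (j-1)))]
      _ = 2 * l2 pt w ^ 2 + 2 * l2 pt w ^ 2 := by
          rw [sum_add_distrib, ← mul_sum, ← mul_sum,
            sum_shift_pred fun j => cl2 pt j (w j) ^ 2, h.l2_sq_eq_sum]
      _ = _ := by ring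
  have := h.l2_le_of_cell hq hγ (H • L w) _ (mul_nonneg zero_le_two (l2_nonneg w))
    (by positivity) le_rfl hY hcell
  rw [l2_smul, abs_of_pos h0] at this
  linarith

/-- If a polynomial represents the functional `v ↦ ∫ f v`, its norm is controlled by `f`. -/
lemma IsMesh.cl2_le_of_repr (h : IsMesh pt) {j : Fin N} {z : ℝ[X]} {f : ℝ → ℝ}
    (hf : Continuous f) {ε : ℝ} (hε : 0 ≤ ε) (hb : ∀ x ∈ Set.Icc (ptL pt j) (ptR pt j), |f x| ≤ ε)
    (hz : cip pt j z z = ∫ x in (ptL pt j)..(ptR pt j), f x * z.eval x) :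
    cl2 pt j z ≤ ε * √(meshSize pt) := by
  have h1 : cip pt j z z ≤ ∫ x in (ptL pt j)..(ptR pt j),
      (ε ^ 2 / 2 + z.eval x * z.eval x / 2) := by
    rw [hz]
    refine intervalIntegral.integral_mono_on (h.lt j).le
      ((hf.mul z.continuous).intervalIntegrable _ _)
      (Continuous.intervalIntegrable (by fun_prop) _ _) fun x hx => ?_
    have := sq_le_sq' (abs_le.1 (hb x hx)).1 (abs_le.1 (hb x hx)).2
    nlinarith [sq_nonneg (f x - z.eval x)]
  rw [intervalIntegral.integral_add (by simp)
    (Continuous.intervalIntegrable (by fun_prop) _ _), intervalIntegral.integral_div,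
    intervalIntegral.integral_div, intervalIntegral.integral_const, smul_eq_mul] at h1
  have h2 : cip pt j z z ≤ ε ^ 2 * meshSize pt := by
    have h3 : cip pt j z z = ∫ x in (ptL pt j)..(ptR pt j), z.eval x * z.eval x := rfl
    have h4 : ptR pt j - ptL pt j ≤ meshSize pt := cellh_le_meshSize j
    rw [← h3] at h1
    nlinarith [sq_nonneg ε]
  calc cl2 pt j z ≤ √(ε ^ 2 * meshSize pt) := Real.sqrt_le_sqrt h2
    _ = _ := by rw [Real.sqrt_mul (sq_nonneg _), Real.sqrt_sq hε]

/-- The DG form applied to a Gauss–Radau projection is exact. -/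
lemma dgRHS_grProj [NeZero N] (h : IsMesh pt) {k : ℕ} (hk : 1 ≤ k) (β : ℝ) {U : ℝ → ℝ}
    (hU : ContDiff ℝ 1 U) (hper : ∀ x, U (x + 1) = U x) {w : Fin N → ℝ[X]}
    (hw : ∀ j, IsGRProj k (ptL pt j) (ptR pt j) U (w j)) (j : Fin N) {v : ℝ[X]}
    (hv : v.natDegree ≤ k) :
    dgRHS pt β w j v = -(β * ∫ x in (ptL pt j)..(ptR pt j), deriv U x * v.eval x) := by
  have hdeg : (derivative v).natDegree < k := by
    have := natDegree_derivative_le v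
    omega
  have hUc := hU.continuous
  have hU'c : Continuous (deriv U) := hU.continuous_deriv le_rfl
  have h1 := (hw j).2.1 _ hdeg
  have h2 : ∫ x in (ptL pt j)..(ptR pt j), (w j).eval x * (derivative v).eval x
      = ∫ x in (ptL pt j)..(ptR pt j), U x * (derivative v).eval x := by
    rw [eq_comm, ← sub_eq_zero, ← intervalIntegral.integral_sub
      (Continuous.intervalIntegrable (by fun_prop) _ _)
      (Continuous.intervalIntegrable (by fun_prop) _ _), ← h1]
    congr 1
    funext x
    ring
  have h3 : ∫ x in (ptL pt j)..(ptR pt j), U x * (derivative v).eval x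
      = U (ptR pt j) * v.eval (ptR pt j) - U (ptL pt j) * v.eval (ptL pt j)
        - ∫ x in (ptL pt j)..(ptR pt j), deriv U x * v.eval x :=
    intervalIntegral.integral_mul_deriv_eq_deriv_mul
      (fun x _ => (hU.differentiable one_ne_zero x).hasDerivAt) (fun x _ => v.hasDerivAt x)
      (hU'c.intervalIntegrable _ _) ((derivative v).continuous.intervalIntegrable _ _)
  have h4 : (w (j-1)).eval (pt (j-1).succ) = U (ptL pt j) := by
    rw [← h.periodic_pred hper j]
    exact (hw (j-1)).2.2
  rw [dgRHS, h2, h3, (hw j).2.2, h4]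
  ring

/-- Spatial consistency error of the DG operator on a Gauss–Radau projection. -/
lemma IsDGOp.l2_grProj_le [NeZero N] {γ : ℝ} (h : IsMesh pt) (hq : QuasiUniform pt γ)
    (hγ : 1 ≤ γ) {k : ℕ} (hk : 1 ≤ k) {β : ℝ} (hβ : 0 < β)
    {L : (Fin N → ℝ[X]) → (Fin N → ℝ[X])} (hL : IsDGOp k pt β L) {U : ℝ → ℝ}
    (hU : ContDiff ℝ 1 U) (hper : ∀ x, U (x + 1) = U x) {w w' : Fin N → ℝ[X]}
    (hw : ∀ j, IsGRProj k (ptL pt j) (ptR pt j) U (w j))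
    (hw' : ∀ j, IsGRProj k (ptL pt j) (ptR pt j) (deriv U) (w' j)) {ε : ℝ} (hε : 0 ≤ ε)
    (hb : ∀ j, ∀ x ∈ Set.Icc (ptL pt j) (ptR pt j), |(w' j).eval x - deriv U x| ≤ ε) :
    l2 pt (L w + β • w') ≤ 2 * γ * (β * ε) := by
  have hwk : MemVk k w := fun j => (hw j).1
  have hw'k : MemVk k w' := fun j => (hw' j).1
  have hU'c : Continuous (deriv U) := hU.continuous_deriv le_rfl
  have hcell : ∀ j, cl2 pt j ((L w + β • w') j)
      ≤ 1 * (0 + β * ε * √(meshSize pt)) := by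
    intro j
    rw [zero_add, one_mul]
    set z := (L w + β • w') j with hz
    have hzd : z.natDegree ≤ k := ((hL w hwk).1.add (hw'k.smul β)) j
    refine h.cl2_le_of_repr (f := fun x => β * ((w' j).eval x - deriv U x)) (by fun_prop)
      (by positivity) (fun x hx => ?_) ?_
    · rw [abs_mul, abs_of_pos hβ]
      have := hb j x hx
      gcongr
    · have h1 : cip pt j z z = cip pt j (L w j) z + β * cip pt j (w' j) z := by
        conv_lhs => rw [cip_eq]
        nth_rewrite 1 [hz]
        simp [cip_eq]
      rw [h1, (hL w hwk).2 j z hzd, dgRHS_grProj h hk β hU hper hw j hzd]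
      have h2 : ∀ x, β * ((w' j).eval x - deriv U x) * z.eval x
          = β * ((w' j).eval x * z.eval x) - β * (deriv U x * z.eval x) := fun x => by ring
      simp only [h2]
      rw [intervalIntegral.integral_sub (Continuous.intervalIntegrable (by fun_prop) _ _)
        (Continuous.intervalIntegrable (by fun_prop) _ _), intervalIntegral.integral_const_mul,
        intervalIntegral.integral_const_mul, cip]
      ring
  have := h.l2_le_of_cell hq hγ (L w + β • w') (fun _ => 0) (Y := 0) le_rfl zero_le_one
    (by positivity) (by simp) hcell
  linarith

end DG

/-! ### Families of smooth periodic functions with uniformly bounded derivatives -/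

/-- A family of smooth `1`-periodic functions whose derivatives of each order are bounded
uniformly over the family. -/
def SmoothFam {ι : Type*} (F : ι → ℝ → ℝ) : Prop :=
  (∀ i, ContDiff ℝ (⊤ : ℕ∞) (F i)) ∧ (∀ i x, F i (x + 1) = F i x) ∧
    ∀ m : ℕ, ∃ M : ℝ, ∀ i x, |iteratedDeriv m (F i) x| ≤ M

section Fam

variable {ι κ : Type*}

lemma SmoothFam.linComb (S : Finset κ) {a : κ → ι → ℝ} {F : κ → ι → ℝ → ℝ}
    (ha : ∀ m ∈ S, ∃ A : ℝ, ∀ i, |a m i| ≤ A) (hF : ∀ m ∈ S, SmoothFam (F m)) :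
    SmoothFam fun i x => ∑ m ∈ S, a m i * F m i x := by
  refine ⟨fun i => ContDiff.sum fun m hm => contDiff_const.mul ((hF m hm).1 i), fun i x =>
    sum_congr rfl fun m hm => by rw [(hF m hm).2.1 i x], fun q => ?_⟩
  have hM : ∀ m : κ, ∃ B : ℝ, m ∈ S → ∀ i x, |a m i * iteratedDeriv q (F m i) x| ≤ B := by
    intro m
    by_cases hm : m ∈ S
    · obtain ⟨A, hA⟩ := ha m hm
      obtain ⟨M, hM⟩ := (hF m hm).2.2 q
      refine ⟨A * M, fun _ i x => ?_⟩
      rw [abs_mul]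
      exact mul_le_mul (hA i) (hM i x) (abs_nonneg _) ((abs_nonneg _).trans (hA i))
    · exact ⟨0, fun h => absurd h hm⟩
  choose B hB using hM
  refine ⟨∑ m ∈ S, B m, fun i x => ?_⟩
  rw [iteratedDeriv_fun_sum fun m hm =>
    (contDiff_const.mul (((hF m hm).1 i).of_le (by exact_mod_cast le_top))).contDiffAt]
  refine (abs_sum_le_sum_abs _ _).trans (sum_le_sum fun m hm => ?_)
  rw [iteratedDeriv_const_mul_field]
  exact hB m hm i x

lemma deriv_periodic {f : ℝ → ℝ} (h : ∀ x, f (x + 1) = f x) (x : ℝ) :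
    deriv f (x + 1) = deriv f x := by
  rw [← deriv_comp_add_const]
  congr 1
  exact funext h

lemma iteratedDeriv_periodic {f : ℝ → ℝ} (h : ∀ x, f (x + 1) = f x) (m : ℕ) (x : ℝ) :
    iteratedDeriv m f (x + 1) = iteratedDeriv m f x := by
  have := iteratedDeriv_comp_add_const m f 1
  rw [funext h] at this
  exact (congrFun this x).symm

lemma SmoothFam.deriv {F : ι → ℝ → ℝ} (hF : SmoothFam F) : SmoothFam fun i => deriv (F i) := by
  refine ⟨fun i => (contDiff_infty_iff_deriv.1 (hF.1 i)).2, fun i => deriv_periodic (hF.2.1 i),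
    fun m => ?_⟩
  obtain ⟨M, hM⟩ := hF.2.2 (m+1)
  refine ⟨M, fun i x => ?_⟩
  rw [← iteratedDeriv_succ']
  exact hM i x

lemma SmoothFam.add_mul {F G : ι → ℝ → ℝ} (hF : SmoothFam F) (hG : SmoothFam G) {a : ι → ℝ}
    {A : ℝ} (ha : ∀ i, |a i| ≤ A) : SmoothFam fun i x => F i x + a i * G i x := by
  have := SmoothFam.linComb (univ : Finset (Fin 2)) (a := ![fun _ => 1, a]) (F := ![F, G])
    (fun m _ => by fin_cases m; exacts [⟨1, by simp⟩, ⟨A, ha⟩])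
    (fun m _ => by fin_cases m; exacts [hF, hG])
  simpa [Fin.sum_univ_two] using this

lemma SmoothFam.finUnion {q : ℕ} {F : Fin q → ι → ℝ → ℝ} (hF : ∀ ℓ, SmoothFam (F ℓ)) :
    SmoothFam fun p : ι × Fin q => F p.2 p.1 := by
  refine ⟨fun p => (hF p.2).1 p.1, fun p => (hF p.2).2.1 p.1, fun m => ?_⟩
  choose M hM using fun ℓ => (hF ℓ).2.2 m
  obtain ⟨B, hB⟩ := Finite.exists_le M
  exact ⟨B, fun p x => (hM p.2 p.1 x).trans (hB p.2)⟩

lemma exists_iteratedDeriv_bound {φ : ℝ → ℝ} (hφ : ContDiff ℝ (⊤ : ℕ∞) φ)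
    (hper : ∀ x, φ (x + 1) = φ x) (m : ℕ) : ∃ M : ℝ, ∀ x, |iteratedDeriv m φ x| ≤ M := by
  have hb := Function.Periodic.isBounded_of_continuous (iteratedDeriv_periodic hper m) one_ne_zero
    (hφ.continuous_iteratedDeriv m (by exact_mod_cast le_top))
  obtain ⟨M, hM⟩ := hb.exists_norm_le
  exact ⟨M, fun x => hM _ ⟨x, rfl⟩⟩

lemma SmoothFam.translates {φ : ℝ → ℝ} (hφ : ContDiff ℝ (⊤ : ℕ∞) φ)
    (hper : ∀ x, φ (x + 1) = φ x) (a : ι → ℝ) : SmoothFam fun i x => φ (x - a i) := by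
  refine ⟨fun i => hφ.comp (contDiff_id.sub contDiff_const), fun i x => ?_, fun m => ?_⟩
  · change φ (x + 1 - a i) = φ (x - a i)
    rw [← hper (x - a i)]; ring_nf
  · obtain ⟨M, hM⟩ := exists_iteratedDeriv_bound hφ hper m
    refine ⟨M, fun i x => ?_⟩
    rw [iteratedDeriv_comp_sub_const]
    exact hM _

/-- Difference quotients of translates form a bounded family. -/
lemma SmoothFam.quotients {φ : ℝ → ℝ} (hφ : ContDiff ℝ (⊤ : ℕ∞) φ)
    (hper : ∀ x, φ (x + 1) = φ x) (a b : ι → ℝ) (τ : ι → ℝ) (B : ℝ)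
    (hτ : ∀ i, 0 < τ i) (hab : ∀ i, |a i - b i| ≤ B * τ i) :
    SmoothFam fun i x => (φ (x - b i) - φ (x - a i)) / τ i := by
  have hA := SmoothFam.translates hφ hper a
  have hB := SmoothFam.translates hφ hper b
  refine ⟨fun i => ((hB.1 i).sub (hA.1 i)).div_const _, fun i x => ?_, fun m => ?_⟩
  · have h1 : φ (x + 1 - a i) = φ (x - a i) := hA.2.1 i x
    have h2 : φ (x + 1 - b i) = φ (x - b i) := hB.2.1 i x
    change (φ (x + 1 - b i) - φ (x + 1 - a i)) / τ i = _
    rw [h1, h2]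
  · obtain ⟨M, hM⟩ := exists_iteratedDeriv_bound hφ hper (m+1)
    refine ⟨M * B, fun i x => ?_⟩
    have h1 : (fun x => (φ (x - b i) - φ (x - a i)) / τ i)
        = fun x => (τ i)⁻¹ * ((fun x => φ (x - b i)) - fun x => φ (x - a i)) x := by
      funext y
      simp only [Pi.sub_apply]
      rw [div_eq_inv_mul]
    beta_reduce
    rw [h1, iteratedDeriv_const_mul_field, iteratedDeriv_sub
      ((hB.1 i).of_le (by exact_mod_cast le_top)).contDiffAt
      ((hA.1 i).of_le (by exact_mod_cast le_top)).contDiffAt,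
      iteratedDeriv_comp_sub_const, iteratedDeriv_comp_sub_const]
    have hd : ∀ y ∈ Set.univ, DifferentiableAt ℝ (iteratedDeriv m φ) y := fun y _ =>
      (hφ.differentiable_iteratedDeriv m (by exact_mod_cast WithTop.coe_lt_top m)) y
    have h2 := Convex.norm_image_sub_le_of_norm_deriv_le (C := M) hd
      (fun y _ => by rw [← iteratedDeriv_succ]; exact hM y) convex_univ
      (Set.mem_univ (x - a i)) (Set.mem_univ (x - b i))
    have h3 : x - b i - (x - a i) = a i - b i := by ring
    rw [h3, Real.norm_eq_abs, Real.norm_eq_abs] at h2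
    have hM0 : 0 ≤ M := (abs_nonneg _).trans (hM 0)
    rw [abs_mul, abs_of_pos (inv_pos.2 (hτ i)), inv_mul_le_iff₀ (hτ i)]
    calc _ ≤ M * |a i - b i| := h2
      _ ≤ M * (B * τ i) := by
        have := hab i
        gcongr
      _ = _ := by ring

end Fam

/-! ### The exact solution and the reference functions -/

/-- Exact solutions are transported along characteristics. -/
lemma IsSmoothSolution.transport {β : ℝ} {u : ℝ → ℝ → ℝ} (hu : IsSmoothSolution β u) (x t : ℝ) :
    u x t = u (x - β * t) 0 := by
  obtain ⟨hs, -, hpde⟩ := hu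
  set y := x - β * t with hy
  have hd : Differentiable ℝ (fun p : ℝ × ℝ => u p.1 p.2) := hs.differentiable (by simp)
  have h1 : ∀ σ, HasDerivAt (fun σ => u (y + β * σ) σ) 0 σ := by
    intro σ
    have hF := (hd (y + β * σ, σ)).hasFDerivAt
    set F' := fderiv ℝ (fun p : ℝ × ℝ => u p.1 p.2) (y + β * σ, σ)
    have hc : HasDerivAt (fun σ : ℝ => (y + β * σ, σ)) (β, (1:ℝ)) σ := by
      have : HasDerivAt (fun σ : ℝ => y + β * σ) β σ := by
        simpa using ((hasDerivAt_id σ).const_mul β).const_add y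
      exact this.prodMk (hasDerivAt_id σ)
    have hA := HasFDerivAt.comp_hasDerivAt (f := fun σ : ℝ => (y + β * σ, σ)) σ hF hc
    have hX : HasDerivAt (fun z => u z σ) (F' (1, 0)) (y + β * σ) :=
      HasFDerivAt.comp_hasDerivAt (f := fun z : ℝ => (z, σ)) (y + β * σ) hF
        ((hasDerivAt_id (y + β * σ)).prodMk (hasDerivAt_const _ _))
    have hT : HasDerivAt (fun z => u (y + β * σ) z) (F' (0, 1)) σ :=
      HasFDerivAt.comp_hasDerivAt (f := fun z : ℝ => (y + β * σ, z)) σ hF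
        ((hasDerivAt_const _ _).prodMk (hasDerivAt_id σ))
    have hz := hpde (y + β * σ) σ
    rw [hX.deriv, hT.deriv] at hz
    have h2 : F' (β, 1) = 0 := by
      have : ((β, 1) : ℝ × ℝ) = (0, 1) + β • (1, 0) := by simp
      rw [this, map_add, map_smul, smul_eq_mul, hz]
    rw [h2] at hA
    exact hA
  have h3 := is_const_of_deriv_eq_zero (fun σ => (h1 σ).differentiableAt)
    (fun σ => (h1 σ).deriv) t 0
  simpa [hy] using h3

lemma UrefUpTo_eq (u : ℝ → ℝ → ℝ) (c d : ℕ → ℕ → ℝ) (β τ : ℝ) (n : ℕ) {i ℓ : ℕ} (h : i ≤ ℓ) :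
    UrefUpTo u c d β τ n ℓ i = Uref u c d β τ n i := by
  induction ℓ with
  | zero => obtain rfl : i = 0 := by omega
            rfl
  | succ ℓ ih =>
    rcases Nat.lt_or_ge ℓ i with h1 | h1
    · obtain rfl : i = ℓ + 1 := by omega
      rfl
    · rw [UrefUpTo]
      beta_reduce
      rw [if_pos h1, ih h1]

lemma Uref_zero (u : ℝ → ℝ → ℝ) (c d : ℕ → ℕ → ℝ) (β τ : ℝ) (n : ℕ) :
    Uref u c d β τ n 0 = fun x => u x (n * τ) := rfl

lemma Uref_succ (u : ℝ → ℝ → ℝ) (c d : ℕ → ℕ → ℝ) (β τ : ℝ) (n ℓ : ℕ) :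
    Uref u c d β τ n (ℓ+1) = fun x => ∑ m ∈ range (ℓ+1),
      (c ℓ m * Uref u c d β τ n m x - τ * d ℓ m * β * deriv (Uref u c d β τ n m) x) := by
  rw [Uref, UrefUpTo]
  beta_reduce
  rw [if_neg (by omega)]
  funext x
  refine sum_congr rfl fun m hm => ?_
  rw [UrefUpTo_eq _ _ _ _ _ _ (Nat.lt_succ_iff.1 (mem_range.1 hm))]

/-- Admissible pairs of a time step and a time level. -/
abbrev TimeIdx : Type := {p : ℝ × ℕ // 0 < p.1 ∧ p.1 ≤ 1}

section Reference

variable {β : ℝ} {u : ℝ → ℝ → ℝ} {c d : ℕ → ℕ → ℝ} {s : ℕ}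

lemma TimeIdx.abs_le (i : TimeIdx) : |i.1.1| ≤ 1 := by
  rw [abs_of_pos i.2.1]; exact i.2.2

lemma IsSmoothSolution.contDiff_zero (hu : IsSmoothSolution β u) :
    ContDiff ℝ (⊤ : ℕ∞) fun x => u x 0 :=
  hu.1.comp (f := fun x : ℝ => (x, (0:ℝ))) (contDiff_id.prodMk contDiff_const)

lemma IsSmoothSolution.smoothFam {ι : Type*} (hu : IsSmoothSolution β u) (t : ι → ℝ) :
    SmoothFam fun i x => u x (t i) := by
  have h1 : (fun i x => u x (t i)) = fun i x => u (x - β * t i) 0 := by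
    funext i x
    exact hu.transport x (t i)
  rw [h1]
  exact SmoothFam.translates hu.contDiff_zero (fun x => hu.2.1 x 0) fun i => β * t i

/-- The reference functions differ from the exact solution by `τ` times a bounded family. -/
lemma exists_Uref_eq (hu : IsSmoothSolution β u)
    (hc : ∀ ℓ < s, ∑ m ∈ range (ℓ+1), c ℓ m = 1) (ℓ : ℕ) (hℓ : ℓ ≤ s) :
    ∃ R : TimeIdx → ℝ → ℝ, SmoothFam R ∧ ∀ i : TimeIdx,
      Uref u c d β i.1.1 i.1.2 ℓ = fun x => u x (i.1.2 * i.1.1) + i.1.1 * R i x := by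
  induction ℓ using Nat.strong_induction_on with
  | _ ℓ ih =>
  have hu0 := hu.smoothFam fun i : TimeIdx => (i.1.2 : ℝ) * i.1.1
  rcases ℓ with _ | ℓ
  · refine ⟨fun _ _ => 0, ?_, fun i => by simp [Uref_zero]⟩
    simpa using SmoothFam.linComb (ι := TimeIdx) (κ := ℕ) ∅ (a := fun _ _ => 0)
      (F := fun _ _ _ => 0) (by simp) (by simp)
  · have hex : ∀ m : ℕ, ∃ R : TimeIdx → ℝ → ℝ, m ∈ range (ℓ+1) → SmoothFam R ∧ ∀ i : TimeIdx,
        Uref u c d β i.1.1 i.1.2 m = fun x => u x (i.1.2 * i.1.1) + i.1.1 * R i x := by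
      intro m
      by_cases hm : m ∈ range (ℓ+1)
      · obtain ⟨R, hR⟩ := ih m (mem_range.1 hm) (by have := mem_range.1 hm; omega)
        exact ⟨R, fun _ => hR⟩
      · exact ⟨fun _ _ => 0, fun h => absurd h hm⟩
    choose R hR using hex
    have hUs : ∀ m ∈ range (ℓ+1), SmoothFam fun i : TimeIdx => Uref u c d β i.1.1 i.1.2 m := by
      intro m hm
      have := hu0.add_mul (hR m hm).1 (a := fun i => i.1.1) TimeIdx.abs_le
      convert this using 2 with i
      exact (hR m hm).2 i
    refine ⟨fun i x => (∑ m ∈ range (ℓ+1), c ℓ m * R m i x)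
      + (-1) * ∑ m ∈ range (ℓ+1), (d ℓ m * β) * deriv (Uref u c d β i.1.1 i.1.2 m) x, ?_, ?_⟩
    · exact (SmoothFam.linComb (range (ℓ+1)) (a := fun m _ => c ℓ m)
        (fun m _ => ⟨_, fun _ => le_rfl⟩) fun m hm => (hR m hm).1).add_mul
        (SmoothFam.linComb (range (ℓ+1)) (a := fun m _ => d ℓ m * β)
        (fun m _ => ⟨_, fun _ => le_rfl⟩) fun m hm => (hUs m hm).deriv) (a := fun _ => -1)
        (fun _ => le_rfl)
    · intro i
      rw [Uref_succ]
      funext x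
      have h1 : u x (i.1.2 * i.1.1)
          = ∑ m ∈ range (ℓ+1), c ℓ m * u x (i.1.2 * i.1.1) := by
        rw [← sum_mul, hc ℓ (by omega), one_mul]
      rw [h1, mul_add, mul_sum, ← mul_assoc, mul_sum, ← sum_add_distrib, ← sum_add_distrib]
      refine sum_congr rfl fun m hm => ?_
      nth_rewrite 1 [(hR m hm).2 i]
      ring

lemma smoothFam_Uref (hu : IsSmoothSolution β u)
    (hc : ∀ ℓ < s, ∑ m ∈ range (ℓ+1), c ℓ m = 1) (ℓ : ℕ) (hℓ : ℓ ≤ s) :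
    SmoothFam fun i : TimeIdx => Uref u c d β i.1.1 i.1.2 ℓ := by
  obtain ⟨R, hR, h⟩ := exists_Uref_eq (d := d) hu hc ℓ hℓ
  have := (hu.smoothFam fun i : TimeIdx => (i.1.2 : ℝ) * i.1.1).add_mul hR
    (a := fun i => i.1.1) TimeIdx.abs_le
  convert this using 2 with i
  exact h i

lemma smoothFam_UrefS (hu : IsSmoothSolution β u)
    (hc : ∀ ℓ < s, ∑ m ∈ range (ℓ+1), c ℓ m = 1) (ℓ : ℕ) (hℓ : ℓ ≤ s) :
    SmoothFam fun i : TimeIdx => UrefS u c d β i.1.1 s i.1.2 ℓ := by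
  unfold UrefS
  split_ifs
  · exact hu.smoothFam fun i : TimeIdx => ((i.1.2 : ℝ) + 1) * i.1.1
  · exact smoothFam_Uref hu hc ℓ hℓ

lemma smoothFam_rkRes (hu : IsSmoothSolution β u) (hs : 1 ≤ s)
    (hc : ∀ ℓ < s, ∑ m ∈ range (ℓ+1), c ℓ m = 1) :
    SmoothFam fun i : TimeIdx => rkRes u c d β i.1.1 s i.1.2 := by
  obtain ⟨R, hR, h⟩ := exists_Uref_eq (d := d) hu hc s le_rfl
  have hQ := SmoothFam.quotients hu.contDiff_zero (fun x => hu.2.1 x 0)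
    (fun i : TimeIdx => β * (i.1.2 * i.1.1)) (fun i => β * (((i.1.2 : ℝ) + 1) * i.1.1))
    (fun i => i.1.1) |β| (fun i => i.2.1) (fun i => by
      have : β * (i.1.2 * i.1.1) - β * (((i.1.2 : ℝ) + 1) * i.1.1) = -(β * i.1.1) := by ring
      rw [this, abs_neg, abs_mul, abs_of_pos i.2.1])
  have := hQ.add_mul hR (a := fun _ => -1) (fun _ => le_rfl)
  convert this using 2 with i
  funext x
  have h1 := congrFun (h i) x
  obtain ⟨s', rfl⟩ : ∃ s', s = s' + 1 := ⟨s - 1, by omega⟩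
  rw [Uref_succ] at h1
  beta_reduce at h1
  have hτ := i.2.1.ne'
  simp only [rkRes, Nat.add_sub_cancel]
  rw [h1, hu.transport x (((i.1.2 : ℝ) + 1) * i.1.1), hu.transport x (i.1.2 * i.1.1)]
  field_simp
  ring

/-- The recursion satisfied by the reference functions, with the residual in the last stage. -/
lemma UrefS_succ (τ : ℝ) (hτ : τ ≠ 0) (n ℓ : ℕ) (hℓ : ℓ < s) (x : ℝ) :
    UrefS u c d β τ s n (ℓ+1) x = (∑ m ∈ range (ℓ+1), c ℓ m * UrefS u c d β τ s n m x)
      + (∑ m ∈ range (ℓ+1), (-(τ * d ℓ m * β)) * deriv (UrefS u c d β τ s n m) x)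
      + τ * (if ℓ + 1 = s then rkRes u c d β τ s n x else 0) := by
  have h1 : ∀ m ∈ range (ℓ+1), UrefS u c d β τ s n m = Uref u c d β τ n m := fun m hm => by
    rw [UrefS, if_neg (by have := mem_range.1 hm; omega)]
  rw [← sum_add_distrib]
  have h2 : ∑ m ∈ range (ℓ+1), (c ℓ m * UrefS u c d β τ s n m x
      + (-(τ * d ℓ m * β)) * deriv (UrefS u c d β τ s n m) x)
      = ∑ m ∈ range (ℓ+1), (c ℓ m * Uref u c d β τ n m x
        - τ * d ℓ m * β * deriv (Uref u c d β τ n m) x) :=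
    sum_congr rfl fun m hm => by rw [h1 m hm]; ring
  rw [h2, UrefS]
  split_ifs with h
  · subst h
    simp only [rkRes, Nat.add_sub_cancel]
    rw [mul_div_cancel₀ _ hτ]
    ring
  · rw [Uref_succ]; simp

end Reference

/-! ### The global Gauss–Radau projection -/

/-- The global Gauss–Radau projection of a continuous function. -/
noncomputable def grP (k : ℕ) (pt : Fin (N+1) → ℝ) (U : ℝ → ℝ) : Fin N → ℝ[X] :=
  fun j => Classical.epsilon fun p => IsGRProj k (ptL pt j) (ptR pt j) U p

section GR

variable {pt : Fin (N+1) → ℝ} {k : ℕ}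

lemma IsMesh.grP_spec (h : IsMesh pt) {U : ℝ → ℝ} (hU : Continuous U) (j : Fin N) :
    IsGRProj k (ptL pt j) (ptR pt j) U (grP k pt U j) :=
  Classical.epsilon_spec (exists_isGRProj k (h.lt j) hU)

lemma IsMesh.memVk_grP (h : IsMesh pt) {U : ℝ → ℝ} (hU : Continuous U) :
    MemVk k (grP k pt U) := fun j => (h.grP_spec hU j).1

lemma IsMesh.grP_linComb (h : IsMesh pt) {ι : Type*} (S : Finset ι) (a : ι → ℝ)
    {w : ι → ℝ → ℝ} (hw : ∀ i ∈ S, Continuous (w i)) :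
    grP k pt (fun x => ∑ i ∈ S, a i * w i x) = ∑ i ∈ S, a i • grP k pt (w i) := by
  funext j
  have hc : Continuous fun x => ∑ i ∈ S, a i * w i x :=
    continuous_finsetSum _ fun i hi => continuous_const.mul (hw i hi)
  refine (h.grP_spec hc j).unique (h.lt j) hc ?_
  have := IsGRProj.linComb S a hw (fun i hi => h.grP_spec (k := k) (hw i hi) j)
  simpa [Finset.sum_apply, smul_eq_C_mul] using this

lemma IsMesh.grP_add (h : IsMesh pt) {f g : ℝ → ℝ} (hf : Continuous f) (hg : Continuous g) :
    grP k pt (fun x => f x + g x) = grP k pt f + grP k pt g := by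
  have := h.grP_linComb (k := k) (univ : Finset (Fin 2)) ![1, 1] (w := ![f, g])
    (fun i _ => by fin_cases i; exacts [hf, hg])
  simpa [Fin.sum_univ_two] using this

lemma IsMesh.grP_const_mul (h : IsMesh pt) (a : ℝ) {f : ℝ → ℝ} (hf : Continuous f) :
    grP k pt (fun x => a * f x) = a • grP k pt f := by
  have := h.grP_linComb (k := k) (univ : Finset (Fin 1)) ![a] (w := ![f])
    (fun i _ => by fin_cases i; exact hf)
  simpa using this

/-- Integral comparison behind the next two estimates. -/
lemma IsMesh.sum_integral_sq_le (h : IsMesh pt) {f g : Fin N → ℝ → ℝ}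
    (hf : ∀ j, Continuous (f j)) (hg : ∀ j, Continuous (g j)) {ε : ℝ}
    (hb : ∀ j, ∀ x ∈ Set.Icc (ptL pt j) (ptR pt j), |f j x - g j x| ≤ ε) :
    ∑ j, ∫ x in (ptL pt j)..(ptR pt j), f j x ^ 2
      ≤ 2 * (∑ j, ∫ x in (ptL pt j)..(ptR pt j), g j x ^ 2) + 2 * ε ^ 2 := by
  have h1 : ∀ j ∈ univ, ∫ x in (ptL pt j)..(ptR pt j), f j x ^ 2
      ≤ 2 * (∫ x in (ptL pt j)..(ptR pt j), g j x ^ 2) + 2 * ε ^ 2 * cellh pt j := by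
    intro j _
    have hfj := hf j
    have hgj := hg j
    have h2 : ∫ x in (ptL pt j)..(ptR pt j), f j x ^ 2
        ≤ ∫ x in (ptL pt j)..(ptR pt j), (2 * g j x ^ 2 + 2 * ε ^ 2) := by
      refine intervalIntegral.integral_mono_on (h.lt j).le
        (Continuous.intervalIntegrable (by fun_prop) _ _)
        (Continuous.intervalIntegrable (by fun_prop) _ _) fun x hx => ?_
      have := sq_le_sq' (abs_le.1 (hb j x hx)).1 (abs_le.1 (hb j x hx)).2
      nlinarith [sq_nonneg (g j x - (f j x - g j x))]
    rw [intervalIntegral.integral_add (Continuous.intervalIntegrable (by fun_prop) _ _) (by simp),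
      intervalIntegral.integral_const_mul, intervalIntegral.integral_const, smul_eq_mul] at h2
    rw [cellh]
    linarith
  have h3 := sum_le_sum h1
  rw [sum_add_distrib, ← mul_sum, ← mul_sum, h.sum_cellh] at h3
  linarith

lemma sqrt_le_two_mul {a b ε : ℝ} (hb : 0 ≤ b) (hε : 0 ≤ ε) (h : a ≤ 2 * b + 2 * ε ^ 2) :
    √a ≤ 2 * √b + 2 * ε := by
  refine Real.sqrt_le_iff.2 ⟨by positivity, ?_⟩
  have := Real.sq_sqrt hb
  nlinarith [mul_nonneg (Real.sqrt_nonneg b) hε]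

lemma IsMesh.sum_sq_nonneg (h : IsMesh pt) (f : Fin N → ℝ → ℝ) :
    0 ≤ ∑ j, ∫ x in (ptL pt j)..(ptR pt j), f j x ^ 2 :=
  sum_nonneg fun j _ => intervalIntegral.integral_nonneg (h.lt j).le fun _ _ => sq_nonneg _

lemma ip_self_eq (u : Fin N → ℝ[X]) :
    ip pt u u = ∑ j, ∫ x in (ptL pt j)..(ptR pt j), (u j).eval x ^ 2 := by
  simp only [ip, cip, sq]

lemma IsMesh.errL2_le (h : IsMesh pt) {U : ℝ → ℝ} (hU : Continuous U) (w G : Fin N → ℝ[X])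
    {ε : ℝ} (hε : 0 ≤ ε)
    (hb : ∀ j, ∀ x ∈ Set.Icc (ptL pt j) (ptR pt j), |(G j).eval x - U x| ≤ ε) :
    errL2 pt w U ≤ 2 * l2 pt (w - G) + 2 * ε := by
  rw [errL2, l2, ip_self_eq]
  refine sqrt_le_two_mul (h.sum_sq_nonneg fun j x => ((w - G) j).eval x) hε ?_
  refine h.sum_integral_sq_le (f := fun j x => (w j).eval x - U x)
    (g := fun j x => ((w - G) j).eval x) (fun j => by fun_prop) (fun j => by fun_prop)
    fun j x hx => ?_
  have := hb j x hx
  simpa using this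

lemma IsMesh.l2_sub_le_errL2 (h : IsMesh pt) {U : ℝ → ℝ} (hU : Continuous U)
    (w G : Fin N → ℝ[X]) {ε : ℝ} (hε : 0 ≤ ε)
    (hb : ∀ j, ∀ x ∈ Set.Icc (ptL pt j) (ptR pt j), |(G j).eval x - U x| ≤ ε) :
    l2 pt (w - G) ≤ 2 * errL2 pt w U + 2 * ε := by
  rw [errL2, l2, ip_self_eq]
  refine sqrt_le_two_mul (h.sum_sq_nonneg fun j x => (w j).eval x - U x) hε ?_
  refine h.sum_integral_sq_le (g := fun j x => (w j).eval x - U x)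
    (f := fun j x => ((w - G) j).eval x) (fun j => by fun_prop) (fun j => by fun_prop)
    fun j x hx => ?_
  have := hb j x hx
  rw [abs_sub_comm] at this
  simpa using this

lemma IsMesh.l2_grP_le (h : IsMesh pt) {ρ : ℝ → ℝ} (hρ : Continuous ρ) (G : Fin N → ℝ[X])
    {ε : ℝ} (hε : 0 ≤ ε)
    (hb : ∀ j, ∀ x ∈ Set.Icc (ptL pt j) (ptR pt j), |(G j).eval x - ρ x| ≤ ε) :
    l2 pt G ≤ 2 * fl2 ρ + 2 * ε := by
  have h1 := h.l2_sub_le_errL2 hρ 0 G hε hb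
  have h2 : errL2 pt 0 ρ = fl2 ρ := by
    simp only [errL2, fl2, Pi.zero_apply, eval_zero, zero_sub, neg_sq]
    rw [h.sum_integral (by fun_prop)]
  rwa [zero_sub, l2_neg, h2] at h1

end GR

/-- Approximation by the global Gauss–Radau projection, uniformly over a smooth family. -/
lemma SmoothFam.grP_approx {ι : Type*} {F : ι → ℝ → ℝ} (hF : SmoothFam F) (k : ℕ) {γ : ℝ}
    (hγ : 1 ≤ γ) : ∃ K : ℝ, 0 < K ∧ ∀ (N : ℕ) [NeZero N] (pt : Fin (N+1) → ℝ), IsMesh pt →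
    QuasiUniform pt γ → ∀ (i : ι), ∀ m ≤ k, ∀ (j : Fin N), ∀ x ∈ Set.Icc (ptL pt j) (ptR pt j),
    meshSize pt ^ m * |(pderiv m (grP k pt (F i) j)).eval x - iteratedDeriv m (F i) x|
      ≤ K * meshSize pt ^ (k+1) := by
  obtain ⟨C, hC, h⟩ := isGRProj_approx k
  obtain ⟨M, hM⟩ := hF.2.2 (k+1)
  refine ⟨γ ^ k * (C * (|M| + 1)), by positivity, fun N _ pt hm hq i m hmk j x hx => ?_⟩
  have hM' : ∀ x, |iteratedDeriv (k+1) (F i) x| ≤ |M| + 1 := fun x =>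
    (hM i x).trans ((le_abs_self M).trans (by linarith))
  have hc : ContDiff ℝ (k+1) (F i) := (hF.1 i).of_le (by exact_mod_cast le_top)
  have h1 := h _ _ (hm.lt j) (F i) hc _ hM' _ (hm.grP_spec hc.continuous j) m hmk x hx
  have h0 := hm.meshSize_pos
  have hj := hm.cellh_pos j
  calc meshSize pt ^ m * |(pderiv m (grP k pt (F i) j)).eval x - iteratedDeriv m (F i) x|
      ≤ (γ * cellh pt j) ^ m
        * |(pderiv m (grP k pt (F i) j)).eval x - iteratedDeriv m (F i) x| := by
        gcongr; exact hq j
    _ = γ ^ m * (cellh pt j ^ m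
        * |(pderiv m (grP k pt (F i) j)).eval x - iteratedDeriv m (F i) x|) := by
        rw [mul_pow]; ring
    _ ≤ γ ^ k * (C * (|M| + 1) * cellh pt j ^ (k+1)) := by
        refine mul_le_mul ?_ h1 (by positivity) (by positivity)
        gcongr
    _ ≤ γ ^ k * (C * (|M| + 1) * meshSize pt ^ (k+1)) := by
        gcongr
        exact cellh_le_meshSize j
    _ = _ := by ring

/-- Smallness of the jumps, and proximity to cell constants, of the Gauss–Radau projections of a
smooth family. -/
lemma SmoothFam.grP_jump {ι : Type*} {F : ι → ℝ → ℝ} (hF : SmoothFam F) (k : ℕ) {γ : ℝ}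
    (hγ : 1 ≤ γ) : ∃ K : ℝ, 0 < K ∧ ∀ (N : ℕ) [NeZero N] (pt : Fin (N+1) → ℝ), IsMesh pt →
    QuasiUniform pt γ → meshSize pt ≤ 1 → ∀ i : ι,
    (∀ m ≤ k, ∀ j : Fin N,
      meshSize pt ^ m * |jumpD pt (grP k pt (F i)) m j| ≤ K * meshSize pt ^ (k+1)) ∧
    (∀ j : Fin N, ∃ a : ℝ, ∀ x ∈ Set.Icc (ptL pt j) (ptR pt j),
      |(grP k pt (F i) j).eval x - a| ≤ K * meshSize pt) ∧
    (∀ j : Fin N, ∀ x ∈ Set.Icc (ptL pt j) (ptR pt j),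
      |(grP k pt (F i) j).eval x - F i x| ≤ K * meshSize pt ^ (k+1)) := by
  obtain ⟨K, hK, h⟩ := hF.grP_approx k hγ
  obtain ⟨M, hM⟩ := hF.2.2 1
  refine ⟨2 * K + |M|, by positivity, fun N _ pt hm hq h1 i => ?_⟩
  have h0 := hm.meshSize_pos
  have happ : ∀ j : Fin N, ∀ x ∈ Set.Icc (ptL pt j) (ptR pt j),
      |(grP k pt (F i) j).eval x - F i x| ≤ K * meshSize pt ^ (k+1) := fun j x hx => by
    simpa using h N pt hm hq i 0 (by omega) j x hx
  refine ⟨fun m hmk j => ?_, fun j => ⟨F i (ptL pt j), fun x hx => ?_⟩, fun j x hx => ?_⟩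
  · have e1 := h N pt hm hq i m hmk (j+1) (ptL pt (j+1)) ⟨le_rfl, (hm.lt _).le⟩
    have e2 := h N pt hm hq i m hmk j (ptR pt j) ⟨(hm.lt _).le, le_rfl⟩
    have e3 : iteratedDeriv m (F i) (ptL pt (j+1)) = iteratedDeriv m (F i) (ptR pt j) :=
      hm.periodic_succ (iteratedDeriv_periodic (hF.2.1 i) m) j
    rw [e3] at e1
    have e4 : jumpD pt (grP k pt (F i)) m j
        = ((pderiv m (grP k pt (F i) (j+1))).eval (ptL pt (j+1))
            - iteratedDeriv m (F i) (ptR pt j))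
          - ((pderiv m (grP k pt (F i) j)).eval (ptR pt j)
            - iteratedDeriv m (F i) (ptR pt j)) := by
      rw [sub_sub_sub_cancel_right]; rfl
    rw [e4]
    calc _ ≤ meshSize pt ^ m * (_ + _) := by gcongr; exact abs_sub _ _
      _ ≤ 2 * K * meshSize pt ^ (k+1) := by rw [mul_add]; linarith
      _ ≤ _ := by gcongr; linarith [abs_nonneg M]
  · have hd : ∀ y ∈ Set.univ, DifferentiableAt ℝ (F i) y := fun y _ =>
      (hF.1 i).differentiable (by simp) y
    have h2 := Convex.norm_image_sub_le_of_norm_deriv_le (C := |M|) hd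
      (fun y _ => by
        have := hM i y
        rw [iteratedDeriv_one] at this
        exact this.trans (le_abs_self M)) convex_univ
      (Set.mem_univ (ptL pt j)) (Set.mem_univ x)
    rw [Real.norm_eq_abs, Real.norm_eq_abs] at h2
    have h3 : |x - ptL pt j| ≤ meshSize pt := by
      rw [abs_of_nonneg (by linarith [hx.1])]
      have : ptR pt j - ptL pt j ≤ meshSize pt := cellh_le_meshSize j
      linarith [hx.2]
    have h4 : meshSize pt ^ (k+1) ≤ meshSize pt := by
      simpa using pow_le_pow_of_le_one h0.le h1 (Nat.le_add_left 1 k)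
    calc |(grP k pt (F i) j).eval x - F i (ptL pt j)|
        ≤ |(grP k pt (F i) j).eval x - F i x| + |F i x - F i (ptL pt j)| := abs_sub_le _ _ _
      _ ≤ K * meshSize pt ^ (k+1) + |M| * |x - ptL pt j| := add_le_add (happ j x hx) h2
      _ ≤ 2 * K * meshSize pt + |M| * meshSize pt := by
          gcongr
          linarith
      _ = _ := by ring
  · refine (happ j x hx).trans ?_
    gcongr
    linarith [abs_nonneg M]

/-- A Runge–Kutta stage as a linear combination. -/
lemma rkStage_eq [NeZero N] (c d : ℕ → ℕ → ℝ) (τ : ℝ) (L : (Fin N → ℝ[X]) → (Fin N → ℝ[X]))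
    (w : ℕ → Fin N → ℝ[X]) (ℓ : ℕ) : rkStage c d τ L w ℓ
      = ∑ m ∈ range (ℓ+1), (c ℓ m • w m + (τ * d ℓ m) • L (w m)) := by
  funext j
  simp [rkStage, Finset.sum_apply, smul_eq_C_mul]

/-- Consistency of the scheme on the projected reference functions. -/
lemma consistency {k s r : ℕ} (hk : 1 ≤ k) (hs : 1 ≤ s) {c d : ℕ → ℕ → ℝ}
    (hc : ∀ ℓ < s, ∑ m ∈ range (ℓ+1), c ℓ m = 1) {β γ Cr : ℝ} (hβ : 0 < β) (hγ : 1 ≤ γ)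
    (hCr : 0 ≤ Cr) {u : ℝ → ℝ → ℝ} (hu : IsSmoothSolution β u) :
    ∃ K : ℝ, 0 < K ∧ ∀ (N : ℕ) [NeZero N] (pt : Fin (N+1) → ℝ), IsMesh pt → QuasiUniform pt γ →
    ∀ L : (Fin N → ℝ[X]) → (Fin N → ℝ[X]), IsDGOp k pt β L → ∀ i : TimeIdx,
    fl2 (rkRes u c d β i.1.1 s i.1.2) ≤ Cr * i.1.1 ^ r → ∀ ℓ < s, ∃ ζ : Fin N → ℝ[X],
      grP k pt (UrefS u c d β i.1.1 s i.1.2 (ℓ+1))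
        = rkStage c d i.1.1 L (fun m => grP k pt (UrefS u c d β i.1.1 s i.1.2 m)) ℓ
          + i.1.1 • ζ ∧
      l2 pt ζ ≤ K * (meshSize pt ^ (k+1) + i.1.1 ^ r) := by
  have hA : SmoothFam fun p : TimeIdx × Fin (s+1) => UrefS u c d β p.1.1.1 s p.1.1.2 p.2 :=
    SmoothFam.finUnion (F := fun (ℓ : Fin (s+1)) (i : TimeIdx) =>
      UrefS u c d β i.1.1 s i.1.2 ℓ) fun ℓ => smoothFam_UrefS hu hc ℓ (by omega)
  have hR := smoothFam_rkRes (d := d) hu hs hc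
  obtain ⟨K₁, hK₁, h₁⟩ := hA.deriv.grP_approx k hγ
  obtain ⟨K₂, hK₂, h₂⟩ := hR.grP_approx k hγ
  set D := ∑ ℓ ∈ range s, ∑ m ∈ range (ℓ+1), |d ℓ m| with hD
  have hD0 : 0 ≤ D := sum_nonneg fun _ _ => sum_nonneg fun _ _ => abs_nonneg _
  refine ⟨D * (2 * γ * (β * K₁)) + 2 * Cr + 2 * K₂, by positivity,
    fun N _ pt h hq L hL i hi ℓ hℓ => ?_⟩
  have hτ := i.2.1
  have h0 := h.meshSize_pos
  set U := UrefS u c d β i.1.1 s i.1.2 with hUdef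
  set G := fun m => grP k pt (U m) with hG
  set G' := fun m => grP k pt (deriv (U m)) with hG'
  set ρ : ℝ → ℝ := fun x => if ℓ + 1 = s then rkRes u c d β i.1.1 s i.1.2 x else 0 with hρ
  have hRc : Continuous (rkRes u c d β i.1.1 s i.1.2) := (hR.1 i).continuous
  have hρc : Continuous ρ := by
    rw [hρ]
    split_ifs
    · exact hRc
    · exact continuous_const
  have hUs : ∀ m ≤ s, ContDiff ℝ (⊤ : ℕ∞) (U m) := fun m hm =>
    (smoothFam_UrefS (d := d) hu hc m hm).1 i
  have hUper : ∀ m ≤ s, ∀ x, U m (x + 1) = U m x := fun m hm =>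
    (smoothFam_UrefS (d := d) hu hc m hm).2.1 i
  have hUc : ∀ m ≤ s, Continuous (U m) := fun m hm => (hUs m hm).continuous
  have hU'c : ∀ m ≤ s, Continuous (deriv (U m)) := fun m hm =>
    (hUs m hm).continuous_deriv (by exact_mod_cast le_top)
  have hms : ∀ m ∈ range (ℓ+1), m ≤ s := fun m hm => by have := mem_range.1 hm; omega
  refine ⟨grP k pt ρ - ∑ m ∈ range (ℓ+1), d ℓ m • (L (G m) + β • G' m), ?_, ?_⟩
  · have e1 : U (ℓ+1) = fun x => (∑ m ∈ range (ℓ+1), c ℓ m * U m x)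
        + (∑ m ∈ range (ℓ+1), (-(i.1.1 * d ℓ m * β)) * deriv (U m) x) + i.1.1 * ρ x :=
      funext fun x => UrefS_succ i.1.1 hτ.ne' i.1.2 ℓ hℓ x
    have c1 : Continuous fun x => ∑ m ∈ range (ℓ+1), c ℓ m * U m x :=
      continuous_finsetSum _ fun m hm => continuous_const.mul (hUc m (hms m hm))
    have c2 : Continuous fun x => ∑ m ∈ range (ℓ+1), (-(i.1.1 * d ℓ m * β)) * deriv (U m) x :=
      continuous_finsetSum _ fun m hm => continuous_const.mul (hU'c m (hms m hm))
    have c3 : Continuous fun x => i.1.1 * ρ x := continuous_const.mul hρc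
    rw [e1, h.grP_add (f := fun x => (∑ m ∈ range (ℓ+1), c ℓ m * U m x)
      + ∑ m ∈ range (ℓ+1), (-(i.1.1 * d ℓ m * β)) * deriv (U m) x) (c1.add c2) c3,
      h.grP_add c1 c2,
      h.grP_linComb _ _ fun m hm => hUc m (hms m hm),
      h.grP_linComb _ _ fun m hm => hU'c m (hms m hm), h.grP_const_mul _ hρc, rkStage_eq,
      smul_sub, smul_sum, ← sum_add_distrib, add_sub_left_comm, ← sum_sub_distrib, add_comm]
    congr 1
    refine sum_congr rfl fun m _ => ?_
    module
  · have hz : ∀ m ∈ range (ℓ+1), l2 pt (L (G m) + β • G' m)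
        ≤ 2 * γ * (β * (K₁ * meshSize pt ^ (k+1))) := by
      intro m hm
      refine hL.l2_grProj_le h hq hγ hk hβ ((hUs m (hms m hm)).of_le (by exact_mod_cast le_top))
        (hUper m (hms m hm)) (h.grP_spec (hUc m (hms m hm)))
        (h.grP_spec (hU'c m (hms m hm))) (by positivity) fun j x hx => ?_
      have := h₁ N pt h hq (i, ⟨m, by have := hms m hm; omega⟩) 0 (by omega) j x hx
      simpa using this
    have hρl : l2 pt (grP k pt ρ) ≤ 2 * (Cr * i.1.1 ^ r) + 2 * (K₂ * meshSize pt ^ (k+1)) := by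
      by_cases hls : ℓ + 1 = s
      · have e : ρ = rkRes u c d β i.1.1 s i.1.2 := by rw [hρ]; simp [hls]
        rw [e]
        refine (h.l2_grP_le hRc _ (ε := K₂ * meshSize pt ^ (k+1)) (by positivity)
          fun j x hx => ?_).trans (by linarith)
        have := h₂ N pt h hq i 0 (by omega) j x hx
        simpa using this
      · have e : ρ = fun x => 0 * (0:ℝ) := by rw [hρ]; simp [hls]
        rw [e, h.grP_const_mul 0 (f := fun _ => (0:ℝ)) continuous_const, zero_smul, l2_zero]
        positivity
    have hsum : l2 pt (∑ m ∈ range (ℓ+1), d ℓ m • (L (G m) + β • G' m))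
        ≤ D * (2 * γ * (β * (K₁ * meshSize pt ^ (k+1)))) := by
      refine (h.l2_sum_le _ _).trans ?_
      calc ∑ m ∈ range (ℓ+1), l2 pt (d ℓ m • (L (G m) + β • G' m))
          ≤ ∑ m ∈ range (ℓ+1), |d ℓ m| * (2 * γ * (β * (K₁ * meshSize pt ^ (k+1)))) :=
            sum_le_sum fun m hm => by
              rw [l2_smul]
              exact mul_le_mul_of_nonneg_left (hz m hm) (abs_nonneg _)
        _ = (∑ m ∈ range (ℓ+1), |d ℓ m|) * (2 * γ * (β * (K₁ * meshSize pt ^ (k+1)))) := by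
            rw [sum_mul]
        _ ≤ _ := by
            gcongr
            exact single_le_sum (f := fun ℓ => ∑ m ∈ range (ℓ+1), |d ℓ m|)
              (fun _ _ => sum_nonneg fun _ _ => abs_nonneg _) (mem_range.2 hℓ)
    have hE : 0 ≤ i.1.1 ^ r := by positivity
    have hH : 0 ≤ meshSize pt ^ (k+1) := by positivity
    have t1 : 0 ≤ D * (2 * γ * (β * K₁)) * i.1.1 ^ r := by positivity
    have t2 : 0 ≤ Cr * meshSize pt ^ (k+1) := by positivity
    have t3 : 0 ≤ K₂ * i.1.1 ^ r := by positivity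
    refine (h.l2_sub_le _ _).trans ?_
    linarith

/-! ### Bounds on the damping coefficients and on the oscillation-eliminating step -/

section OE

variable {pt : Fin (N+1) → ℝ}

lemma cl2_smul (j : Fin N) (a : ℝ) (p : ℝ[X]) : cl2 pt j (a • p) = |a| * cl2 pt j p :=
  bilin_sqrt_smul (B := ibil (ptL pt j) (ptR pt j)) a p

lemma IsMesh.cl2_add_le (h : IsMesh pt) (j : Fin N) (p q : ℝ[X]) :
    cl2 pt j (p + q) ≤ cl2 pt j p + cl2 pt j q := inorm_add_le (h.lt j).le p q

lemma jumpD_sub [NeZero N] (u v : Fin N → ℝ[X]) (m : ℕ) (j : Fin N) :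
    jumpD pt (u - v) m j = jumpD pt u m j - jumpD pt v m j := by
  simp only [jumpD, Pi.sub_apply, pderiv_sub, eval_sub]
  ring

lemma jumpD_const [NeZero N] (a : ℝ) (m : ℕ) (j : Fin N) :
    jumpD pt (fun _ => C a) m j = 0 := by
  rcases m with _ | m
  · simp [jumpD]
  · have : pderiv (m+1) (C a) = 0 := by simp [pderiv]
    simp [jumpD, this]

lemma abs_eval_sub_le_linfSub (u : Fin N → ℝ[X]) (a : ℝ) (j : Fin N) {x : ℝ}
    (hx : x ∈ Set.Icc (ptL pt j) (ptR pt j)) : |(u j).eval x - a| ≤ linfSub pt u a := by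
  have h1 : BddAbove ((fun x => |(u j).eval x - a|) '' Set.Icc (ptL pt j) (ptR pt j)) :=
    isCompact_Icc.bddAbove_image (by fun_prop)
  exact (le_csSup h1 ⟨x, hx, rfl⟩).trans
    (le_ciSup (f := fun j => sSup ((fun x => |(u j).eval x - a|) '' Set.Icc (ptL pt j) (ptR pt j)))
      (Set.finite_range _).bddAbove j)

lemma IsMesh.jump_le [NeZero N] (h : IsMesh pt) {k : ℕ} {K : ℝ}
    (hinv : ∀ (j : Fin N) (p : ℝ[X]), p.natDegree ≤ k → ∀ m ≤ k,
      ∀ x ∈ Set.Icc (ptL pt j) (ptR pt j),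
      meshSize pt ^ m * |(pderiv m p).eval x| * √(meshSize pt) ≤ K * cl2 pt j p)
    {w : Fin N → ℝ[X]} (hw : MemVk k w) {m : ℕ} (hm : m ≤ k) (j : Fin N) :
    meshSize pt ^ m * |jumpD pt w m j| * √(meshSize pt)
      ≤ K * (cl2 pt j (w j) + cl2 pt (j+1) (w (j+1))) := by
  have h0 := h.meshSize_pos
  have e1 := hinv (j+1) _ (hw (j+1)) m hm (ptL pt (j+1)) ⟨le_rfl, (h.lt _).le⟩
  have e2 := hinv j _ (hw j) m hm (ptR pt j) ⟨(h.lt _).le, le_rfl⟩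
  calc meshSize pt ^ m * |jumpD pt w m j| * √(meshSize pt)
      ≤ meshSize pt ^ m * (|(pderiv m (w (j+1))).eval (ptL pt (j+1))|
        + |(pderiv m (w j)).eval (ptR pt j)|) * √(meshSize pt) := by
        gcongr
        exact abs_sub _ _
    _ ≤ _ := by linarith

lemma sigma_le [NeZero N] (h : IsMesh pt) {k : ℕ} (hk : 1 ≤ k) {u : Fin N → ℝ[X]}
    (hl : 0 < linfSub pt u (avg pt u)) {m : ℕ} (hm : m ≤ k) (j : Fin N) :
    sigma k pt u m j ≤ (2 * k + 1) * (meshSize pt ^ m * |jumpD pt u m (j-1)|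
      + meshSize pt ^ m * |jumpD pt u m j|) / (2 * linfSub pt u (avg pt u)) := by
  have h0 := h.meshSize_pos
  have hj := h.cellh_pos j
  have hk' : (1:ℝ) ≤ k := by exact_mod_cast hk
  have hm' : (m:ℝ) ≤ k := by exact_mod_cast hm
  rw [sigma]
  split_ifs
  · positivity
  · have hf : (1:ℝ) ≤ (Nat.factorial m) := by exact_mod_cast Nat.factorial_pos m
    have hpre : (2 * (m:ℝ) + 1) * cellh pt j ^ m / ((2 * k - 1) * Nat.factorial m)
        ≤ (2 * k + 1) * meshSize pt ^ m := by
      rw [div_le_iff₀ (mul_pos (by linarith) (by linarith))]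
      have h1 : cellh pt j ^ m ≤ meshSize pt ^ m := by gcongr; exact cellh_le_meshSize j
      have h2 : (1:ℝ) ≤ (2 * k - 1) * Nat.factorial m := by nlinarith
      calc (2 * (m:ℝ) + 1) * cellh pt j ^ m ≤ (2 * k + 1) * meshSize pt ^ m := by gcongr
        _ ≤ _ := le_mul_of_one_le_right (by positivity) h2
    refine (mul_le_mul_of_nonneg_right hpre (by positivity)).trans (le_of_eq ?_)
    ring

lemma sigma_nonneg [NeZero N] (h : IsMesh pt) {k : ℕ} (hk : 1 ≤ k) {u : Fin N → ℝ[X]}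
    (hl : 0 ≤ linfSub pt u (avg pt u)) (m : ℕ) (j : Fin N) : 0 ≤ sigma k pt u m j := by
  have hj := h.cellh_pos j
  have hk' : (1:ℝ) ≤ k := by exact_mod_cast hk
  have hk2 : (0:ℝ) ≤ 2 * k - 1 := by linarith
  rw [sigma]
  split_ifs
  · exact le_rfl
  · positivity

end OE

/-- Effect of the oscillation-eliminating step on a function `v = ξ + G` near a projected smooth
function `G`. -/
lemma oe_bound {k : ℕ} (hk : 1 ≤ k) {β γ c0 KG : ℝ} (hβ : 0 < β) (hγ : 1 ≤ γ) (hc0 : 0 < c0)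
    (hKG : 0 < KG) : ∃ A : ℝ, 0 < A ∧ ∀ (N : ℕ) [NeZero N] (pt : Fin (N+1) → ℝ), IsMesh pt →
    QuasiUniform pt γ → ∀ Pc : Fin N → ℕ → ℝ[X] → ℝ[X], IsCellProj pt Pc →
    ∀ G : Fin N → ℝ[X],
    (∀ m ≤ k, ∀ j, meshSize pt ^ m * |jumpD pt G m j| ≤ KG * meshSize pt ^ (k+1)) →
    (∀ j, ∃ a : ℝ, ∀ x ∈ Set.Icc (ptL pt j) (ptR pt j), |(G j).eval x - a| ≤ KG * meshSize pt) →
    MemVk k G → ∀ v : Fin N → ℝ[X], MemVk k v → c0 ≤ linfSub pt v (avg pt v) →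
    ∀ τ : ℝ, 0 ≤ τ → ∀ w : ℝ → Fin N → ℝ[X], IsDampingSol k pt (fun _ => β) Pc v w →
    (meshSize pt * √(meshSize pt)) * l2 pt (w τ - v) ≤ τ * A
      * (l2 pt (v - G) + meshSize pt * √(meshSize pt)) * (l2 pt (v - G) + meshSize pt ^ (k+1)) ∧
    meshSize pt * l2 pt (w τ - v) ≤ τ * A * (l2 pt (v - G) + meshSize pt) := by
  obtain ⟨K, hK, hinv⟩ := mesh_inverse k hγ
  set κ : ℝ := k * ((k+1) * (β * γ)) with hκdef
  have hκ : 0 ≤ κ := by positivity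
  set K₁ : ℝ := (2 * k + 1) * (4 * K) with hK₁
  set K₂ : ℝ := (2 * k + 1) * (2 * K + 2 * KG) / (2 * c0) with hK₂
  have hK₁0 : 0 < K₁ := by positivity
  have hK₂0 : 0 < K₂ := by positivity
  refine ⟨6 * γ * ((κ + 1) * (K₁ + K₂) * (1 + KG)), by positivity,
    fun N _ pt h hq Pc hP G hJ hcst hGk v hvk hc τ hτ w hw => ?_⟩
  have h0 := h.meshSize_pos
  have hinv' := hinv N pt h hq
  have hs : 0 < √(meshSize pt) := Real.sqrt_pos.2 h0
  have hl : 0 < linfSub pt v (avg pt v) := hc0.trans_le hc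
  set H := meshSize pt with hH
  set ξ := v - G with hξ
  have hξk : MemVk k ξ := hvk.sub hGk
  set x : Fin N → ℝ := fun j => cl2 pt j (ξ j) with hx
  have hx0 : ∀ j, 0 ≤ x j := fun j => cl2_nonneg _ _
  set X : Fin N → ℝ := fun j => x (j-1) + x j + x (j+1) with hX
  have hxX : ∀ j, x j ≤ X j := fun j => by
    have := hx0 (j-1); have := hx0 (j+1); simp only [hX]; linarith
  have hX0 : ∀ j, 0 ≤ X j := fun j => (hx0 j).trans (hxX j)
  have hxb : ∀ j, x j ≤ l2 pt ξ := fun j => h.cl2_le_l2 ξ j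
  have hb0 : 0 ≤ l2 pt ξ := l2_nonneg ξ
  have hXsum : ∑ j, X j ^ 2 ≤ (3 * l2 pt ξ) ^ 2 := by
    calc ∑ j, X j ^ 2 ≤ ∑ j, (3 * x (j-1) ^ 2 + 3 * x j ^ 2 + 3 * x (j+1) ^ 2) :=
          sum_le_sum fun j _ => by
            simp only [hX]
            nlinarith [sq_nonneg (x (j-1) - x j), sq_nonneg (x (j-1) - x (j+1)),
              sq_nonneg (x j - x (j+1))]
      _ = 3 * l2 pt ξ ^ 2 + 3 * l2 pt ξ ^ 2 + 3 * l2 pt ξ ^ 2 := by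
          rw [sum_add_distrib, sum_add_distrib, ← mul_sum, ← mul_sum, ← mul_sum,
            sum_shift_pred fun j => x j ^ 2, sum_shift_succ fun j => x j ^ 2, h.l2_sq_eq_sum]
      _ = _ := by ring
  -- the damping coefficients are uniformly bounded
  have hσ1 : ∀ m ≤ k, ∀ j, sigma k pt v m j ≤ K₁ := by
    intro m hm j
    set a := avg pt v
    set l := linfSub pt v a
    have hcell : ∀ i, cl2 pt i ((v - (fun _ => C a : Fin N → ℝ[X])) i) ≤ l * √H := by
      intro i
      refine (inorm_le_of_abs_le (M := l) (h.lt i).le hl.le _ fun y hy => ?_).trans ?_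
      · simpa using abs_eval_sub_le_linfSub v a i hy
      · gcongr
        exact cellh_le_meshSize i
    have hjump : ∀ i, H ^ m * |jumpD pt v m i| ≤ 2 * K * l := by
      intro i
      have e := h.jump_le hinv' (hvk.sub (v := fun _ => C a) fun _ => by simp) hm i
      rw [jumpD_sub, jumpD_const, sub_zero] at e
      have e1 := hcell i
      have e2 := hcell (i+1)
      have e3 : H ^ m * |jumpD pt v m i| * √H ≤ 2 * K * l * √H :=
        e.trans <| (mul_le_mul_of_nonneg_left (add_le_add e1 e2) hK.le).trans
          (le_of_eq (by ring))
      exact le_of_mul_le_mul_right e3 hs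
    refine (sigma_le h hk hl hm j).trans ?_
    rw [div_le_iff₀ (by positivity)]
    have e1 := hjump (j-1)
    have e2 := hjump j
    calc _ ≤ (2 * (k:ℝ) + 1) * (2 * K * l + 2 * K * l) := by gcongr
      _ ≤ (2 * (k:ℝ) + 1) * (4 * K) * (2 * l) := by
          have : 0 ≤ (2 * (k:ℝ) + 1) * (4 * K) * l := by positivity
          linarith
  -- and they are small where the numerical solution is accurate
  have hσ2 : ∀ m ≤ k, ∀ j, √H * sigma k pt v m j ≤ K₂ * (X j + H ^ (k+1) * √H) := by
    intro m hm j
    have hjump : ∀ i, H ^ m * |jumpD pt v m i| * √H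
        ≤ K * (x i + x (i+1)) + KG * (H ^ (k+1) * √H) := by
      intro i
      have e := h.jump_le hinv' hξk hm i
      have e1 := hJ m hm i
      have e2 : |jumpD pt v m i| ≤ |jumpD pt ξ m i| + |jumpD pt G m i| := by
        have : jumpD pt v m i = jumpD pt ξ m i + jumpD pt G m i := by rw [hξ, jumpD_sub]; ring
        rw [this]
        exact abs_add_le _ _
      calc H ^ m * |jumpD pt v m i| * √H
          ≤ H ^ m * (|jumpD pt ξ m i| + |jumpD pt G m i|) * √H := by gcongr
        _ = H ^ m * |jumpD pt ξ m i| * √H + H ^ m * |jumpD pt G m i| * √H := by ring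
        _ ≤ K * (x i + x (i+1)) + KG * H ^ (k+1) * √H := by gcongr
        _ = _ := by ring
    have e1 := hjump (j-1)
    rw [sub_add_cancel] at e1
    have e2 := hjump j
    have e3 : sigma k pt v m j ≤ (2 * k + 1) * (H ^ m * |jumpD pt v m (j-1)|
      + H ^ m * |jumpD pt v m j|) / (2 * c0) :=
      (sigma_le h hk hl hm j).trans (by gcongr)
    calc √H * sigma k pt v m j ≤ √H * ((2 * k + 1) * (H ^ m * |jumpD pt v m (j-1)|
          + H ^ m * |jumpD pt v m j|) / (2 * c0)) := by gcongr
      _ = (2 * k + 1) * (H ^ m * |jumpD pt v m (j-1)| * √H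
          + H ^ m * |jumpD pt v m j| * √H) / (2 * c0) := by ring
      _ ≤ (2 * k + 1) * ((2 * K + 2 * KG) * (X j + H ^ (k+1) * √H)) / (2 * c0) := by
          have t1 : 0 ≤ KG * X j := mul_nonneg hKG.le (hX0 j)
          have t2 : 0 ≤ K * (H ^ (k+1) * √H) := by positivity
          have t3 := mul_nonneg hK.le (hx0 (j-1))
          have t4 := mul_nonneg hK.le (hx0 (j+1))
          have t5 : K * X j = K * x (j-1) + K * x j + K * x (j+1) := by simp only [hX]; ring
          gcongr
          linarith
      _ = _ := by rw [hK₂]; ring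
  have hσ0 : ∀ m j, 0 ≤ sigma k pt v m j := sigma_nonneg h hk hl.le
  have hδ0 : ∀ j m, 0 ≤ dampRate k pt (fun _ => β) v m j := fun j m =>
    div_nonneg (mul_nonneg hβ.le (hσ0 m j)) (h.cellh_pos j).le
  have hinc : ∀ (j : Fin N) (S t : ℝ), 0 ≤ t → (∀ m ≤ k, t * sigma k pt v m j ≤ S) → 0 ≤ S →
      t * H * cl2 pt j ((w τ - v) j) ≤ τ * (κ * S) * ((1 + KG) * (x j + H * √H)) := by
    intro j S t ht hS hS0
    obtain ⟨a, ha⟩ := hcst j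
    have e1 := damping_increment_le h hP hw hvk hτ j (hδ0 j) a
    have hj := h.cellh_pos j
    have e2 : cl2 pt j (v j - C a) ≤ (1 + KG) * (x j + H * √H) := by
      have e3 : v j - C a = ξ j + (G j - C a) := by simp [hξ]
      have e4 : cl2 pt j (G j - C a) ≤ KG * H * √H := by
        refine (inorm_le_of_abs_le (M := KG * H) (h.lt j).le (by positivity) _
          fun y hy => ?_).trans ?_
        · simpa using ha y hy
        · gcongr
          exact cellh_le_meshSize j
      rw [e3]
      refine (h.cl2_add_le j _ _).trans ?_
      have t1 := mul_nonneg hKG.le (hx0 j)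
      have t2 : 0 ≤ H * √H := by positivity
      have t3 : cl2 pt j (ξ j) = x j := rfl
      linarith
    have e3 : t * H * ∑ m ∈ range (k+1), dampRate k pt (fun _ => β) v m j
        ≤ (k+1) * (β * γ) * S := by
      rw [mul_sum]
      have : ∀ m ∈ range (k+1), t * H * dampRate k pt (fun _ => β) v m j ≤ β * γ * S := by
        intro m hm
        have e := hS m (Nat.lt_succ_iff.1 (mem_range.1 hm))
        have hqj := hq j
        rw [← hH] at hqj
        have t0 := mul_nonneg ht (hσ0 m j)
        calc t * H * dampRate k pt (fun _ => β) v m j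
            = β * (H / cellh pt j) * (t * sigma k pt v m j) := by rw [dampRate]; ring
          _ ≤ β * γ * S := by
              gcongr
              rwa [div_le_iff₀ hj]
      refine (sum_le_sum this).trans (le_of_eq ?_)
      simp [mul_assoc]
    have hz0 := cl2_nonneg (pt := pt) j (v j - C a)
    calc t * H * cl2 pt j ((w τ - v) j)
        ≤ t * H * (k * (∑ m ∈ range (k+1), dampRate k pt (fun _ => β) v m j) * τ
            * cl2 pt j (v j - C a)) := by
          gcongr
          exact e1
      _ = τ * (k * (t * H * ∑ m ∈ range (k+1), dampRate k pt (fun _ => β) v m j))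
            * cl2 pt j (v j - C a) := by ring
      _ ≤ τ * (k * ((k+1) * (β * γ) * S)) * ((1 + KG) * (x j + H * √H)) := by gcongr
      _ = _ := by rw [hκdef]; ring
  constructor
  · have hcell : ∀ j, cl2 pt j (((H * √H) • (w τ - v)) j)
        ≤ τ * (κ + 1) * (K₁ + K₂) * (1 + KG) * (l2 pt ξ + H * √H)
          * (X j + H ^ (k+1) * √(meshSize pt)) := by
      intro j
      rw [Pi.smul_apply, cl2_smul, abs_of_pos (by positivity)]
      have hXj := hX0 j
      have hxj := hx0 j
      have e := hinc j (K₂ * (X j + H ^ (k+1) * √H)) (√H) hs.le (fun m hm => hσ2 m hm j)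
        (by positivity)
      calc H * √H * cl2 pt j ((w τ - v) j)
          ≤ τ * (κ * (K₂ * (X j + H ^ (k+1) * √H))) * ((1 + KG) * (x j + H * √H)) := by
            refine le_trans (le_of_eq ?_) e
            ring
        _ ≤ τ * ((κ + 1) * ((K₁ + K₂) * (X j + H ^ (k+1) * √H)))
            * ((1 + KG) * (l2 pt ξ + H * √H)) := by
            gcongr
            · linarith
            · linarith
            · exact hxb j
        _ = _ := by ring
    have e := h.l2_le_of_cell hq hγ _ X (mul_nonneg (by norm_num) hb0) (by positivity)
      (by positivity) hXsum hcell
    rw [l2_smul, abs_of_pos (by positivity)] at e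
    refine e.trans ?_
    calc 2 * γ * (τ * (κ + 1) * (K₁ + K₂) * (1 + KG) * (l2 pt ξ + H * √H))
          * (3 * l2 pt ξ + H ^ (k+1))
        ≤ 2 * γ * (τ * (κ + 1) * (K₁ + K₂) * (1 + KG) * (l2 pt ξ + H * √H))
          * (3 * (l2 pt ξ + H ^ (k+1))) := by
          have : 0 ≤ H ^ (k+1) := by positivity
          gcongr
          linarith
      _ = _ := by ring
  · have hcell : ∀ j, cl2 pt j ((H • (w τ - v)) j)
        ≤ τ * (κ + 1) * (K₁ + K₂) * (1 + KG) * (X j + H * √(meshSize pt)) := by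
      intro j
      rw [Pi.smul_apply, cl2_smul, abs_of_pos h0]
      have hXj := hX0 j
      have hxj := hx0 j
      have e := hinc j K₁ 1 zero_le_one (fun m hm => by rw [one_mul]; exact hσ1 m hm j) hK₁0.le
      calc H * cl2 pt j ((w τ - v) j)
          ≤ τ * (κ * K₁) * ((1 + KG) * (x j + H * √H)) := by rw [← one_mul H]; simpa using e
        _ ≤ τ * ((κ + 1) * (K₁ + K₂)) * ((1 + KG) * (X j + H * √H)) := by
            gcongr
            · linarith
            · linarith
            · exact hxX j
        _ = _ := by ring
    have e := h.l2_le_of_cell hq hγ _ X (mul_nonneg (by norm_num) hb0) (by positivity)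
      h0.le hXsum hcell
    rw [l2_smul, abs_of_pos h0] at e
    refine e.trans ?_
    calc 2 * γ * (τ * (κ + 1) * (K₁ + K₂) * (1 + KG)) * (3 * l2 pt ξ + H)
        ≤ 2 * γ * (τ * (κ + 1) * (K₁ + K₂) * (1 + KG)) * (3 * (l2 pt ξ + H)) := by
          gcongr
          linarith
      _ = _ := by ring

/-! ### Error propagation over one time step -/

/-- Discrete error recursion over the stages of one time step. -/
lemma stage_recursion {A M : ℝ} (hA : 0 < A) (hM : 0 ≤ M) (s : ℕ) :
    ∃ B : ℝ, 0 < B ∧ ∀ (a b e y : ℕ → ℝ) (H E τ : ℝ), 0 ≤ H → 0 ≤ E → 0 ≤ τ → τ ≤ 1 →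
    (∀ ℓ, 0 ≤ b ℓ) → 0 ≤ a 0 → y 0 ≤ 0 → H * (a 0 + E) ≤ M →
    (∀ ℓ < s, b (ℓ+1) ≤ A * (∑ m ∈ range (ℓ+1), a m + E)) →
    (∀ ℓ < s, e (ℓ+1) ≤ τ * A * (1 + H * b (ℓ+1)) * (b (ℓ+1) + E)) →
    (∀ ℓ < s, a (ℓ+1) ≤ b (ℓ+1) + e (ℓ+1)) →
    (∀ ℓ < s, y (ℓ+1) ≤ A * (∑ m ∈ range (ℓ+1), y m + τ * E) + e (ℓ+1)) →
    ∀ ℓ ≤ s, a ℓ ≤ B * (a 0 + E) ∧ y ℓ ≤ B * τ * (a 0 + E) := by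
  suffices key : ∀ p : ℕ, ∃ B : ℝ, 0 < B ∧ ∀ (a b e y : ℕ → ℝ) (H E τ : ℝ), 0 ≤ H → 0 ≤ E →
      0 ≤ τ → τ ≤ 1 → (∀ ℓ, 0 ≤ b ℓ) → 0 ≤ a 0 → y 0 ≤ 0 → H * (a 0 + E) ≤ M →
      (∀ ℓ < s, b (ℓ+1) ≤ A * (∑ m ∈ range (ℓ+1), a m + E)) →
      (∀ ℓ < s, e (ℓ+1) ≤ τ * A * (1 + H * b (ℓ+1)) * (b (ℓ+1) + E)) →
      (∀ ℓ < s, a (ℓ+1) ≤ b (ℓ+1) + e (ℓ+1)) →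
      (∀ ℓ < s, y (ℓ+1) ≤ A * (∑ m ∈ range (ℓ+1), y m + τ * E) + e (ℓ+1)) →
      ∀ ℓ ≤ p, ℓ ≤ s → a ℓ ≤ B * (a 0 + E) ∧ y ℓ ≤ B * τ * (a 0 + E) by
    obtain ⟨B, hB, h⟩ := key s
    refine ⟨B, hB, fun a b e y H E τ hH hE hτ hτ1 hb ha hy hHM h₁ h₂ h₃ h₄ ℓ hℓ =>
      h a b e y H E τ hH hE hτ hτ1 hb ha hy hHM h₁ h₂ h₃ h₄ ℓ hℓ hℓ⟩
  intro p
  induction p with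
  | zero =>
    refine ⟨1, one_pos, fun a b e y H E τ hH hE hτ hτ1 hb ha hy hHM _ _ _ _ ℓ hℓ _ => ?_⟩
    obtain rfl : ℓ = 0 := by omega
    exact ⟨by linarith, hy.trans (by positivity)⟩
  | succ p ih =>
    obtain ⟨B, hB, ih⟩ := ih
    set B₁ := A * ((p+1) * B + 1) with hB₁
    set B₂ := A * (1 + B₁ * M) * (B₁ + 1) with hB₂
    have hB₁0 : 0 < B₁ := by positivity
    have hB₂0 : 0 < B₂ := by positivity
    refine ⟨B + B₁ + B₂, by positivity,
      fun a b e y H E τ hH hE hτ hτ1 hb ha hy hHM h₁ h₂ h₃ h₄ ℓ hℓ hℓs => ?_⟩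
    have ih' := ih a b e y H E τ hH hE hτ hτ1 hb ha hy hHM h₁ h₂ h₃ h₄
    set X := a 0 + E with hX
    have hX0 : 0 ≤ X := by positivity
    have hEX : E ≤ X := by linarith
    rcases Nat.lt_or_ge ℓ (p+1) with hlt | hge
    · obtain ⟨i₁, i₂⟩ := ih' ℓ (by omega) hℓs
      refine ⟨i₁.trans ?_, i₂.trans ?_⟩
      · gcongr; linarith
      · gcongr; linarith
    obtain rfl : ℓ = p + 1 := by omega
    have hp : p < s := by omega
    have hsum : ∑ m ∈ range (p+1), a m ≤ (p+1) * (B * X) := by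
      refine (sum_le_sum fun m hm => (ih' m (by grind) (by grind)).1).trans ?_
      simp
    have hsumy : ∑ m ∈ range (p+1), y m ≤ (p+1) * (B * τ * X) := by
      refine (sum_le_sum fun m hm => (ih' m (by grind) (by grind)).2).trans ?_
      simp
    have hbX : b (p+1) ≤ B₁ * X := by
      refine (h₁ p hp).trans ?_
      calc A * (∑ m ∈ range (p+1), a m + E) ≤ A * ((p+1) * (B * X) + X) := by gcongr
        _ = B₁ * X := by rw [hB₁]; ring
    have hb0 := hb (p+1)
    have heX : e (p+1) ≤ B₂ * τ * X := by
      refine (h₂ p hp).trans ?_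
      have hHb : H * b (p+1) ≤ B₁ * M := by
        calc H * b (p+1) ≤ H * (B₁ * X) := by gcongr
          _ = B₁ * (H * X) := by ring
          _ ≤ B₁ * M := by gcongr
      calc τ * A * (1 + H * b (p+1)) * (b (p+1) + E)
          ≤ τ * A * (1 + B₁ * M) * (B₁ * X + X) := by gcongr
        _ = B₂ * τ * X := by rw [hB₂]; ring
    have hτX : B₂ * τ * X ≤ B₂ * X := by
      calc B₂ * τ * X ≤ B₂ * 1 * X := by gcongr
        _ = _ := by ring
    have hBX : 0 ≤ B * X := by positivity
    have hBτX : 0 ≤ B * τ * X := by positivity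
    refine ⟨?_, ?_⟩
    · have := h₃ p hp
      linarith
    · refine (h₄ p hp).trans ?_
      calc A * (∑ m ∈ range (p+1), y m + τ * E) + e (p+1)
          ≤ A * ((p+1) * (B * τ * X) + τ * X) + B₂ * τ * X := by gcongr
        _ = B₁ * τ * X + B₂ * τ * X := by rw [hB₁]; ring
        _ ≤ _ := by linarith

section Stage

variable [NeZero N] {pt : Fin (N+1) → ℝ} {k : ℕ} {β : ℝ}
  {L : (Fin N → ℝ[X]) → (Fin N → ℝ[X])}

lemma rkStage_congr (c d : ℕ → ℕ → ℝ) (τ : ℝ) {v w : ℕ → Fin N → ℝ[X]} {ℓ : ℕ}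
    (hvw : ∀ m ≤ ℓ, v m = w m) : rkStage c d τ L v ℓ = rkStage c d τ L w ℓ := by
  rw [rkStage_eq, rkStage_eq]
  refine sum_congr rfl fun m hm => ?_
  rw [hvw m (Nat.lt_succ_iff.1 (mem_range.1 hm))]

lemma IsDGOp.memVk_rkStage (hL : IsDGOp k pt β L) (c d : ℕ → ℕ → ℝ) (τ : ℝ)
    {w : ℕ → Fin N → ℝ[X]} {ℓ : ℕ} (hw : ∀ m ≤ ℓ, MemVk k (w m)) :
    MemVk k (rkStage c d τ L w ℓ) := by
  rw [rkStage_eq]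
  refine MemVk.sum _ fun m hm => ?_
  have h := hw m (Nat.lt_succ_iff.1 (mem_range.1 hm))
  exact (h.smul _).add ((hL _ h).1.smul _)

lemma IsDGOp.rkStage_sub (h : IsMesh pt) (hL : IsDGOp k pt β L) (c d : ℕ → ℕ → ℝ) (τ : ℝ)
    {v w : ℕ → Fin N → ℝ[X]} {ℓ : ℕ} (hv : ∀ m ≤ ℓ, MemVk k (v m))
    (hw : ∀ m ≤ ℓ, MemVk k (w m)) :
    rkStage c d τ L (fun m => v m - w m) ℓ = rkStage c d τ L v ℓ - rkStage c d τ L w ℓ := by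
  rw [rkStage_eq, rkStage_eq, rkStage_eq, ← sum_sub_distrib]
  refine sum_congr rfl fun m hm => ?_
  have hm' := Nat.lt_succ_iff.1 (mem_range.1 hm)
  rw [hL.map_sub h (hv m hm') (hw m hm'), smul_sub, smul_sub]
  abel

lemma IsMesh.l2_rkStage_le (h : IsMesh pt) (c d : ℕ → ℕ → ℝ) {τ Kd : ℝ} (hτ : 0 ≤ τ)
    (hLb : ∀ w, MemVk k w → τ * l2 pt (L w) ≤ Kd * l2 pt w) {s : ℕ}
    {w : ℕ → Fin N → ℝ[X]} {ℓ : ℕ} (hℓ : ℓ < s) (hKd : 0 ≤ Kd) (hw : ∀ m ≤ ℓ, MemVk k (w m)) :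
    l2 pt (rkStage c d τ L w ℓ)
      ≤ (∑ i ∈ range s, ∑ m ∈ range s, (|c i m| + Kd * |d i m|))
        * ∑ m ∈ range (ℓ+1), l2 pt (w m) := by
  rw [rkStage_eq, mul_sum]
  refine (h.l2_sum_le _ _).trans (sum_le_sum fun m hm => ?_)
  have hm' := Nat.lt_succ_iff.1 (mem_range.1 hm)
  have hterm : |c ℓ m| + Kd * |d ℓ m| ≤ ∑ i ∈ range s, ∑ m ∈ range s, (|c i m| + Kd * |d i m|) :=
    (single_le_sum (f := fun m => |c ℓ m| + Kd * |d ℓ m|) (fun i _ => by positivity)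
      (mem_range.2 (hm'.trans_lt hℓ))).trans
    (single_le_sum (f := fun i => ∑ m ∈ range s, (|c i m| + Kd * |d i m|))
      (fun i _ => sum_nonneg fun _ _ => by positivity) (mem_range.2 hℓ))
  refine (h.l2_add_le _ _).trans ?_
  rw [l2_smul, l2_smul, abs_mul, abs_of_nonneg hτ]
  calc |c ℓ m| * l2 pt (w m) + τ * |d ℓ m| * l2 pt (L (w m))
      = |c ℓ m| * l2 pt (w m) + |d ℓ m| * (τ * l2 pt (L (w m))) := by ring
    _ ≤ |c ℓ m| * l2 pt (w m) + |d ℓ m| * (Kd * l2 pt (w m)) := by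
        have := mul_le_mul_of_nonneg_left (hLb _ (hw m hm')) (abs_nonneg (d ℓ m))
        linarith
    _ = (|c ℓ m| + Kd * |d ℓ m|) * l2 pt (w m) := by ring
    _ ≤ _ := mul_le_mul_of_nonneg_right hterm (l2_nonneg _)

/-- The stages of the undamped Runge–Kutta discontinuous Galerkin scheme. -/
lemma IsDGOp.exists_rkStages (hL : IsDGOp k pt β L) (c d : ℕ → ℕ → ℝ) (τ : ℝ)
    {w₀ : Fin N → ℝ[X]} (hw₀ : MemVk k w₀) : ∃ w : ℕ → Fin N → ℝ[X], w 0 = w₀ ∧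
      (∀ ℓ, MemVk k (w ℓ)) ∧ ∀ ℓ, w (ℓ+1) = rkStage c d τ L w ℓ := by
  let t : ℕ → ℕ → Fin N → ℝ[X] := fun ℓ => Nat.rec (fun _ => w₀)
    (fun ℓ tℓ => Function.update tℓ (ℓ+1) (rkStage c d τ L tℓ ℓ)) ℓ
  have ht : ∀ ℓ, t (ℓ+1) = Function.update (t ℓ) (ℓ+1) (rkStage c d τ L (t ℓ) ℓ) := fun _ => rfl
  have hstab : ∀ ℓ, ∀ m ≤ ℓ, t m m = t ℓ m := by
    intro ℓ
    induction ℓ with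
    | zero => intro m hm; obtain rfl : m = 0 := by omega
              rfl
    | succ ℓ ih =>
      intro m hm
      rcases Nat.lt_or_ge m (ℓ+1) with hlt | hge
      · rw [ih m (by omega), ht, Function.update_of_ne (by omega)]
      · obtain rfl : m = ℓ + 1 := by omega
        rfl
  have hrec : ∀ ℓ, t (ℓ+1) (ℓ+1) = rkStage c d τ L (fun m => t m m) ℓ := by
    intro ℓ
    rw [ht, Function.update_self]
    exact rkStage_congr c d τ fun m hm => (hstab ℓ m hm).symm
  refine ⟨fun ℓ => t ℓ ℓ, rfl, fun ℓ => ?_, hrec⟩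
  induction ℓ using Nat.strong_induction_on with
  | _ ℓ ih =>
    rcases ℓ with _ | ℓ
    · exact hw₀
    · beta_reduce
      rw [hrec]
      exact hL.memVk_rkStage c d τ fun m hm => ih m (by omega)

lemma IsDGOp.ip_rkStage (hL : IsDGOp k pt β L) (c d : ℕ → ℕ → ℝ) (τ : ℝ)
    {w : ℕ → Fin N → ℝ[X]} {ℓ : ℕ} (hw : ∀ m ≤ ℓ, MemVk k (w m)) {v : Fin N → ℝ[X]}
    (hv : MemVk k v) : ip pt (rkStage c d τ L w ℓ) v
      = ∑ m ∈ range (ℓ+1), (c ℓ m * ip pt (w m) v + τ * d ℓ m * Hform pt β (w m) v) := by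
  rw [rkStage_eq, ← gbil_apply, map_sum, LinearMap.sum_apply]
  refine sum_congr rfl fun m hm => ?_
  have h := hw m (Nat.lt_succ_iff.1 (mem_range.1 hm))
  rw [map_add, map_smul, map_smul, LinearMap.add_apply, LinearMap.smul_apply,
    LinearMap.smul_apply, gbil_apply, gbil_apply, hL.ip_eq h hv, smul_eq_mul, smul_eq_mul]

end Stage

/-- Error propagation over one step of the scheme. -/
lemma step_bound {k s : ℕ} (c d : ℕ → ℕ → ℝ) {β A Kd Cs M : ℝ} (hA : 0 < A)
    (hKd : 0 ≤ Kd) (hCs : 0 ≤ Cs) (hM : 0 ≤ M) : ∃ B : ℝ, 0 < B ∧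
    ∀ (N : ℕ) [NeZero N] (pt : Fin (N+1) → ℝ), IsMesh pt →
    ∀ L : (Fin N → ℝ[X]) → (Fin N → ℝ[X]), IsDGOp k pt β L →
    ∀ τ H E : ℝ, 0 ≤ τ → τ ≤ 1 → 0 ≤ H → 0 ≤ E →
    (∀ w, MemVk k w → τ * l2 pt (L w) ≤ Kd * l2 pt w) →
    (∀ w : ℕ → Fin N → ℝ[X], (∀ ℓ, MemVk k (w ℓ)) → (∀ ℓ, w (ℓ+1) = rkStage c d τ L w ℓ) →
      l2 pt (w s) ≤ (1 + Cs * τ) * l2 pt (w 0)) →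
    ∀ G ζ uh uσ : ℕ → Fin N → ℝ[X], (∀ ℓ ≤ s, MemVk k (G ℓ)) → (∀ ℓ ≤ s, MemVk k (uσ ℓ)) →
    (∀ ℓ < s, G (ℓ+1) = rkStage c d τ L G ℓ + τ • ζ ℓ) → (∀ ℓ < s, l2 pt (ζ ℓ) ≤ A * E) →
    (∀ ℓ < s, uh (ℓ+1) = rkStage c d τ L uσ ℓ) →
    (∀ ℓ < s, l2 pt (uσ (ℓ+1) - uh (ℓ+1)) ≤ τ * A * (1 + H * l2 pt (uh (ℓ+1) - G (ℓ+1)))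
      * (l2 pt (uh (ℓ+1) - G (ℓ+1)) + E)) →
    H * (l2 pt (uσ 0 - G 0) + E) ≤ M →
    l2 pt (uσ s - G s) + E ≤ (1 + B * τ) * (l2 pt (uσ 0 - G 0) + E) := by
  set R := ∑ i ∈ range s, ∑ m ∈ range s, (|c i m| + Kd * |d i m|) with hR
  have hR0 : 0 ≤ R := sum_nonneg fun _ _ => sum_nonneg fun _ _ => by positivity
  obtain ⟨B, hB, hrec⟩ := stage_recursion (A := R + A) (by positivity) hM s
  refine ⟨Cs + B, by positivity, fun N _ pt h L hL τ H E hτ hτ1 hH hE hLb hst G ζ uh uσ hG huσ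
    hGs hζ huh hoe hHM => ?_⟩
  obtain ⟨w, hw0, hwk, hws⟩ := hL.exists_rkStages c d τ
    ((huσ 0 (by omega)).sub (hG 0 (by omega)))
  have hξ : ∀ ℓ ≤ s, MemVk k (uσ ℓ - G ℓ) := fun ℓ hℓ => (huσ ℓ hℓ).sub (hG ℓ hℓ)
  have hζ' : ∀ ℓ < s, l2 pt (τ • ζ ℓ) ≤ τ * (A * E) := fun ℓ hℓ => by
    rw [l2_smul, abs_of_nonneg hτ]
    have := hζ ℓ hℓ
    gcongr
  have hsub : ∀ ℓ < s, uh (ℓ+1) - G (ℓ+1)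
      = rkStage c d τ L (fun m => uσ m - G m) ℓ - τ • ζ ℓ := fun ℓ hℓ => by
    rw [hL.rkStage_sub h c d τ (fun m hm => huσ m (by omega)) (fun m hm => hG m (by omega)),
      huh ℓ hℓ, hGs ℓ hℓ]
    abel
  have hoe' : ∀ ℓ < s, l2 pt (uσ (ℓ+1) - uh (ℓ+1)) ≤ τ * (R + A)
      * (1 + H * l2 pt (uh (ℓ+1) - G (ℓ+1))) * (l2 pt (uh (ℓ+1) - G (ℓ+1)) + E) := fun ℓ hℓ => by
    have hb := l2_nonneg (pt := pt) (uh (ℓ+1) - G (ℓ+1))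
    refine (hoe ℓ hℓ).trans ?_
    gcongr
    linarith
  have key := (hrec (fun ℓ => l2 pt (uσ ℓ - G ℓ)) (fun ℓ => l2 pt (uh ℓ - G ℓ))
    (fun ℓ => l2 pt (uσ ℓ - uh ℓ)) (fun ℓ => l2 pt (uσ ℓ - G ℓ - w ℓ)) H E τ hH hE hτ hτ1
    (fun ℓ => l2_nonneg _) (l2_nonneg _) (by simp [hw0, l2_zero]) hHM ?_ hoe' ?_ ?_ s le_rfl).2
  · have e1 : l2 pt (uσ s - G s) ≤ l2 pt (uσ s - G s - w s) + l2 pt (w s) := by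
      have := h.l2_add_le (uσ s - G s - w s) (w s)
      rwa [sub_add_cancel] at this
    have e2 := hst w hwk hws
    rw [hw0] at e2
    have e3 : 0 ≤ Cs * τ * E := by positivity
    beta_reduce at key
    linarith
  · intro ℓ hℓ
    rw [hsub ℓ hℓ]
    have e1 := h.l2_rkStage_le c d hτ hLb hℓ hKd (w := fun m => uσ m - G m)
      fun m hm => hξ m (by omega)
    rw [← hR] at e1
    have e2 : τ * (A * E) ≤ A * E := mul_le_of_le_one_left (by positivity) hτ1
    have e3 : 0 ≤ ∑ m ∈ range (ℓ+1), l2 pt (uσ m - G m) := sum_nonneg fun _ _ => l2_nonneg _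
    have e4 := mul_nonneg hA.le e3
    have e5 := mul_nonneg hR0 hE
    have e6 := h.l2_sub_le (rkStage c d τ L (fun m => uσ m - G m) ℓ) (τ • ζ ℓ)
    have e7 := hζ' ℓ hℓ
    linarith
  · intro ℓ hℓ
    have := h.l2_add_le (uh (ℓ+1) - G (ℓ+1)) (uσ (ℓ+1) - uh (ℓ+1))
    rwa [sub_add_sub_comm, add_comm (uh (ℓ+1)), add_sub_add_right_eq_sub] at this
  · intro ℓ hℓ
    have hdec : uσ (ℓ+1) - G (ℓ+1) - w (ℓ+1)
        = rkStage c d τ L (fun m => uσ m - G m - w m) ℓ - τ • ζ ℓ + (uσ (ℓ+1) - uh (ℓ+1)) := by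
      rw [hL.rkStage_sub h c d τ (v := fun m => uσ m - G m) (fun m hm => hξ m (by omega))
        (fun m _ => hwk m), hws ℓ,
        sub_right_comm (rkStage c d τ L (fun m => uσ m - G m) ℓ), ← hsub ℓ hℓ]
      abel
    rw [hdec]
    have e1 := h.l2_rkStage_le c d hτ hLb hℓ hKd (w := fun m => uσ m - G m - w m)
      fun m hm => (hξ m (by omega)).sub (hwk m)
    rw [← hR] at e1
    have e3 : 0 ≤ ∑ m ∈ range (ℓ+1), l2 pt (uσ m - G m - w m) := sum_nonneg fun _ _ => l2_nonneg _
    have e4 := mul_nonneg hA.le e3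
    have e5 := mul_nonneg hR0 (mul_nonneg hτ hE)
    have e6 := h.l2_sub_le (rkStage c d τ L (fun m => uσ m - G m - w m) ℓ) (τ • ζ ℓ)
    have e7 := hζ' ℓ hℓ
    have e8 := h.l2_add_le (rkStage c d τ L (fun m => uσ m - G m - w m) ℓ - τ • ζ ℓ)
      (uσ (ℓ+1) - uh (ℓ+1))
    linarith

/-- Conversion of the stability hypothesis, without source terms, to the operator form. -/
lemma stable_of_weak [NeZero N] {pt : Fin (N+1) → ℝ} {k s : ℕ} {β τ Cs Cst : ℝ}
    {L : (Fin N → ℝ[X]) → (Fin N → ℝ[X])} (hL : IsDGOp k pt β L) {c d : ℕ → ℕ → ℝ}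
    (hCs : 0 ≤ Cs) (hτ : 0 ≤ τ)
    (hst : ∀ w g : ℕ → Fin N → ℝ[X], (∀ ℓ, MemVk k (w ℓ)) → (∀ ℓ, MemVk k (g ℓ)) →
      (∀ ℓ < s, ∀ v, MemVk k v → ip pt (w (ℓ+1)) v = ∑ m ∈ range (ℓ+1),
        (c ℓ m * ip pt (w m) v + τ * d ℓ m * (Hform pt β (w m) v + ip pt (g m) v))) →
      l2 pt (w s) ^ 2 ≤ (1 + Cs * τ) * l2 pt (w 0) ^ 2
        + Cst * τ * ∑ ℓ ∈ range s, l2 pt (g ℓ) ^ 2)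
    (w : ℕ → Fin N → ℝ[X]) (hw : ∀ ℓ, MemVk k (w ℓ))
    (hws : ∀ ℓ, w (ℓ+1) = rkStage c d τ L w ℓ) :
    l2 pt (w s) ≤ (1 + Cs * τ) * l2 pt (w 0) := by
  have e := hst w (fun _ => 0) hw (fun _ _ => by simp) fun ℓ _ v hv => by
    rw [hws, hL.ip_rkStage c d τ (fun m _ => hw m) hv]
    simp [← gbil_apply]
  simp only [l2_zero, ne_eq, OfNat.ofNat_ne_zero, not_false_eq_true, zero_pow, sum_const_zero,
    mul_zero, add_zero] at e
  have h1 : 1 ≤ 1 + Cs * τ := by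
    have := mul_nonneg hCs hτ
    linarith
  have h0 := l2_nonneg (pt := pt) (w 0)
  refine abs_le_of_sq_le_sq' ?_ (by positivity) |>.2
  calc l2 pt (w s) ^ 2 ≤ (1 + Cs * τ) * l2 pt (w 0) ^ 2 := e
    _ ≤ (1 + Cs * τ) ^ 2 * l2 pt (w 0) ^ 2 := by
        gcongr
        nlinarith
    _ = _ := by ring

/-! ### Accumulation of the error and the final estimate -/

lemma conditional_gronwall {X : ℕ → ℝ} {B τ T H M : ℝ} {nstar : ℕ} (hB : 0 ≤ B) (hτ : 0 ≤ τ)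
    (hT : nstar * τ = T) (hH : 0 ≤ H) (hX : 0 ≤ X 0)
    (hstep : ∀ n < nstar, H * X n ≤ M → X (n+1) ≤ (1 + B * τ) * X n)
    (hM : H * (Real.exp (B * T) * X 0) ≤ M) :
    ∀ n ≤ nstar, X n ≤ Real.exp (B * T) * X 0 := by
  have hexp : ∀ n ≤ nstar, Real.exp (B * (n * τ)) ≤ Real.exp (B * T) := fun n hn => by
    rw [← hT]
    gcongr
  suffices h : ∀ n ≤ nstar, X n ≤ Real.exp (B * (n * τ)) * X 0 from fun n hn =>
    (h n hn).trans (mul_le_mul_of_nonneg_right (hexp n hn) hX)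
  intro n
  induction n with
  | zero => intro _; simp
  | succ n ih =>
    intro hn
    have ih' := ih (by omega)
    have hle := ih'.trans (mul_le_mul_of_nonneg_right (hexp n (by omega)) hX)
    have hBτ : 0 ≤ B * τ := mul_nonneg hB hτ
    calc X (n+1) ≤ (1 + B * τ) * X n :=
          hstep n (by omega) ((mul_le_mul_of_nonneg_left hle hH).trans hM)
      _ ≤ (1 + B * τ) * (Real.exp (B * (n * τ)) * X 0) := by gcongr
      _ ≤ Real.exp (B * τ) * (Real.exp (B * (n * τ)) * X 0) := by
          have := Real.add_one_le_exp (B * τ)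
          gcongr
          linarith
      _ = Real.exp (B * ((n+1 : ℕ) * τ)) * X 0 := by
          rw [← mul_assoc, ← Real.exp_add]
          congr 2
          push_cast
          ring

lemma UrefS_last (u : ℝ → ℝ → ℝ) (c d : ℕ → ℕ → ℝ) (β τ : ℝ) {s : ℕ} (hs : 1 ≤ s) (n : ℕ) :
    UrefS u c d β τ s (n+1) 0 = UrefS u c d β τ s n s := by
  rw [UrefS, UrefS, if_neg (by omega), if_pos rfl, Uref_zero]
  push_cast
  rfl

lemma UrefS_zero (u : ℝ → ℝ → ℝ) (c d : ℕ → ℕ → ℝ) (β τ : ℝ) {s : ℕ} (hs : 1 ≤ s) (n : ℕ) :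
    UrefS u c d β τ s n 0 = fun x => u x (n * τ) := by
  rw [UrefS, if_neg (by omega), Uref_zero]

lemma IsOEDGEvol.memVk [NeZero N] {pt : Fin (N+1) → ℝ} {k s : ℕ} {c d : ℕ → ℕ → ℝ} {β τ : ℝ}
    {b : Fin N → ℝ} {Pc : Fin N → ℕ → ℝ[X] → ℝ[X]} {L Fτ : (Fin N → ℝ[X]) → (Fin N → ℝ[X])}
    {u0 : Fin N → ℝ[X]} {uh uσ : ℕ → ℕ → Fin N → ℝ[X]}
    (hev : IsOEDGEvol s c d τ L Fτ u0 uh uσ) (hL : IsDGOp k pt β L)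
    (hF : IsOEOp k pt b Pc τ Fτ) (hu0 : MemVk k u0) :
    ∀ n, ∀ ℓ ≤ s, MemVk k (uσ n ℓ) := by
  have hstep : ∀ n, MemVk k (uσ n 0) → ∀ ℓ ≤ s, MemVk k (uσ n ℓ) := by
    intro n h0 ℓ
    induction ℓ using Nat.strong_induction_on with
    | _ ℓ ih =>
      intro hℓ
      rcases ℓ with _ | ℓ
      · exact h0
      · obtain ⟨e1, e2⟩ := (hev.2 n).2 ℓ (by omega)
        have hm : MemVk k (uh n (ℓ+1)) := by
          rw [e1]
          exact hL.memVk_rkStage c d τ fun m hm => ih m (by omega) (by omega)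
        obtain ⟨w, hw, hFw⟩ := hF _ hm
        rw [e2, hFw]
        exact hw.2.1 τ
  intro n
  induction n with
  | zero => exact hstep 0 (by rw [hev.1]; exact hu0)
  | succ n ih => exact hstep (n+1) (by rw [(hev.2 n).1]; exact ih s le_rfl)

/-- Error bound for the whole evolution in terms of the bound for the damping increments. -/
lemma evolution_bound {k s r : ℕ} (hk : 1 ≤ k) (hs : 1 ≤ s) {c d : ℕ → ℕ → ℝ}
    (hc : ∀ ℓ < s, ∑ m ∈ range (ℓ+1), c ℓ m = 1) {β γ CCFL Cs Cr T A : ℝ} (hβ : 0 < β)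
    (hγ : 1 ≤ γ) (hCCFL : 0 < CCFL) (hCs : 0 ≤ Cs) (hCr : 0 ≤ Cr) (hA : 0 < A)
    {u : ℝ → ℝ → ℝ} (hu : IsSmoothSolution β u) : ∃ B : ℝ, 0 < B ∧
    ∀ (N : ℕ) [NeZero N] (pt : Fin (N+1) → ℝ), IsMesh pt → QuasiUniform pt γ →
    ∀ (τ : ℝ) (nstar : ℕ), 0 < τ → τ ≤ 1 → (nstar : ℝ) * τ = T → τ ≤ CCFL * meshSize pt →
    ∀ L : (Fin N → ℝ[X]) → (Fin N → ℝ[X]), IsDGOp k pt β L →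
    (∀ w : ℕ → Fin N → ℝ[X], (∀ ℓ, MemVk k (w ℓ)) → (∀ ℓ, w (ℓ+1) = rkStage c d τ L w ℓ) →
      l2 pt (w s) ≤ (1 + Cs * τ) * l2 pt (w 0)) →
    (∀ n ≤ nstar, fl2 (rkRes u c d β τ s n) ≤ Cr * τ ^ r) →
    ∀ uh uσ : ℕ → ℕ → Fin N → ℝ[X], (∀ n, ∀ ℓ ≤ s, MemVk k (uσ n ℓ)) →
    (∀ n, uσ (n+1) 0 = uσ n s) →
    (∀ n, ∀ ℓ < s, uh n (ℓ+1) = rkStage c d τ L (uσ n) ℓ) →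
    ∀ H : ℝ, 0 ≤ H →
    (∀ n, ∀ ℓ < s, l2 pt (uσ n (ℓ+1) - uh n (ℓ+1)) ≤ τ * A
      * (1 + H * l2 pt (uh n (ℓ+1) - grP k pt (UrefS u c d β τ s n (ℓ+1))))
      * (l2 pt (uh n (ℓ+1) - grP k pt (UrefS u c d β τ s n (ℓ+1)))
        + (meshSize pt ^ (k+1) + τ ^ r))) →
    H * (Real.exp (B * T) * (l2 pt (uσ 0 0 - grP k pt (UrefS u c d β τ s 0 0))
      + (meshSize pt ^ (k+1) + τ ^ r))) ≤ 1 →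
    ∀ n ≤ nstar, l2 pt (uσ n 0 - grP k pt (UrefS u c d β τ s n 0))
        + (meshSize pt ^ (k+1) + τ ^ r)
      ≤ Real.exp (B * T) * (l2 pt (uσ 0 0 - grP k pt (UrefS u c d β τ s 0 0))
        + (meshSize pt ^ (k+1) + τ ^ r)) := by
  obtain ⟨K, hK, hcons⟩ := consistency (r := r) (d := d) hk hs hc hβ hγ hCr hu
  obtain ⟨KL, hKL, hLb⟩ := dg_bound hk hβ hγ
  obtain ⟨B, hB, hstep⟩ := step_bound (k := k) (s := s) c d (β := β) (A := A + K)
    (Kd := CCFL * KL) (M := 1) (by positivity) (by positivity) hCs zero_le_one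
  refine ⟨B, hB, fun N _ pt h hq τ nstar hτ hτ1 hT hcfl L hL hst hres uh uσ hmem hnext hstage
    H hH hoe hH1 => ?_⟩
  have h0 := h.meshSize_pos
  set E := meshSize pt ^ (k+1) + τ ^ r with hE
  have hE0 : 0 ≤ E := by positivity
  refine conditional_gronwall (X := fun n => l2 pt (uσ n 0 - grP k pt (UrefS u c d β τ s n 0)) + E)
    hB.le hτ.le hT hH (add_nonneg (l2_nonneg _) hE0) ?_ hH1
  intro n hn hHn
  set i : TimeIdx := ⟨(τ, n), hτ, hτ1⟩ with hi
  choose! ζ hζ using hcons N pt h hq L hL i (hres n hn.le)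
  rw [hnext n, UrefS_last u c d β τ hs n]
  refine hstep N pt h L hL τ H E hτ.le hτ1 hH hE0 ?_ hst
    (fun m => grP k pt (UrefS u c d β τ s n m)) ζ (uh n) (uσ n)
    (fun ℓ hℓ => h.memVk_grP ((smoothFam_UrefS hu hc ℓ hℓ).1 i).continuous) (hmem n)
    (fun ℓ hℓ => (hζ ℓ hℓ).1) (fun ℓ hℓ => (hζ ℓ hℓ).2.trans ?_) (hstage n)
    (fun ℓ hℓ => (hoe n ℓ hℓ).trans ?_) hHn
  · intro w hw
    have := hLb N pt h hq L hL w hw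
    have hn := l2_nonneg (pt := pt) (L w)
    calc τ * l2 pt (L w) ≤ CCFL * meshSize pt * l2 pt (L w) := by gcongr
      _ = CCFL * (meshSize pt * l2 pt (L w)) := by ring
      _ ≤ CCFL * (KL * l2 pt w) := by gcongr
      _ = _ := by ring
  · change K * E ≤ (A + K) * E
    gcongr
    linarith
  · have hb := l2_nonneg (pt := pt) (uh n (ℓ+1) - grP k pt (UrefS u c d β τ s n (ℓ+1)))
    gcongr
    linarith

/-- Theorem 4.1 with `d = 1`: optimal error estimate for the fully
discrete 1D OEDG method for `u_t + β u_x = 0`.  Under quasi-uniformity, the CFL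
condition `τ ≤ C_CFL h^κ` (`κ ≥ 1`), stability of the underlying RKDG scheme (with stage
sources), order conditions `k ≥ 1`, `r ≥ 2` (i.e. `k > d/2`, `r > d/2 + 1`), the uniform
lower bound `‖u_h^{n,ℓ} - avg(u_h^{n,ℓ})‖_{L∞} ≥ c₀ > 0`, smoothness of the exact
solution, the order-`r` residual bound for the reference functions, and the initial
error bound `‖u_σ^0 - u(·,0)‖ ≤ C₀ h^{k+1}`, there is a constant `C` independent of
`h`, `τ` and `n` with
`max_{0≤n≤n⋆} ‖u_σ^n - u(·,nτ)‖_{L²(Ω)} ≤ C (h^{k+1} + τ^r)`, where `T = n⋆ τ`. -/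
theorem oedg_optimal_error_estimate
    (k s r : ℕ) (hk : 1 ≤ k) (hr : 2 ≤ r) (hs : 1 ≤ s)
    (c d : ℕ → ℕ → ℝ) (hc : ∀ ℓ < s, ∑ m ∈ Finset.range (ℓ+1), c ℓ m = 1)
    (β γ CCFL κ Cs Cst Cr c0 C0 T : ℝ)
    (hβ : 0 < β) (hγ : 1 ≤ γ) (hCCFL : 0 < CCFL) (hκ : 1 ≤ κ)
    (hCs : 0 ≤ Cs) (hCst : 0 ≤ Cst) (hCr : 0 ≤ Cr) (hc0 : 0 < c0) (hC0 : 0 ≤ C0)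
    (hT : 0 < T)
    (u : ℝ → ℝ → ℝ) (hu : IsSmoothSolution β u) :
    ∃ C : ℝ, 0 < C ∧
      ∀ (N : ℕ) [NeZero N] (pt : Fin (N+1) → ℝ),
        IsMesh pt → QuasiUniform pt γ → meshSize pt ≤ 1 →
      ∀ (τ : ℝ) (nstar : ℕ), 0 < τ → τ ≤ 1 → (nstar : ℝ) * τ = T →
        τ ≤ CCFL * meshSize pt ^ κ →
      ∀ Pc : Fin N → ℕ → Polynomial ℝ → Polynomial ℝ, IsCellProj pt Pc →
      ∀ L Fτ : (Fin N → Polynomial ℝ) → (Fin N → Polynomial ℝ),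
        IsDGOp k pt β L → IsOEOp k pt (fun _ => β) Pc τ Fτ →
      -- stability (Assumption 4.2) of the RKDG scheme without the OE procedure,
      -- allowing stage source terms `g^{n,ℓ}`:
      (∀ w g : ℕ → Fin N → Polynomial ℝ,
          (∀ ℓ, MemVk k (w ℓ)) → (∀ ℓ, MemVk k (g ℓ)) →
          (∀ ℓ < s, ∀ v, MemVk k v →
            ip pt (w (ℓ+1)) v = ∑ m ∈ Finset.range (ℓ+1),
              (c ℓ m * ip pt (w m) v
                + τ * d ℓ m * (Hform pt β (w m) v + ip pt (g m) v))) →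
          l2 pt (w s) ^ 2 ≤ (1 + Cs * τ) * l2 pt (w 0) ^ 2
            + Cst * τ * ∑ ℓ ∈ Finset.range s, l2 pt (g ℓ) ^ 2) →
      -- the Runge–Kutta method has order `r` (reference-function residual bound):
      (∀ n ≤ nstar, fl2 (rkRes u c d β τ s n) ≤ Cr * τ ^ r) →
      ∀ (u0 : Fin N → Polynomial ℝ) (uh uσ : ℕ → ℕ → Fin N → Polynomial ℝ),
        MemVk k u0 → IsOEDGEvol s c d τ L Fτ u0 uh uσ →
        (∀ n ℓ, 1 ≤ ℓ → ℓ ≤ s → c0 ≤ linfSub pt (uh n ℓ) (avg pt (uh n ℓ))) →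
        errL2 pt u0 (fun x => u x 0) ≤ C0 * meshSize pt ^ (k+1) →
        ∀ n ≤ nstar, errL2 pt (uσ n 0) (fun x => u x ((n:ℝ) * τ))
          ≤ C * (meshSize pt ^ (k+1) + τ ^ r) := by
  have hFam : SmoothFam fun p : TimeIdx × Fin (s+1) => UrefS u c d β p.1.1.1 s p.1.1.2 p.2 :=
    SmoothFam.finUnion (F := fun (ℓ : Fin (s+1)) (i : TimeIdx) =>
      UrefS u c d β i.1.1 s i.1.2 ℓ) fun ℓ => smoothFam_UrefS hu hc ℓ (by omega)
  obtain ⟨KG, hKG, hproj⟩ := hFam.grP_jump k hγ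
  obtain ⟨A, hA, hoe⟩ := oe_bound hk hβ hγ hc0 hKG
  obtain ⟨B, hB, hsmall⟩ := evolution_bound (r := r) (d := d) (T := T) hk hs hc hβ hγ hCCFL hCs
    hCr hA hu
  set D := 2 * C0 + 2 * KG + 1 with hD
  set Q := 1 + CCFL ^ r with hQ
  set Z := Real.exp (B * T) * (D * Q) with hZ
  have hD0 : 0 < D := by positivity
  have hZ0 : 0 < Z := by positivity
  obtain ⟨B', hB', hlarge⟩ := evolution_bound (r := r) (d := d) (T := T)
    (A := A * (Z ^ 2 + (Z ^ 2) ^ (k+1))) hk hs hc hβ hγ hCCFL hCs hCr (by positivity) hu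
  refine ⟨2 * ((Real.exp (B * T) + Real.exp (B' * T)) * D) + 2 * KG, by positivity, ?_⟩
  intro N _ pt h hq hh1 τ nstar hτ hτ1 hTn hcfl Pc hPc L Fτ hL hF hst hres u0 uh uσ hu0 hev hlow
    hinit n hn
  have h0 := h.meshSize_pos
  set H := meshSize pt with hH
  set E := H ^ (k+1) + τ ^ r with hE
  have hE0 : 0 ≤ E := by positivity
  have hHE : H ^ (k+1) ≤ E := le_add_of_nonneg_right (by positivity)
  have hcfl' : τ ≤ CCFL * H := hcfl.trans <| by
    gcongr
    simpa using Real.rpow_le_rpow_of_exponent_ge h0 hh1 hκ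
  have hEQ : E ≤ Q * (H * H) := by
    have e1 : H ^ (k+1) ≤ H * H := by
      rw [← pow_two]
      exact pow_le_pow_of_le_one h0.le hh1 (by omega)
    have e2 : τ ^ r ≤ CCFL ^ r * (H * H) := by
      calc τ ^ r ≤ (CCFL * H) ^ r := by gcongr
        _ = CCFL ^ r * H ^ r := mul_pow _ _ _
        _ ≤ CCFL ^ r * (H * H) := by
            rw [← pow_two]
            have := pow_le_pow_of_le_one h0.le hh1 hr
            gcongr
    rw [hE, hQ]
    linarith
  have hmem := hev.memVk hL hF hu0
  have hst' := stable_of_weak hL hCs hτ.le hst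
  have hpr : ∀ (n ℓ : ℕ), ℓ ≤ s →
      (∀ m ≤ k, ∀ j, H ^ m * |jumpD pt (grP k pt (UrefS u c d β τ s n ℓ)) m j| ≤ KG * H ^ (k+1)) ∧
      (∀ j, ∃ a, ∀ x ∈ Set.Icc (ptL pt j) (ptR pt j),
        |(grP k pt (UrefS u c d β τ s n ℓ) j).eval x - a| ≤ KG * H) ∧
      ∀ j, ∀ x ∈ Set.Icc (ptL pt j) (ptR pt j),
        |(grP k pt (UrefS u c d β τ s n ℓ) j).eval x - UrefS u c d β τ s n ℓ x|
          ≤ KG * H ^ (k+1) := fun n ℓ hℓ =>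
    hproj N pt h hq hh1 (⟨(τ, n), hτ, hτ1⟩, ⟨ℓ, Nat.lt_succ_of_le hℓ⟩)
  have hcont : ∀ (n ℓ : ℕ), ℓ ≤ s → Continuous (UrefS u c d β τ s n ℓ) := fun n ℓ hℓ =>
    (hFam.1 (⟨(τ, n), hτ, hτ1⟩, ⟨ℓ, Nat.lt_succ_of_le hℓ⟩)).continuous
  have hoe' : ∀ n, ∀ ℓ < s,
      H * √H * l2 pt (uσ n (ℓ+1) - uh n (ℓ+1)) ≤ τ * A
        * (l2 pt (uh n (ℓ+1) - grP k pt (UrefS u c d β τ s n (ℓ+1))) + H * √H)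
        * (l2 pt (uh n (ℓ+1) - grP k pt (UrefS u c d β τ s n (ℓ+1))) + H ^ (k+1)) ∧
      H * l2 pt (uσ n (ℓ+1) - uh n (ℓ+1)) ≤ τ * A
        * (l2 pt (uh n (ℓ+1) - grP k pt (UrefS u c d β τ s n (ℓ+1))) + H) := fun n ℓ hℓ => by
    have hGk : MemVk k (grP k pt (UrefS u c d β τ s n (ℓ+1))) := h.memVk_grP (hcont n (ℓ+1) hℓ)
    have huk : MemVk k (uh n (ℓ+1)) := by
      rw [((hev.2 n).2 ℓ hℓ).1]
      exact hL.memVk_rkStage c d τ fun m hm => hmem n m (by omega)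
    obtain ⟨w, hw, hFw⟩ := hF _ huk
    have e := hoe N pt h hq Pc hPc _ (hpr n (ℓ+1) hℓ).1 (hpr n (ℓ+1) hℓ).2.1 hGk _ huk
      (hlow n (ℓ+1) (by omega) hℓ) τ hτ.le w hw
    rw [← hFw, ← ((hev.2 n).2 ℓ hℓ).2] at e
    exact e
  have hx0 : l2 pt (uσ 0 0 - grP k pt (UrefS u c d β τ s 0 0)) + E ≤ D * E := by
    have e := h.l2_sub_le_errL2 (hcont 0 0 (by omega)) (uσ 0 0) _ (by positivity)
      (hpr 0 0 (by omega)).2.2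
    have e1 : UrefS u c d β τ s 0 0 = fun x => u x 0 := by
      rw [UrefS_zero u c d β τ hs]
      simp
    beta_reduce at e
    rw [e1, hev.1] at e ⊢
    have e2 := mul_le_mul_of_nonneg_left hHE (show 0 ≤ 2 * C0 + 2 * KG by positivity)
    rw [hD]
    linarith
  have hfin : l2 pt (uσ n 0 - grP k pt (UrefS u c d β τ s n 0)) + E
      ≤ (Real.exp (B * T) + Real.exp (B' * T)) * D * E := by
    have hDE : 0 ≤ D * E := by positivity
    rcases le_or_gt (Z * √H) 1 with hcase | hcase
    · have hs0 : 0 < √H := Real.sqrt_pos.2 h0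
      have hss : √H * √H = H := Real.mul_self_sqrt h0.le
      have hHs : 0 < H * √H := by positivity
      have e := hsmall N pt h hq τ nstar hτ hτ1 hTn hcfl' L hL hst' hres uh uσ hmem
        (fun n => (hev.2 n).1) (fun n ℓ hℓ => ((hev.2 n).2 ℓ hℓ).1) (H * √H)⁻¹ (by positivity)
        (fun n ℓ hℓ => ?_) ?_ n hn
      · refine e.trans ?_
        calc _ ≤ Real.exp (B * T) * (D * E) := by gcongr
          _ ≤ _ := by
            have : 0 ≤ Real.exp (B' * T) * (D * E) := by positivity
            linarith
      · have e := (hoe' n ℓ hℓ).1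
        have hb := l2_nonneg (pt := pt) (uh n (ℓ+1) - grP k pt (UrefS u c d β τ s n (ℓ+1)))
        set b := l2 pt (uh n (ℓ+1) - grP k pt (UrefS u c d β τ s n (ℓ+1)))
        refine le_of_mul_le_mul_left (e.trans ?_) hHs
        calc τ * A * (b + H * √H) * (b + H ^ (k+1))
            ≤ τ * A * (b + H * √H) * (b + E) := by gcongr
          _ = H * √H * (τ * A * (1 + (H * √H)⁻¹ * b) * (b + E)) := by
              field_simp
              ring
      · rw [inv_mul_le_iff₀ hHs, mul_one]
        calc _ ≤ Real.exp (B * T) * (D * (Q * (H * H))) := by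
              refine mul_le_mul_of_nonneg_left (hx0.trans ?_) (Real.exp_pos _).le
              gcongr
          _ = Z * √H * (H * √H) := by
              rw [hZ]
              nth_rw 2 [← hss]
              ring
          _ ≤ 1 * (H * √H) := by gcongr
          _ = H * √H := one_mul _
    · have hZH : 1 ≤ Z ^ 2 * H := by
        calc 1 ≤ (Z * √H) ^ 2 := one_le_pow₀ hcase.le
          _ = Z ^ 2 * H := by rw [mul_pow, Real.sq_sqrt h0.le]
      have e := hlarge N pt h hq τ nstar hτ hτ1 hTn hcfl' L hL hst' hres uh uσ hmem
        (fun n => (hev.2 n).1) (fun n ℓ hℓ => ((hev.2 n).2 ℓ hℓ).1) 0 le_rfl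
        (fun n ℓ hℓ => ?_) (by simp) n hn
      · refine e.trans ?_
        calc _ ≤ Real.exp (B' * T) * (D * E) := by gcongr
          _ ≤ _ := by
            have : 0 ≤ Real.exp (B * T) * (D * E) := by positivity
            linarith
      · have e := (hoe' n ℓ hℓ).2
        have hb := l2_nonneg (pt := pt) (uh n (ℓ+1) - grP k pt (UrefS u c d β τ s n (ℓ+1)))
        set b := l2 pt (uh n (ℓ+1) - grP k pt (UrefS u c d β τ s n (ℓ+1)))
        have hZE : 1 ≤ (Z ^ 2) ^ (k+1) * E := by
          calc 1 ≤ (Z ^ 2 * H) ^ (k+1) := one_le_pow₀ hZH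
            _ = (Z ^ 2) ^ (k+1) * H ^ (k+1) := mul_pow _ _ _
            _ ≤ _ := by gcongr
        refine le_of_mul_le_mul_left (e.trans ?_) h0
        have t1 : b ≤ H * (Z ^ 2 * b) := by
          calc b = 1 * b := (one_mul b).symm
            _ ≤ Z ^ 2 * H * b := by gcongr
            _ = _ := by ring
        have t2 : H ≤ H * ((Z ^ 2) ^ (k+1) * E) := le_mul_of_one_le_right h0.le hZE
        have t3 : 0 ≤ H * ((Z ^ 2) ^ (k+1) * b + Z ^ 2 * E) := by positivity
        calc τ * A * (b + H)
            ≤ τ * A * (H * (Z ^ 2 * b) + H * ((Z ^ 2) ^ (k+1) * E)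
              + H * ((Z ^ 2) ^ (k+1) * b + Z ^ 2 * E)) := by
              refine mul_le_mul_of_nonneg_left ?_ (by positivity)
              linarith
          _ = _ := by ring
  have e := h.errL2_le (hcont n 0 (by omega)) (uσ n 0) _ (by positivity)
    (hpr n 0 (by omega)).2.2
  beta_reduce at e
  have e2 := mul_le_mul_of_nonneg_left hHE hKG.le
  rw [UrefS_zero u c d β τ hs] at e hfin
  linarith

end OEDG
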